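/- Let H_1,…,H_k be Euclidean spaces with dim H_i = n_i ≥ 1, let B_i : ℝ^n → H_i be surjective linear maps, and let c_1,…,c_k > 0 satisfy ∑_{i=1}^k c_i n_i = n. Then for all non-negative f_i ∈ L^1(H_i), ∫*_{ℝ^n} sup{∏_{i=1}^k f_i(x_i)^{c_i} : x = ∑_{i=1}^k c_i B_i^* x_i, x_i ∈ H_i} dx ≥ D ∏_{i=1}^k (∫_{H_i} f_i)^{c_i}, where D is the largest constant for which the inequality holds for all centered Gaussian inputs f_i(x) = e^{−⟨A_i x, x⟩} with A_i : H_i → H_i positive definite; that is, D is the infimum over such Gaussians of the ratio of the left-hand side to ∏_{i=1}^k (∫_{H_i} f_i)^{c_i}. -/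

import Mathlib

open MeasureTheory
open scoped ENNReal RealInnerProductSpace

/-- The outer integral of a (possibly non-measurable) non-negative function: the infimum
of the integrals of measurable functions dominating it. -/
noncomputable def outerLintegral {α : Type*} [MeasurableSpace α] (μ : Measure α)
    (f : α → ℝ≥0∞) : ℝ≥0∞ :=
  ⨅ (g : α → ℝ≥0∞) (_ : Measurable g) (_ : ∀ x, f x ≤ g x), ∫⁻ x, g x ∂μ

/-- A linear map `A` on a real inner product space is positive definite if it is
self-adjoint and `⟪x, Ax⟫ > 0` for all `x ≠ 0`. -/
def IsPosDefMap {H : Type*} [NormedAddCommGroup H] [InnerProductSpace ℝ H]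
    (A : H →ₗ[ℝ] H) : Prop :=
  (∀ x y : H, ⟪A x, y⟫ = ⟪x, A y⟫) ∧ ∀ x : H, x ≠ 0 → 0 < ⟪x, A x⟫

section ReverseBrascampLieb

open Filter Topology ProbabilityTheory
set_option linter.unusedSectionVars false

section GaussianAverages

variable {V : Type*} [NormedAddCommGroup V] [InnerProductSpace ℝ V]

/-- A positive function whose logarithm is `ℓ`-Lipschitz. -/
structure LogLip (ℓ : ℝ) (f : V → ℝ) : Prop where
  nonneg : 0 ≤ ℓ
  pos : ∀ x, 0 < f x
  le : ∀ x y, f x ≤ f y * Real.exp (ℓ * ‖x - y‖)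

namespace LogLip

variable {ℓ : ℝ} {f : V → ℝ}

lemma abs_log_sub_le (hf : LogLip ℓ f) (x y : V) :
    |Real.log (f x) - Real.log (f y)| ≤ ℓ * ‖x - y‖ := by
  have key : ∀ a b : V, Real.log (f a) - Real.log (f b) ≤ ℓ * ‖a - b‖ := fun a b => by
    have h := Real.log_le_log (hf.pos a) (hf.le a b)
    rw [Real.log_mul (hf.pos b).ne' (Real.exp_pos _).ne', Real.log_exp] at h
    linarith
  refine abs_sub_le_iff.2 ⟨key x y, ?_⟩
  rw [norm_sub_rev]
  exact key y x

lemma continuous (hf : LogLip ℓ f) : Continuous f := by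
  have h : LipschitzWith ℓ.toNNReal (fun x => Real.log (f x)) :=
    LipschitzWith.of_dist_le_mul fun x y => by
      rw [Real.dist_eq, dist_eq_norm, Real.coe_toNNReal _ hf.nonneg]
      exact hf.abs_log_sub_le x y
  have : f = fun x => Real.exp (Real.log (f x)) := by
    ext x; rw [Real.exp_log (hf.pos x)]
  rw [this]
  exact Real.continuous_exp.comp h.continuous

lemma ge (hf : LogLip ℓ f) (x y : V) : f y * Real.exp (-(ℓ * ‖x - y‖)) ≤ f x := by
  have h := hf.le y x
  rw [norm_sub_rev] at h
  calc f y * Real.exp (-(ℓ * ‖x - y‖))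
      ≤ f x * Real.exp (ℓ * ‖x - y‖) * Real.exp (-(ℓ * ‖x - y‖)) := by gcongr
    _ = f x := by rw [mul_assoc, ← Real.exp_add]; simp

lemma mono (hf : LogLip ℓ f) {ℓ' : ℝ} (h : ℓ ≤ ℓ') : LogLip ℓ' f where
  nonneg := hf.nonneg.trans h
  pos := hf.pos
  le x y := (hf.le x y).trans (by have := (hf.pos y).le; gcongr)

lemma rpow (hf : LogLip ℓ f) {p : ℝ} (hp : 0 ≤ p) : LogLip (p * ℓ) (fun x => f x ^ p) where
  nonneg := mul_nonneg hp hf.nonneg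
  pos x := Real.rpow_pos_of_pos (hf.pos x) _
  le x y := by
    refine (Real.rpow_le_rpow (hf.pos x).le (hf.le x y) hp).trans_eq ?_
    rw [Real.mul_rpow (hf.pos y).le (Real.exp_pos _).le, ← Real.exp_mul]
    ring_nf

lemma comp_clm {W : Type*} [NormedAddCommGroup W] [InnerProductSpace ℝ W]
    (hf : LogLip ℓ f) (T : W →L[ℝ] V) : LogLip (ℓ * ‖T‖) (fun x => f (T x)) where
  nonneg := mul_nonneg hf.nonneg (norm_nonneg _)
  pos x := hf.pos _
  le x y := by
    refine (hf.le (T x) (T y)).trans ?_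
    have h1 := (hf.pos (T y)).le
    have h2 := hf.nonneg
    rw [← map_sub, mul_assoc ℓ]
    gcongr
    exact T.le_opNorm _

end LogLip

variable [FiniteDimensional ℝ V] [MeasurableSpace V] [BorelSpace V]

lemma integrable_exp_neg_mul_sq_norm {b : ℝ} (hb : 0 < b) :
    Integrable (fun w : V => Real.exp (-b * ‖w‖ ^ 2)) := by
  have h := (GaussianFourier.integrable_cexp_neg_mul_sq_norm_add (V := V) (b := (b : ℂ))
    (by simpa using hb) 0 0).norm
  refine h.congr (ae_of_all _ fun w => ?_)
  simp [Complex.norm_exp, ← Complex.ofReal_pow]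

lemma integrable_exp_quadratic_norm {b : ℝ} (hb : 0 < b) (s : ℝ) :
    Integrable (fun w : V => Real.exp (-b * ‖w‖ ^ 2 + s * ‖w‖)) := by
  refine ((integrable_exp_neg_mul_sq_norm (V := V) (half_pos hb)).const_mul
    (Real.exp (s ^ 2 / (2 * b)))).mono' (by fun_prop) (ae_of_all _ fun w => ?_)
  rw [Real.norm_of_nonneg (Real.exp_pos _).le, ← Real.exp_add]
  refine Real.exp_le_exp.2 ?_
  have : s ^ 2 / (2 * b) + -(b / 2) * ‖w‖ ^ 2 - (-b * ‖w‖ ^ 2 + s * ‖w‖)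
      = (s - b * ‖w‖) ^ 2 / (2 * b) := by field_simp; ring
  have h2 : 0 ≤ (s - b * ‖w‖) ^ 2 / (2 * b) := by positivity
  linarith

/-- The average of `f` against `exp (-‖w‖² / 4)`, dilated by `√t` and centred at `x`: up to a
constant, the solution of the heat equation with initial datum `f`. -/
noncomputable def heat (f : V → ℝ) (t : ℝ) (x : V) : ℝ :=
  ∫ w, Real.exp (-‖w‖ ^ 2 / 4) * f (x + √t • w)

/-- The measure with density `exp (-‖w‖² / 4) f (x + √t w)`. -/
noncomputable def heatMeasure (f : V → ℝ) (t : ℝ) (x : V) : Measure V :=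
  volume.withDensity fun w => ENNReal.ofReal (Real.exp (-‖w‖ ^ 2 / 4) * f (x + √t • w))

variable {ℓ : ℝ} {f : V → ℝ}

lemma LogLip.shift_le (hf : LogLip ℓ f) (t : ℝ) (x w : V) :
    f (x + √t • w) ≤ f x * Real.exp (ℓ * √t * ‖w‖) := by
  refine (hf.le _ x).trans_eq ?_
  rw [add_sub_cancel_left, norm_smul, Real.norm_of_nonneg (Real.sqrt_nonneg t), mul_assoc]

lemma LogLip.shift_ge (hf : LogLip ℓ f) (t : ℝ) (x w : V) :
    f x * Real.exp (-(ℓ * √t) * ‖w‖) ≤ f (x + √t • w) := by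
  refine le_trans (le_of_eq ?_) (hf.ge _ x)
  rw [add_sub_cancel_left, norm_smul, Real.norm_of_nonneg (Real.sqrt_nonneg t), ← mul_assoc,
    neg_mul]

/-- Integrability against the Gaussian of functions of subgaussian growth. -/
lemma LogLip.integrable_mul (hf : LogLip ℓ f) (t : ℝ) (x : V) {φ : V → ℝ}
    (hφ : Continuous φ) {C b s : ℝ} (hb : b < 1 / 4)
    (h : ∀ w, |φ w| ≤ C * Real.exp (b * ‖w‖ ^ 2 + s * ‖w‖)) :
    Integrable (fun w => (Real.exp (-‖w‖ ^ 2 / 4) * f (x + √t • w)) * φ w) := by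
  have hc := hf.continuous
  refine ((integrable_exp_quadratic_norm (V := V) (b := 1 / 4 - b) (by linarith)
    (s + ℓ * √t)).const_mul (f x * C)).mono' (by fun_prop) (ae_of_all _ fun w => ?_)
  rw [norm_mul, norm_mul, Real.norm_of_nonneg (Real.exp_pos _).le,
    Real.norm_of_nonneg (hf.pos _).le, Real.norm_eq_abs]
  have h0 := (hf.pos x).le
  have h1 := (hf.pos (x + √t • w)).le
  calc Real.exp (-‖w‖ ^ 2 / 4) * f (x + √t • w) * |φ w|
      ≤ Real.exp (-‖w‖ ^ 2 / 4) * (f x * Real.exp (ℓ * √t * ‖w‖)) *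
        (C * Real.exp (b * ‖w‖ ^ 2 + s * ‖w‖)) := by
        gcongr
        · exact hf.shift_le t x w
        · exact h w
    _ = f x * C * (Real.exp (-‖w‖ ^ 2 / 4) * Real.exp (ℓ * √t * ‖w‖) *
        Real.exp (b * ‖w‖ ^ 2 + s * ‖w‖)) := by ring
    _ = _ := by rw [← Real.exp_add, ← Real.exp_add]; ring_nf

lemma LogLip.integrable_heat (hf : LogLip ℓ f) (t : ℝ) (x : V) :
    Integrable (fun w => Real.exp (-‖w‖ ^ 2 / 4) * f (x + √t • w)) := by
  simpa using hf.integrable_mul t x (φ := fun _ => 1) continuous_const (C := 1) (b := 0) (s := 0)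
    (by norm_num) (by simp)

lemma LogLip.heat_pos (hf : LogLip ℓ f) (t : ℝ) (x : V) : 0 < heat f t x := by
  refine (integral_pos_iff_support_of_nonneg (fun w => ?_) (hf.integrable_heat t x)).2 ?_
  · exact mul_nonneg (Real.exp_pos _).le (hf.pos _).le
  · have : Function.support (fun w => Real.exp (-‖w‖ ^ 2 / 4) * f (x + √t • w)) = Set.univ := by
      ext w; simp [(hf.pos _).ne']
    rw [this]
    exact isOpen_univ.measure_pos _ Set.univ_nonempty

lemma LogLip.integral_heatMeasure (hf : LogLip ℓ f) (t : ℝ) (x : V) (φ : V → ℝ) :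
    ∫ w, φ w ∂(heatMeasure f t x) = ∫ w, (Real.exp (-‖w‖ ^ 2 / 4) * f (x + √t • w)) * φ w := by
  have hc := hf.continuous
  rw [heatMeasure, integral_withDensity_eq_integral_toReal_smul (by fun_prop) (by simp)]
  refine integral_congr_ae (ae_of_all _ fun w => ?_)
  have := (hf.pos (x + √t • w)).le
  simp only [smul_eq_mul]
  rw [ENNReal.toReal_ofReal (by positivity)]

lemma LogLip.integrable_heatMeasure (hf : LogLip ℓ f) (t : ℝ) (x : V) {φ : V → ℝ}
    (h : Integrable (fun w => (Real.exp (-‖w‖ ^ 2 / 4) * f (x + √t • w)) * φ w)) :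
    Integrable φ (heatMeasure f t x) := by
  have hc := hf.continuous
  rw [heatMeasure, integrable_withDensity_iff (by fun_prop) (by simp)]
  refine h.congr (ae_of_all _ fun w => ?_)
  have := (hf.pos (x + √t • w)).le
  simp only
  rw [ENNReal.toReal_ofReal (by positivity), mul_comm]

end GaussianAverages

lemma tendsto_symmetric_second_difference {φ : ℝ → ℝ} (hφ : AnalyticAt ℝ φ 0) :
    Tendsto (fun s => (φ s + φ (-s) - 2 * φ 0) / s ^ 2) (𝓝[≠] 0) (𝓝 (deriv (deriv φ) 0)) := by
  have hneg : Tendsto (fun s : ℝ => -s) (𝓝 0) (𝓝 0) := by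
    simpa using (continuous_neg (G := ℝ)).tendsto 0
  have hev : ∀ᶠ s in 𝓝 (0 : ℝ), HasDerivAt φ (deriv φ s) s :=
    hφ.eventually_analyticAt.mono fun s hs => hs.differentiableAt.hasDerivAt
  refine HasDerivAt.lhopital_zero_nhdsNE (f' := fun s => deriv φ s - deriv φ (-s))
    (g' := fun s => 2 * s) ?_ ?_ ?_ ?_ ?_ ?_
  · refine eventually_nhdsWithin_of_eventually_nhds ?_
    filter_upwards [hev, hneg.eventually hev] with s h1 h2
    have h3 : HasDerivAt (fun s => φ (-s)) (-deriv φ (-s)) s := by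
      simpa [Function.comp_def] using h2.comp s (hasDerivAt_neg s)
    simpa [sub_eq_add_neg] using (h1.add h3).sub_const (2 * φ 0)
  · refine Eventually.of_forall fun s => ?_
    simpa using hasDerivAt_pow 2 s
  · filter_upwards [self_mem_nhdsWithin] with s hs
    simpa using hs
  · have h := hφ.continuousAt.tendsto
    have := (h.add (h.comp hneg)).sub_const (2 * φ 0)
    refine (this.mono_left nhdsWithin_le_nhds).trans (le_of_eq ?_)
    congr 1; ring
  · have : Tendsto (fun s : ℝ => s ^ 2) (𝓝 0) (𝓝 (0 ^ 2)) := (continuous_pow 2).tendsto 0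
    simpa using this.mono_left nhdsWithin_le_nhds
  · have h1 : HasDerivAt (deriv φ) (deriv (deriv φ) 0) 0 := hφ.deriv.differentiableAt.hasDerivAt
    have h2 : HasDerivAt (fun s => deriv φ (-s)) (-deriv (deriv φ) 0) 0 := by
      have h1' : HasDerivAt (deriv φ) (deriv (deriv φ) 0) (-0) := by simpa using h1
      simpa [Function.comp_def] using h1'.comp (0 : ℝ) (hasDerivAt_neg (0 : ℝ))
    have h3 := (hasDerivAt_iff_tendsto_slope.1 (h1.sub h2)).div_const 2
    refine (h3.congr' ?_).trans (le_of_eq ?_)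
    · filter_upwards [self_mem_nhdsWithin] with s hs
      have hs : s ≠ 0 := hs
      simp only [slope_def_field, Pi.sub_apply, neg_zero, sub_self, sub_zero]
      field_simp
    · congr 1; ring

section GaussianAverages

variable {V : Type*} [NormedAddCommGroup V] [InnerProductSpace ℝ V]
  [FiniteDimensional ℝ V] [MeasurableSpace V] [BorelSpace V] {ℓ : ℝ} {f : V → ℝ}

variable (V) in
/-- The exponential moments of the norm under the (unnormalised) Gaussian measure. -/
noncomputable def gaussNormMgf (s : ℝ) : ℝ :=
  ∫ w : V, Real.exp (-‖w‖ ^ 2 / 4) * Real.exp (s * ‖w‖)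

lemma integrable_gaussNormMgf (s : ℝ) :
    Integrable (fun w : V => Real.exp (-‖w‖ ^ 2 / 4) * Real.exp (s * ‖w‖)) := by
  refine (integrable_exp_quadratic_norm (V := V) (b := 1 / 4) (by norm_num) s).congr
    (ae_of_all _ fun w => ?_)
  simp only
  rw [← Real.exp_add]
  ring_nf

lemma gaussNormMgf_mono : Monotone (gaussNormMgf V) := fun s s' h =>
  integral_mono (integrable_gaussNormMgf s) (integrable_gaussNormMgf s') fun w => by
    gcongr

lemma gaussNormMgf_pos (s : ℝ) : 0 < gaussNormMgf V s := by
  refine (integral_pos_iff_support_of_nonneg (fun w => by positivity)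
    (integrable_gaussNormMgf s)).2 ?_
  have : Function.support (fun w : V => Real.exp (-‖w‖ ^ 2 / 4) * Real.exp (s * ‖w‖))
      = Set.univ := by
    ext w; simp
  rw [this]
  exact isOpen_univ.measure_pos _ Set.univ_nonempty

lemma continuous_gaussNormMgf : Continuous (gaussNormMgf V) := by
  refine continuous_iff_continuousAt.2 fun s₀ => ?_
  refine continuousAt_of_dominated (bound := fun w : V => Real.exp (-‖w‖ ^ 2 / 4) *
    Real.exp ((s₀ + 1) * ‖w‖)) (Eventually.of_forall fun s =>
      (integrable_gaussNormMgf s).aestronglyMeasurable) ?_ (integrable_gaussNormMgf _)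
    (ae_of_all _ fun w => by fun_prop)
  filter_upwards [Iio_mem_nhds (lt_add_one s₀)] with s hs
  refine ae_of_all _ fun w => ?_
  have hs : s ≤ s₀ + 1 := le_of_lt hs
  rw [Real.norm_of_nonneg (by positivity)]
  gcongr

lemma LogLip.heat_le (hf : LogLip ℓ f) (t : ℝ) (x : V) :
    heat f t x ≤ f x * gaussNormMgf V (ℓ * √t) := by
  rw [heat, gaussNormMgf, ← integral_const_mul]
  refine integral_mono (hf.integrable_heat t x) ((integrable_gaussNormMgf _).const_mul _)
    fun w => ?_
  calc _ ≤ Real.exp (-‖w‖ ^ 2 / 4) * (f x * Real.exp (ℓ * √t * ‖w‖)) := by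
        have := hf.shift_le t x w
        gcongr
    _ = _ := by ring

lemma LogLip.heat_ge (hf : LogLip ℓ f) (t : ℝ) (x : V) :
    f x * gaussNormMgf V (-(ℓ * √t)) ≤ heat f t x := by
  rw [heat, gaussNormMgf, ← integral_const_mul]
  refine integral_mono ((integrable_gaussNormMgf _).const_mul _) (hf.integrable_heat t x)
    fun w => ?_
  calc f x * (Real.exp (-‖w‖ ^ 2 / 4) * Real.exp (-(ℓ * √t) * ‖w‖))
      = Real.exp (-‖w‖ ^ 2 / 4) * (f x * Real.exp (-(ℓ * √t) * ‖w‖)) := by ring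
    _ ≤ _ := by
        have := hf.shift_ge t x w
        gcongr

lemma LogLip.logLip_heat (hf : LogLip ℓ f) (t : ℝ) : LogLip ℓ (heat f t) where
  nonneg := hf.nonneg
  pos x := hf.heat_pos t x
  le x y := by
    rw [heat, heat, ← integral_mul_const]
    refine integral_mono (hf.integrable_heat t x) ((hf.integrable_heat t y).mul_const _)
      fun w => ?_
    have := hf.le (x + √t • w) (y + √t • w)
    rw [add_sub_add_right_eq_sub] at this
    simp only
    rw [mul_assoc]
    gcongr

lemma LogLip.continuous_heat (hf : LogLip ℓ f) :
    Continuous (fun p : ℝ × V => heat f p.1 p.2) := by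
  have hc := hf.continuous
  refine continuous_iff_continuousAt.2 fun ⟨t₀, x₀⟩ => ?_
  refine continuousAt_of_dominated (bound := fun w : V => f x₀ * Real.exp ℓ *
    (Real.exp (-‖w‖ ^ 2 / 4) * Real.exp ((ℓ * √(t₀ + 1)) * ‖w‖)))
    (Eventually.of_forall fun p => (hf.integrable_heat p.1 p.2).aestronglyMeasurable) ?_
    ((integrable_gaussNormMgf _).const_mul _) (ae_of_all _ fun w => by fun_prop)
  filter_upwards [prod_mem_nhds (Iio_mem_nhds (lt_add_one t₀)) (Metric.ball_mem_nhds x₀ one_pos)]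
    with ⟨t, x⟩ ⟨ht, hx⟩
  refine ae_of_all _ fun w => ?_
  have ht : t ≤ t₀ + 1 := le_of_lt ht
  have hx : ‖x - x₀‖ ≤ 1 := by
    rw [← dist_eq_norm]; exact (Metric.mem_ball.1 hx).le
  have h0 := (hf.pos x₀).le
  have h1 := (hf.pos x).le
  have h2 := hf.nonneg
  rw [Real.norm_of_nonneg (mul_nonneg (Real.exp_pos _).le (hf.pos _).le)]
  calc Real.exp (-‖w‖ ^ 2 / 4) * f (x + √t • w)
      ≤ Real.exp (-‖w‖ ^ 2 / 4) * (f x * Real.exp (ℓ * √t * ‖w‖)) := by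
        have := hf.shift_le t x w
        gcongr
    _ ≤ Real.exp (-‖w‖ ^ 2 / 4) * ((f x₀ * Real.exp (ℓ * ‖x - x₀‖)) *
        Real.exp (ℓ * √(t₀ + 1) * ‖w‖)) := by
        have := hf.le x x₀
        gcongr
    _ ≤ Real.exp (-‖w‖ ^ 2 / 4) * ((f x₀ * Real.exp (ℓ * 1)) *
        Real.exp (ℓ * √(t₀ + 1) * ‖w‖)) := by gcongr
    _ = _ := by rw [mul_one]; ring

end GaussianAverages

section GaussianAverages

variable {V : Type*} [NormedAddCommGroup V] [InnerProductSpace ℝ V]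
  [FiniteDimensional ℝ V] [MeasurableSpace V] [BorelSpace V] {ℓ : ℝ} {f : V → ℝ}

/-- The logarithmic gradient of `heat f t` at `x`. -/
noncomputable def heatGrad (f : V → ℝ) (t : ℝ) (x : V) : V :=
  ((2 * √t)⁻¹ * (heat f t x)⁻¹) • ∫ w, w ∂(heatMeasure f t x)

/-- The normalised second moment of `heatMeasure f t x` in the direction `v`. -/
noncomputable def heatSq (f : V → ℝ) (t : ℝ) (x v : V) : ℝ :=
  (∫ w, (⟪w, v⟫ / (2 * √t)) ^ 2 ∂(heatMeasure f t x)) / heat f t x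

/-- The normalised trace of the second moments of `heatMeasure f t x`. -/
noncomputable def heatEnergy (f : V → ℝ) (t : ℝ) (x : V) : ℝ :=
  (∫ w, ‖w‖ ^ 2 / 4 ∂(heatMeasure f t x)) / heat f t x * t⁻¹

namespace LogLip

lemma real_heatMeasure_univ (hf : LogLip ℓ f) (t : ℝ) (x : V) :
    (heatMeasure f t x).real Set.univ = heat f t x := by
  have h := hf.integral_heatMeasure t x (fun _ => 1)
  simpa [heat] using h

lemma isFiniteMeasure_heatMeasure (hf : LogLip ℓ f) (t : ℝ) (x : V) :
    IsFiniteMeasure (heatMeasure f t x) := by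
  refine ⟨lt_top_iff_ne_top.2 fun h => ?_⟩
  have h1 := hf.real_heatMeasure_univ t x
  rw [measureReal_def, h] at h1
  simpa using (hf.heat_pos t x).trans_eq h1.symm

lemma integrable_heatMeasure_exp (hf : LogLip ℓ f) (t : ℝ) (x : V) {φ : V → ℝ}
    (hφ : Continuous φ) {C b s : ℝ} (hb : b < 1 / 4)
    (h : ∀ w, |φ w| ≤ C * Real.exp (b * ‖w‖ ^ 2 + s * ‖w‖)) :
    Integrable φ (heatMeasure f t x) :=
  hf.integrable_heatMeasure t x (hf.integrable_mul t x hφ hb h)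

lemma integrable_sq_norm (hf : LogLip ℓ f) (t : ℝ) (x : V) :
    Integrable (fun w : V => ‖w‖ ^ 2) (heatMeasure f t x) := by
  refine hf.integrable_heatMeasure_exp t x (C := 2) (b := 0) (s := 1) (by fun_prop) (by norm_num)
    fun w => ?_
  have := Real.quadratic_le_exp_of_nonneg (norm_nonneg w)
  rw [abs_of_nonneg (by positivity)]
  simp only [zero_mul, zero_add, one_mul]
  nlinarith [norm_nonneg w]

lemma integrable_id (hf : LogLip ℓ f) (t : ℝ) (x : V) :
    Integrable (fun w : V => w) (heatMeasure f t x) := by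
  have := hf.isFiniteMeasure_heatMeasure t x
  refine (((integrable_const (1 : ℝ)).add (hf.integrable_sq_norm t x))).mono' (by fun_prop)
    (ae_of_all _ fun w => ?_)
  simp only [Pi.add_apply]
  nlinarith [sq_nonneg (‖w‖ - 1)]

lemma integrable_inner_sq (hf : LogLip ℓ f) (t : ℝ) (x v : V) :
    Integrable (fun w : V => (⟪w, v⟫ / (2 * √t)) ^ 2) (heatMeasure f t x) := by
  refine ((hf.integrable_sq_norm t x).mul_const ((‖v‖ / (2 * √t)) ^ 2)).mono' (by fun_prop)
    (ae_of_all _ fun w => ?_)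
  have h := abs_real_inner_le_norm w v
  rw [Real.norm_of_nonneg (by positivity), div_pow, div_pow, ← mul_div_assoc, ← mul_pow,
    ← sq_abs ⟪w, v⟫]
  gcongr

lemma mem_interior_inner (hf : LogLip ℓ f) (t : ℝ) (x v : V) (s : ℝ) :
    s ∈ interior (integrableExpSet (fun w => ⟪w, v⟫ / (2 * √t)) (heatMeasure f t x)) := by
  have : integrableExpSet (fun w => ⟪w, v⟫ / (2 * √t)) (heatMeasure f t x) = Set.univ := by
    refine Set.eq_univ_of_forall fun s => ?_
    refine hf.integrable_heatMeasure_exp t x (C := 1) (b := 0) (s := |s| * (‖v‖ / (2 * √t)))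
      (by fun_prop) (by norm_num) fun w => ?_
    rw [abs_of_nonneg (Real.exp_pos _).le, one_mul, zero_mul, zero_add]
    refine Real.exp_le_exp.2 ((le_abs_self _).trans ?_)
    rw [abs_mul, abs_div, mul_assoc, abs_of_nonneg (show (0:ℝ) ≤ 2 * √t by positivity), div_mul_eq_mul_div,
      mul_comm ‖v‖]
    gcongr
    exact abs_real_inner_le_norm w v
  rw [this, interior_univ]
  trivial

lemma heat_add_smul (hf : LogLip ℓ f) {t : ℝ} (ht : 0 < t) (x v : V) (s : ℝ) :
    heat f t (x + s • v) = Real.exp (-s ^ 2 * (‖v‖ ^ 2 / (4 * t))) *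
      mgf (fun w => ⟪w, v⟫ / (2 * √t)) (heatMeasure f t x) s := by
  have hst : 0 < √t := Real.sqrt_pos.2 ht
  have hst2 : √t ^ 2 = t := Real.sq_sqrt ht.le
  rw [mgf, hf.integral_heatMeasure, heat, ← integral_const_mul]
  rw [← integral_sub_right_eq_self _ ((s / √t) • v)]
  refine integral_congr_ae (ae_of_all _ fun w => ?_)
  simp only
  have h1 : x + s • v + √t • (w - (s / √t) • v) = x + √t • w := by
    rw [smul_sub, smul_smul, mul_div_cancel₀ _ hst.ne']
    abel
  have h2 : -‖w - (s / √t) • v‖ ^ 2 / 4 =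
      -s ^ 2 * (‖v‖ ^ 2 / (4 * t)) + -‖w‖ ^ 2 / 4 + s * (⟪w, v⟫ / (2 * √t)) := by
    rw [norm_sub_sq_real, inner_smul_right, norm_smul, mul_pow, Real.norm_eq_abs, sq_abs, div_pow,
      hst2]
    field_simp
    rw [← hst2]
    ring
  rw [h1, h2, Real.exp_add, Real.exp_add]
  ring

lemma log_heat_add_smul (hf : LogLip ℓ f) {t : ℝ} (ht : 0 < t) (x v : V) (s : ℝ) :
    Real.log (heat f t (x + s • v)) = -s ^ 2 * (‖v‖ ^ 2 / (4 * t)) +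
      cgf (fun w => ⟪w, v⟫ / (2 * √t)) (heatMeasure f t x) s := by
  have h := hf.heat_add_smul ht x v s
  have hpos := hf.heat_pos t (x + s • v)
  rw [h] at hpos ⊢
  have h2 := pos_of_mul_pos_right hpos (Real.exp_pos _).le
  rw [Real.log_mul (Real.exp_pos _).ne' h2.ne', Real.log_exp, cgf]

lemma hasDerivAt_log_heat (hf : LogLip ℓ f) {t : ℝ} (ht : 0 < t) (x v : V) :
    HasDerivAt (fun s : ℝ => Real.log (heat f t (x + s • v))) ⟪heatGrad f t x, v⟫ 0 := by
  have h0 := hf.mem_interior_inner t x v 0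
  have h1 := (analyticAt_cgf h0).differentiableAt.hasDerivAt
  rw [deriv_cgf_zero h0, hf.real_heatMeasure_univ] at h1
  have h2 : HasDerivAt (fun s : ℝ => -s ^ 2 * (‖v‖ ^ 2 / (4 * t))) 0 0 := by
    simpa using ((hasDerivAt_pow 2 (0 : ℝ)).neg).mul_const (‖v‖ ^ 2 / (4 * t))
  have h3 := h2.add h1
  simp only [hf.log_heat_add_smul ht]
  refine h3.congr_deriv (Eq.symm ?_)
  change ⟪((2 * √t)⁻¹ * (heat f t x)⁻¹) • ∫ w, w ∂(heatMeasure f t x), v⟫ = _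
  rw [real_inner_smul_left, real_inner_comm, ← integral_inner (hf.integrable_id t x), integral_div]
  simp only [real_inner_comm v]
  field_simp
  ring

lemma tendsto_log_heat (hf : LogLip ℓ f) {t : ℝ} (ht : 0 < t) (x v : V) :
    Tendsto (fun s : ℝ => (Real.log (heat f t (x + s • v)) + Real.log (heat f t (x + (-s) • v))
      - 2 * Real.log (heat f t x)) / s ^ 2) (𝓝[≠] 0)
      (𝓝 (heatSq f t x v - ⟪heatGrad f t x, v⟫ ^ 2 - ‖v‖ ^ 2 / (2 * t))) := by
  have h0 := hf.mem_interior_inner t x v 0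
  have hd : deriv (cgf (fun w => ⟪w, v⟫ / (2 * √t)) (heatMeasure f t x)) 0
      = ⟪heatGrad f t x, v⟫ := by
    have h1 := hf.hasDerivAt_log_heat ht x v
    have h2 : HasDerivAt (fun s : ℝ => -s ^ 2 * (‖v‖ ^ 2 / (4 * t))) 0 0 := by
      simpa using ((hasDerivAt_pow 2 (0 : ℝ)).neg).mul_const (‖v‖ ^ 2 / (4 * t))
    have h3 := (h1.sub h2).deriv
    rw [sub_zero] at h3
    rw [← h3]
    congr 1
    ext s
    simp only [Pi.sub_apply]
    rw [hf.log_heat_add_smul ht]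
    ring
  have h2 := iteratedDeriv_two_cgf h0
  rw [iteratedDeriv_succ, iteratedDeriv_one, hd] at h2
  have h3 := (tendsto_symmetric_second_difference (analyticAt_cgf h0)).sub_const
    (‖v‖ ^ 2 / (2 * t))
  rw [h2] at h3
  refine (h3.congr' ?_).trans (le_of_eq ?_)
  · filter_upwards [self_mem_nhdsWithin] with s hs
    have hs : s ≠ 0 := hs
    have h4 := hf.log_heat_add_smul ht x v 0
    rw [zero_smul, add_zero] at h4
    rw [hf.log_heat_add_smul ht, hf.log_heat_add_smul ht, h4]
    field_simp
    ring
  · simp [heatSq, mgf, hf.real_heatMeasure_univ]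

lemma hasDerivAt_log_heat_time (hf : LogLip ℓ f) {t : ℝ} (ht : 0 < t) (x : V) :
    HasDerivAt (fun t' : ℝ => Real.log (heat f t' x))
      (heatEnergy f t x - Module.finrank ℝ V / (2 * t)) t := by
  have hset : 0 ∈ interior (integrableExpSet (fun w => ‖w‖ ^ 2 / 4) (heatMeasure f t x)) := by
    refine mem_interior.2 ⟨Set.Iio 1, fun s hs => ?_, isOpen_Iio, by simp⟩
    have hs : s < 1 := hs
    refine hf.integrable_heatMeasure_exp t x (C := 1) (b := s / 4) (s := 0)
      (by fun_prop) (by linarith) fun w => ?_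
    rw [abs_of_nonneg (Real.exp_pos _).le]
    simp only [one_mul, zero_mul, add_zero]
    exact le_of_eq (by ring_nf)
  have key : ∀ t' : ℝ, 0 < t' → heat f t' x = √(t / t') ^ Module.finrank ℝ V *
      mgf (fun w => ‖w‖ ^ 2 / 4) (heatMeasure f t x) (1 - t / t') := by
    intro t' ht'
    have hr : 0 < √(t / t') := Real.sqrt_pos.2 (by positivity)
    have h := Measure.integral_comp_smul_of_nonneg volume
      (fun w => Real.exp (-‖w‖ ^ 2 / 4) * f (x + √t' • w)) (√(t / t')) (hR := hr.le)
    rw [smul_eq_mul, ← heat, eq_comm, inv_mul_eq_iff_eq_mul₀ (by positivity)] at h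
    rw [h, mgf, hf.integral_heatMeasure]
    congr 1
    refine integral_congr_ae (ae_of_all _ fun w => ?_)
    simp only
    have h1 : √t' • √(t / t') • w = √t • w := by
      rw [smul_smul, ← Real.sqrt_mul ht'.le, mul_div_cancel₀ _ ht'.ne']
    have h2 : -‖√(t / t') • w‖ ^ 2 / 4 = -‖w‖ ^ 2 / 4 + (1 - t / t') * (‖w‖ ^ 2 / 4) := by
      rw [norm_smul, mul_pow, Real.norm_of_nonneg hr.le, Real.sq_sqrt (by positivity)]
      ring
    rw [h1, h2, Real.exp_add]
    ring
  have hlog : ∀ t' : ℝ, 0 < t' → Real.log (heat f t' x) =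
      Module.finrank ℝ V / 2 * (Real.log t - Real.log t') +
      cgf (fun w => ‖w‖ ^ 2 / 4) (heatMeasure f t x) (1 - t / t') := by
    intro t' ht'
    have hr : 0 < √(t / t') := Real.sqrt_pos.2 (by positivity)
    have hpos := hf.heat_pos t' x
    rw [key t' ht'] at hpos ⊢
    have h2 := pos_of_mul_pos_right hpos (by positivity)
    rw [Real.log_mul (by positivity) h2.ne', cgf, Real.log_pow, Real.log_sqrt (by positivity),
      Real.log_div ht.ne' ht'.ne']
    ring
  have h1 := (analyticAt_cgf hset).differentiableAt.hasDerivAt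
  rw [deriv_cgf_zero hset, hf.real_heatMeasure_univ] at h1
  have h2 : HasDerivAt (fun t' : ℝ => 1 - t / t') (t⁻¹) t := by
    have := ((hasDerivAt_inv ht.ne').const_mul t).const_sub 1
    simp only [div_eq_mul_inv]
    refine this.congr_deriv ?_
    field_simp
  have h0 : (1 : ℝ) - t / t = 0 := by rw [div_self ht.ne', sub_self]
  rw [← h0] at h1
  have h3 := h1.comp t h2
  have h4 := ((Real.hasDerivAt_log ht.ne').const_sub (Real.log t)).const_mul
    ((Module.finrank ℝ V : ℝ) / 2)
  refine ((h4.add h3).congr_of_eventuallyEq ?_).congr_deriv ?_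
  · filter_upwards [Ioi_mem_nhds ht] with t' ht'
    rw [hlog t' ht']
    rfl
  · rw [heatEnergy]
    rw [mul_comm (2:ℝ) t, ← div_div]
    ring

lemma abs_inner_heatGrad_le (hf : LogLip ℓ f) {t : ℝ} (ht : 0 < t) (x v : V) :
    |⟪heatGrad f t x, v⟫| ≤ ℓ * ‖v‖ := by
  have h := (hf.hasDerivAt_log_heat ht x v).le_of_lip' (C := ℓ * ‖v‖)
    (mul_nonneg hf.nonneg (norm_nonneg _)) (Eventually.of_forall fun s => by
      refine ((hf.logLip_heat t).abs_log_sub_le _ _).trans_eq ?_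
      simp [norm_smul]; ring)
  simpa using h

lemma sum_heatSq (hf : LogLip ℓ f) {t : ℝ} (ht : 0 < t) (x : V) {ι : Type*} [Fintype ι]
    (v : ι → V) (hv : ∀ w, ∑ j, ⟪w, v j⟫ ^ 2 = ‖w‖ ^ 2) :
    ∑ j, heatSq f t x (v j) = heatEnergy f t x := by
  simp only [heatSq, heatEnergy]
  rw [← Finset.sum_div, ← integral_finsetSum _ fun j _ => hf.integrable_inner_sq t x (v j),
    div_mul_eq_mul_div, ← integral_mul_const]
  congr 2
  ext w
  simp only [div_pow]
  rw [← Finset.sum_div, hv, mul_pow, Real.sq_sqrt ht.le]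
  field_simp
  norm_num

end LogLip

end GaussianAverages

section Japanese

variable {V : Type*} [NormedAddCommGroup V] [InnerProductSpace ℝ V]

lemma hasDerivAt_sqrt_one_add_norm_sq (x h : V) :
    HasDerivAt (fun s : ℝ => √(1 + ‖x + s • h‖ ^ 2)) ⟪(√(1 + ‖x‖ ^ 2))⁻¹ • x, h⟫ 0 := by
  have h1 : HasDerivAt (fun s : ℝ => x + s • h) h 0 := by
    simpa using ((hasDerivAt_id (0 : ℝ)).smul_const h).const_add x
  have h2 := (h1.norm_sq.const_add 1).sqrt (by positivity)
  refine h2.congr_deriv ?_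
  simp only [zero_smul, add_zero, real_inner_smul_left]
  field_simp

lemma sqrt_second_difference_le (x h : V) (s : ℝ) :
    √(1 + ‖x + s • h‖ ^ 2) + √(1 + ‖x + (-s) • h‖ ^ 2) - 2 * √(1 + ‖x‖ ^ 2)
      ≤ s ^ 2 * ‖h‖ ^ 2 := by
  have key : ∀ a b : ℝ, 1 ≤ a → 1 ≤ b → √b ≤ √a + (b - a) / (2 * √a) := by
    intro a b ha hb
    have h1 : 0 < √a := Real.sqrt_pos.2 (by linarith)
    have h2 := Real.sq_sqrt (show 0 ≤ a by linarith)
    have h3 := Real.sq_sqrt (show 0 ≤ b by linarith)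
    have : √a + (b - a) / (2 * √a) - √b = (√a - √b) ^ 2 / (2 * √a) := by
      field_simp
      rw [← h2, ← h3, Real.sqrt_sq h1.le, Real.sqrt_sq (Real.sqrt_nonneg b)]
      ring
    have h4 : 0 ≤ (√a - √b) ^ 2 / (2 * √a) := by positivity
    linarith
  have hx : (1 : ℝ) ≤ 1 + ‖x‖ ^ 2 := by nlinarith [sq_nonneg ‖x‖]
  have h1 := key (1 + ‖x‖ ^ 2) (1 + ‖x + s • h‖ ^ 2) hx (by nlinarith [sq_nonneg ‖x + s • h‖])
  have h2 := key (1 + ‖x‖ ^ 2) (1 + ‖x + (-s) • h‖ ^ 2) hx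
    (by nlinarith [sq_nonneg ‖x + (-s) • h‖])
  have h3 : 1 ≤ √(1 + ‖x‖ ^ 2) := Real.one_le_sqrt.2 hx
  have h4 : (1 + ‖x + s • h‖ ^ 2 - (1 + ‖x‖ ^ 2)) / (2 * √(1 + ‖x‖ ^ 2)) +
      (1 + ‖x + (-s) • h‖ ^ 2 - (1 + ‖x‖ ^ 2)) / (2 * √(1 + ‖x‖ ^ 2))
      = s ^ 2 * ‖h‖ ^ 2 / √(1 + ‖x‖ ^ 2) := by
    rw [norm_add_sq_real, norm_add_sq_real, norm_smul, norm_smul, inner_smul_right,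
      inner_smul_right, mul_pow, mul_pow, Real.norm_eq_abs, Real.norm_eq_abs, sq_abs, sq_abs]
    field_simp
    ring
  have h5 : s ^ 2 * ‖h‖ ^ 2 / √(1 + ‖x‖ ^ 2) ≤ s ^ 2 * ‖h‖ ^ 2 :=
    div_le_self (by positivity) h3
  linarith

lemma norm_le_sqrt_one_add_norm_sq (x : V) : ‖x‖ ≤ √(1 + ‖x‖ ^ 2) :=
  Real.le_sqrt_of_sq_le (by linarith)

lemma norm_inv_sqrt_smul_le (x : V) : ‖(√(1 + ‖x‖ ^ 2))⁻¹ • x‖ ≤ 1 := by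
  have h : 0 < √(1 + ‖x‖ ^ 2) := Real.sqrt_pos.2 (by positivity)
  rw [norm_smul, norm_inv, Real.norm_of_nonneg h.le, inv_mul_le_iff₀ h, mul_one]
  exact norm_le_sqrt_one_add_norm_sq x

end Japanese

section HeatGap

variable {ι : Type*} [Fintype ι] {H : ι → Type*} {E : Type*}
  [NormedAddCommGroup E] [InnerProductSpace ℝ E] [FiniteDimensional ℝ E]
  [MeasurableSpace E] [BorelSpace E]
  [∀ i, NormedAddCommGroup (H i)] [∀ i, InnerProductSpace ℝ (H i)]
  [∀ i, FiniteDimensional ℝ (H i)] [∀ i, MeasurableSpace (H i)] [∀ i, BorelSpace (H i)]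

/-- The logarithmic defect in the reverse Brascamp-Lieb hypothesis along the heat flow. -/
noncomputable def heatGap (L : ∀ i, H i →L[ℝ] E) (c : ι → ℝ) (f : ∀ i, H i → ℝ) (g : E → ℝ)
    (t : ℝ) (x : ∀ i, H i) : ℝ :=
  Real.log (heat g t (∑ i, L i (x i))) - ∑ i, c i * Real.log (heat (f i) t (x i))

variable {L : ∀ i, H i →L[ℝ] E} {B : ∀ i, E →L[ℝ] H i} {c : ι → ℝ} {ℓ : ℝ} {f : ∀ i, H i → ℝ}
  {g : E → ℝ}

lemma sum_sq_norm_of_coisometry {V : Type*} [NormedAddCommGroup V] [InnerProductSpace ℝ V]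
    [FiniteDimensional ℝ V] {κ : Type*} [Fintype κ] (b : OrthonormalBasis κ ℝ E)
    (T : E →L[ℝ] V) (hT : ∀ y, ‖T.adjoint y‖ = ‖y‖) :
    ∑ j, ‖T (b j)‖ ^ 2 = Module.finrank ℝ V := by
  have h1 : ∀ j, ‖T (b j)‖ ^ 2 = ∑ l, ⟪T (b j), stdOrthonormalBasis ℝ V l⟫ ^ 2 := fun j =>
    ((stdOrthonormalBasis ℝ V).sum_sq_inner_left (T (b j))).symm
  have h2 : ∀ l, ∑ j, ⟪T (b j), stdOrthonormalBasis ℝ V l⟫ ^ 2 = 1 := fun l => by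
    have h3 : ∀ j, ⟪T (b j), stdOrthonormalBasis ℝ V l⟫
        = ⟪b j, T.adjoint (stdOrthonormalBasis ℝ V l)⟫ := fun j =>
      (ContinuousLinearMap.adjoint_inner_right T _ _).symm
    simp only [h3]
    rw [b.sum_sq_inner_right, hT]
    simp
  simp only [h1]
  rw [Finset.sum_comm]
  simp [h2]

lemma heatGap_time_deriv_ge (hc : ∀ i, 0 < c i) (hg : LogLip ℓ g) (hf : ∀ i, LogLip ℓ (f i))
    (hB : ∀ i y, ‖(B i).adjoint y‖ = ‖y‖) (hL : ∀ z, ∑ i, L i (B i z) = z)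
    (hLc : ∀ z, ∑ i, (c i)⁻¹ * ‖(L i).adjoint z‖ ^ 2 ≤ ‖z‖ ^ 2)
    {ε t : ℝ} (hε : 0 < ε) (ht : 0 < t) (x : ∀ i, H i)
    (hmin : ∀ y, heatGap L c f g t x + ε * ∑ i, √(1 + ‖x i‖ ^ 2)
      ≤ heatGap L c f g t y + ε * ∑ i, √(1 + ‖y i‖ ^ 2)) :
    -(ε * ∑ i, ((Module.finrank ℝ (H i) : ℝ) + 2 * ℓ)) ≤
      (heatEnergy g t (∑ i, L i (x i)) - Module.finrank ℝ E / (2 * t)) -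
      ∑ i, c i * (heatEnergy (f i) t (x i) - Module.finrank ℝ (H i) / (2 * t)) := by
  classical
  set z := ∑ i, L i (x i) with hz
  have hlin : ∀ (h : ∀ i, H i) (s : ℝ), ∑ i, L i (x i + s • h i) = z + s • ∑ i, L i (h i) := by
    intro h s
    simp [hz, Finset.sum_add_distrib, Finset.smul_sum]
  -- first order condition
  have hfirst : ∀ i, c i • heatGrad (f i) t (x i) - ε • (√(1 + ‖x i‖ ^ 2))⁻¹ • x i
      = (L i).adjoint (heatGrad g t z) := by
    have hd : ∀ h : ∀ i, H i, ⟪heatGrad g t z, ∑ i, L i (h i)⟫ -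
        ∑ i, c i * ⟪heatGrad (f i) t (x i), h i⟫ +
        ε * ∑ i, ⟪(√(1 + ‖x i‖ ^ 2))⁻¹ • x i, h i⟫ = 0 := by
      intro h
      have h1 := ((hg.hasDerivAt_log_heat ht z (∑ i, L i (h i))).sub
        (HasDerivAt.fun_sum (u := Finset.univ) fun i _ =>
          ((hf i).hasDerivAt_log_heat ht (x i) (h i)).const_mul (c i))).add
        ((HasDerivAt.fun_sum (u := Finset.univ) fun i _ =>
          hasDerivAt_sqrt_one_add_norm_sq (x i) (h i)).const_mul ε)
      refine IsLocalMin.hasDerivAt_eq_zero (Eventually.of_forall fun s => ?_) h1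
      have h2 := hmin fun i => x i + s • h i
      simp only [heatGap, hlin] at h2
      simpa [hz] using h2
    intro i
    refine ext_inner_right ℝ fun v => ?_
    have h1 := hd (Pi.single i v)
    have h2 : ∀ (φ : ∀ i, H i → ℝ), (∀ i, φ i 0 = 0) → ∑ j, φ j (Pi.single i v j) = φ i v := by
      intro φ hφ
      rw [Finset.sum_eq_single i]
      · simp
      · intro j _ hj
        rw [Pi.single_eq_of_ne hj, hφ]
      · simp
    have h3 : ∑ j, L j ((Pi.single i v : ∀ i, H i) j) = L i v := by
      rw [Finset.sum_eq_single i]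
      · simp
      · intro j _ hj
        rw [Pi.single_eq_of_ne hj, map_zero]
      · simp
    rw [h3, h2 (fun i v => c i * ⟪heatGrad (f i) t (x i), v⟫) (by simp),
      h2 (fun i v => ⟪(√(1 + ‖x i‖ ^ 2))⁻¹ • x i, v⟫) (by simp)] at h1
    rw [ContinuousLinearMap.adjoint_inner_left, inner_sub_left, real_inner_smul_left,
      real_inner_smul_left]
    linarith
  -- second order condition
  set b := stdOrthonormalBasis ℝ E with hb
  have hsecond : ∀ j, 0 ≤ heatSq g t z (b j) - ⟪heatGrad g t z, b j⟫ ^ 2 - 1 / (2 * t) -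
      ∑ i, c i * (heatSq (f i) t (x i) (B i (b j)) - ⟪heatGrad (f i) t (x i), B i (b j)⟫ ^ 2
        - ‖B i (b j)‖ ^ 2 / (2 * t)) + ε * ∑ i, ‖B i (b j)‖ ^ 2 := by
    intro j
    have h1 := ((hg.tendsto_log_heat ht z (b j)).sub
      (tendsto_finsetSum Finset.univ fun i _ =>
        ((hf i).tendsto_log_heat ht (x i) (B i (b j))).const_mul (c i))).add_const
        (ε * ∑ i, ‖B i (b j)‖ ^ 2)
    have hbj : ‖b j‖ = 1 := by simp
    rw [hbj, one_pow] at h1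
    refine ge_of_tendsto h1 ?_
    filter_upwards [self_mem_nhdsWithin] with s hs
    have hs : s ≠ 0 := hs
    have hs2 : 0 < s ^ 2 := by positivity
    have h2 := hmin fun i => x i + s • B i (b j)
    have h3 := hmin fun i => x i + (-s) • B i (b j)
    simp only [heatGap, hlin, hL] at h2 h3
    have h4 : ∑ i, √(1 + ‖x i + s • B i (b j)‖ ^ 2) + ∑ i, √(1 + ‖x i + (-s) • B i (b j)‖ ^ 2)
        - 2 * ∑ i, √(1 + ‖x i‖ ^ 2) ≤ s ^ 2 * ∑ i, ‖B i (b j)‖ ^ 2 := by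
      rw [Finset.mul_sum, Finset.mul_sum, ← Finset.sum_add_distrib, ← Finset.sum_sub_distrib]
      exact Finset.sum_le_sum fun i _ => sqrt_second_difference_le _ _ _
    have h5 := mul_le_mul_of_nonneg_left h4 hε.le
    have h6 : ∑ i, c i * ((Real.log (heat (f i) t (x i + s • B i (b j))) +
          Real.log (heat (f i) t (x i + -s • B i (b j))) - 2 * Real.log (heat (f i) t (x i))) /
            s ^ 2) = (∑ i, c i * Real.log (heat (f i) t (x i + s • B i (b j))) +
          ∑ i, c i * Real.log (heat (f i) t (x i + -s • B i (b j))) -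
            2 * ∑ i, c i * Real.log (heat (f i) t (x i))) / s ^ 2 := by
      rw [Finset.mul_sum, ← Finset.sum_add_distrib, ← Finset.sum_sub_distrib, Finset.sum_div]
      refine Finset.sum_congr rfl fun i _ => ?_
      ring
    rw [h6, ← sub_div, div_add' _ _ _ hs2.ne']
    refine div_nonneg ?_ hs2.le
    rw [← hz] at h2 h3
    linarith
  have hsum := Finset.sum_nonneg fun j (_ : j ∈ Finset.univ) => hsecond j
  rw [Finset.sum_add_distrib, Finset.sum_sub_distrib, Finset.sum_sub_distrib,
    Finset.sum_sub_distrib, hg.sum_heatSq ht z b (fun w => b.sum_sq_inner_left w),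
    b.sum_sq_inner_left, ← Finset.mul_sum] at hsum
  have hBi : ∀ i w, ∑ j, ⟪w, B i (b j)⟫ ^ 2 = ‖w‖ ^ 2 := fun i w => by
    simp only [← ContinuousLinearMap.adjoint_inner_left (B i)]
    rw [b.sum_sq_inner_left, hB]
  have h7 : ∀ i, ∑ j, c i * (heatSq (f i) t (x i) (B i (b j)) -
        ⟪heatGrad (f i) t (x i), B i (b j)⟫ ^ 2 - ‖B i (b j)‖ ^ 2 / (2 * t)) =
      c i * (heatEnergy (f i) t (x i) - ‖heatGrad (f i) t (x i)‖ ^ 2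
        - Module.finrank ℝ (H i) / (2 * t)) := by
    intro i
    rw [← Finset.mul_sum, Finset.sum_sub_distrib, Finset.sum_sub_distrib,
      (hf i).sum_heatSq ht (x i) _ (hBi i), hBi, ← Finset.sum_div,
      sum_sq_norm_of_coisometry b (B i) (hB i)]
  have h8 : ∀ i, ∑ j, ‖B i (b j)‖ ^ 2 = Module.finrank ℝ (H i) := fun i =>
    sum_sq_norm_of_coisometry b (B i) (hB i)
  rw [Finset.sum_comm, Finset.sum_congr rfl fun i _ => h7 i, Finset.sum_comm,
    Finset.sum_congr rfl fun i _ => h8 i] at hsum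
  have h9 : ∑ i, (c i * ‖heatGrad (f i) t (x i)‖ ^ 2 - ε * (2 * ℓ)) ≤ ‖heatGrad g t z‖ ^ 2 := by
    refine le_trans (Finset.sum_le_sum fun i _ => ?_) (hLc (heatGrad g t z))
    rw [← hfirst i, norm_sub_sq_real, norm_smul, real_inner_smul_left, real_inner_smul_right,
      mul_pow, Real.norm_eq_abs, sq_abs]
    have h10 : ⟪heatGrad (f i) t (x i), (√(1 + ‖x i‖ ^ 2))⁻¹ • x i⟫ ≤ ℓ := by
      refine (le_abs_self _).trans (((hf i).abs_inner_heatGrad_le ht _ _).trans ?_)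
      exact mul_le_of_le_one_right hg.nonneg (norm_inv_sqrt_smul_le _)
    have hci := hc i
    have h11 : (c i)⁻¹ * (c i ^ 2 * ‖heatGrad (f i) t (x i)‖ ^ 2 -
        2 * (c i * (ε * ⟪heatGrad (f i) t (x i), (√(1 + ‖x i‖ ^ 2))⁻¹ • x i⟫)) +
        ‖ε • (√(1 + ‖x i‖ ^ 2))⁻¹ • x i‖ ^ 2) = c i * ‖heatGrad (f i) t (x i)‖ ^ 2 -
        2 * (ε * ⟪heatGrad (f i) t (x i), (√(1 + ‖x i‖ ^ 2))⁻¹ • x i⟫) +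
        (c i)⁻¹ * ‖ε • (√(1 + ‖x i‖ ^ 2))⁻¹ • x i‖ ^ 2 := by
      field_simp
    rw [h11]
    have h12 : 0 ≤ (c i)⁻¹ * ‖ε • (√(1 + ‖x i‖ ^ 2))⁻¹ • x i‖ ^ 2 := by positivity
    nlinarith
  have h13 : ∑ i, c i * (heatEnergy (f i) t (x i) - ‖heatGrad (f i) t (x i)‖ ^ 2
        - Module.finrank ℝ (H i) / (2 * t)) = ∑ i, c i * (heatEnergy (f i) t (x i)
        - Module.finrank ℝ (H i) / (2 * t)) - ∑ i, c i * ‖heatGrad (f i) t (x i)‖ ^ 2 := by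
    rw [← Finset.sum_sub_distrib]
    refine Finset.sum_congr rfl fun i _ => ?_
    ring
  have h14 : ∑ _j : Fin (Module.finrank ℝ E), 1 / (2 * t) = Module.finrank ℝ E / (2 * t) := by
    simp [div_eq_mul_inv]
  rw [h13, h14] at hsum
  rw [Finset.sum_sub_distrib, ← Finset.mul_sum] at h9
  rw [Finset.sum_add_distrib, mul_add]
  linarith

end HeatGap

section HeatGap

variable {ι : Type*} [Fintype ι] {H : ι → Type*} {E : Type*}
  [NormedAddCommGroup E] [InnerProductSpace ℝ E] [FiniteDimensional ℝ E]
  [MeasurableSpace E] [BorelSpace E]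
  [∀ i, NormedAddCommGroup (H i)] [∀ i, InnerProductSpace ℝ (H i)]
  [∀ i, FiniteDimensional ℝ (H i)] [∀ i, MeasurableSpace (H i)] [∀ i, BorelSpace (H i)]

variable {L : ∀ i, H i →L[ℝ] E} {B : ∀ i, E →L[ℝ] H i} {c : ι → ℝ} {ℓ : ℝ} {f : ∀ i, H i → ℝ}
  {g : E → ℝ}

variable (H E) in
/-- A lower bound for `heatGap` in terms of Gaussian moments. -/
noncomputable def heatGapBound (c : ι → ℝ) (ℓ t : ℝ) : ℝ :=
  Real.log (gaussNormMgf E (-(ℓ * √t))) - ∑ i, c i * Real.log (gaussNormMgf (H i) (ℓ * √t))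

lemma continuous_heatGapBound (c : ι → ℝ) (ℓ : ℝ) : Continuous (heatGapBound H E c ℓ) := by
  refine Continuous.sub (Continuous.log ?_ fun t => (gaussNormMgf_pos _).ne')
    (continuous_finsetSum _ fun i _ => continuous_const.mul
      (Continuous.log ?_ fun t => (gaussNormMgf_pos _).ne'))
  · exact continuous_gaussNormMgf.comp (by fun_prop)
  · exact continuous_gaussNormMgf.comp (by fun_prop)

lemma heatGapBound_anti (hc : ∀ i, 0 < c i) (hℓ : 0 ≤ ℓ) : Antitone (heatGapBound H E c ℓ) := by
  intro s t hst
  have h : ℓ * √s ≤ ℓ * √t := by gcongr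
  refine sub_le_sub (Real.log_le_log (gaussNormMgf_pos _) (gaussNormMgf_mono (by linarith)))
    (Finset.sum_le_sum fun i _ => mul_le_mul_of_nonneg_left
      (Real.log_le_log (gaussNormMgf_pos _) (gaussNormMgf_mono h)) (hc i).le)

lemma heatGapBound_le_heatGap (hc : ∀ i, 0 < c i) (hg : LogLip ℓ g) (hf : ∀ i, LogLip ℓ (f i))
    (hfg : ∀ x : ∀ i, H i, ∏ i, f i (x i) ^ c i ≤ g (∑ i, L i (x i))) (t : ℝ) (x : ∀ i, H i) :
    heatGapBound H E c ℓ t ≤ heatGap L c f g t x := by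
  have h1 : Real.log (g (∑ i, L i (x i))) + Real.log (gaussNormMgf E (-(ℓ * √t)))
      ≤ Real.log (heat g t (∑ i, L i (x i))) := by
    rw [← Real.log_mul (hg.pos _).ne' (gaussNormMgf_pos _).ne']
    exact Real.log_le_log (mul_pos (hg.pos _) (gaussNormMgf_pos _)) (hg.heat_ge t _)
  have h2 : ∀ i, Real.log (heat (f i) t (x i)) ≤
      Real.log (f i (x i)) + Real.log (gaussNormMgf (H i) (ℓ * √t)) := fun i => by
    rw [← Real.log_mul ((hf i).pos _).ne' (gaussNormMgf_pos _).ne']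
    exact Real.log_le_log ((hf i).heat_pos _ _) ((hf i).heat_le t _)
  have h3 : ∑ i, c i * Real.log (f i (x i)) ≤ Real.log (g (∑ i, L i (x i))) := by
    have h4 : Real.log (∏ i, f i (x i) ^ c i) = ∑ i, c i * Real.log (f i (x i)) := by
      rw [Real.log_prod fun i _ => (Real.rpow_pos_of_pos ((hf i).pos _) _).ne']
      exact Finset.sum_congr rfl fun i _ => Real.log_rpow ((hf i).pos _) _
    rw [← h4]
    exact Real.log_le_log (Finset.prod_pos fun i _ => Real.rpow_pos_of_pos ((hf i).pos _) _) (hfg x)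
  have h5 : ∑ i, c i * Real.log (heat (f i) t (x i)) ≤ ∑ i, c i * Real.log (f i (x i)) +
      ∑ i, c i * Real.log (gaussNormMgf (H i) (ℓ * √t)) := by
    rw [← Finset.sum_add_distrib]
    refine Finset.sum_le_sum fun i _ => ?_
    rw [← mul_add]
    exact mul_le_mul_of_nonneg_left (h2 i) (hc i).le
  rw [heatGapBound, heatGap]
  linarith

lemma continuous_heatGap (hg : LogLip ℓ g) (hf : ∀ i, LogLip ℓ (f i)) :
    Continuous fun p : ℝ × (∀ i, H i) => heatGap L c f g p.1 p.2 := by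
  refine Continuous.sub (Continuous.log ?_ fun p => (hg.heat_pos _ _).ne')
    (continuous_finsetSum _ fun i _ => continuous_const.mul
      (Continuous.log ?_ fun p => ((hf i).heat_pos _ _).ne'))
  · exact hg.continuous_heat.comp (f := fun p : ℝ × (∀ i, H i) => (p.1, ∑ i, L i (p.2 i)))
      (by fun_prop)
  · exact (hf i).continuous_heat.comp (f := fun p : ℝ × (∀ i, H i) => (p.1, p.2 i)) (by fun_prop)

/-- Maximum principle for the heat flow of the reverse Brascamp-Lieb inequality with a slack
depending on the penalisation. -/
lemma heatGapBound_le_heatGap_add (hc : ∀ i, 0 < c i) (hg : LogLip ℓ g) (hf : ∀ i, LogLip ℓ (f i))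
    (hB : ∀ i y, ‖(B i).adjoint y‖ = ‖y‖) (hL : ∀ z, ∑ i, L i (B i z) = z)
    (hLc : ∀ z, ∑ i, (c i)⁻¹ * ‖(L i).adjoint z‖ ^ 2 ≤ ‖z‖ ^ 2)
    (hfg : ∀ x : ∀ i, H i, ∏ i, f i (x i) ^ c i ≤ g (∑ i, L i (x i)))
    {t₀ T ε : ℝ} (ht₀ : 0 < t₀) (htT : t₀ ≤ T) (hε : 0 < ε) :
    heatGapBound H E c ℓ t₀ ≤ heatGap L c f g T 0 + ε * Fintype.card ι +
      ε * (∑ i, ((Module.finrank ℝ (H i) : ℝ) + 2 * ℓ) + 1) * T := by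
  set K := ∑ i, ((Module.finrank ℝ (H i) : ℝ) + 2 * ℓ) + 1 with hK
  have hℓ := hg.nonneg
  have hK0 : 0 < K := by positivity
  set v : ℝ × (∀ i, H i) → ℝ := fun p =>
    heatGap L c f g p.1 p.2 + ε * ∑ i, √(1 + ‖p.2 i‖ ^ 2) + ε * K * p.1 with hv
  have hvc : Continuous v := by
    refine ((continuous_heatGap hg hf).add ?_).add (by fun_prop)
    fun_prop
  set S : Set (ℝ × (∀ i, H i)) := Set.Icc t₀ T ×ˢ Set.univ with hS
  have hSc : IsClosed S := isClosed_Icc.prod isClosed_univ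
  have h0S : ((T, 0) : ℝ × (∀ i, H i)) ∈ S := ⟨⟨htT, le_rfl⟩, trivial⟩
  set R := max 0 ((v (T, 0) - heatGapBound H E c ℓ T) / ε) with hR
  have hcoer : ∀ᶠ p in cocompact (ℝ × (∀ i, H i)) ⊓ 𝓟 S, v (T, 0) ≤ v p := by
    have hcpt : IsCompact (Set.Icc t₀ T ×ˢ Metric.closedBall (0 : ∀ i, H i) R) :=
      isCompact_Icc.prod (isCompact_closedBall _ _)
    filter_upwards [mem_inf_of_left hcpt.compl_mem_cocompact,
      mem_inf_of_right (mem_principal_self S)] with p hp hpS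
    have hpn : ¬ ‖p.2‖ ≤ R := fun h => hp ⟨hpS.1, by simpa using h⟩
    rw [pi_norm_le_iff_of_nonneg (le_max_left _ _)] at hpn
    push Not at hpn
    obtain ⟨i, hi⟩ := hpn
    have h1 : R ≤ ∑ i, √(1 + ‖p.2 i‖ ^ 2) :=
      (hi.le.trans (norm_le_sqrt_one_add_norm_sq _)).trans
        (Finset.single_le_sum (f := fun i => √(1 + ‖p.2 i‖ ^ 2))
          (fun j _ => Real.sqrt_nonneg _) (Finset.mem_univ i))
    have h2 := heatGapBound_le_heatGap hc hg hf hfg p.1 p.2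
    have h3 := heatGapBound_anti (H := H) (E := E) hc hℓ hpS.1.2
    have h4 : (v (T, 0) - heatGapBound H E c ℓ T) / ε ≤ R := le_max_right _ _
    rw [div_le_iff₀ hε] at h4
    have h5 : 0 ≤ ε * K * p.1 := by
      have : 0 ≤ p.1 := ht₀.le.trans hpS.1.1
      positivity
    have h6 := mul_le_mul_of_nonneg_left h1 hε.le
    have h7 : v p = heatGap L c f g p.1 p.2 + ε * ∑ i, √(1 + ‖p.2 i‖ ^ 2) + ε * K * p.1 := rfl
    rw [h7]
    linarith
  obtain ⟨⟨t, x⟩, htx, hmin⟩ := hvc.continuousOn.exists_isMinOn' hSc h0S hcoer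
  have hmin' : ∀ p ∈ S, v (t, x) ≤ v p := fun p hp => hmin hp
  have hvT : v (T, 0) = heatGap L c f g T 0 + ε * Fintype.card ι + ε * K * T := by
    simp [hv]
  have hle := hmin' _ h0S
  rw [hvT] at hle
  rcases htx.1.1.eq_or_lt with h | h
  · have h2 := heatGapBound_le_heatGap hc hg hf hfg t x
    simp only at h
    rw [← h] at h2 hle
    have h7 : v (t₀, x) = heatGap L c f g t₀ x + ε * ∑ i, √(1 + ‖x i‖ ^ 2) + ε * K * t₀ := rfl
    have h8 : 0 ≤ ε * ∑ i, √(1 + ‖x i‖ ^ 2) + ε * K * t₀ := by positivity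
    linarith
  · exfalso
    simp only at h
    have ht : 0 < t := ht₀.trans h
    have h1 := heatGap_time_deriv_ge hc hg hf hB hL hLc hε ht x fun y => by
      have := hmin' (t, y) ⟨htx.1, trivial⟩
      simp only [hv] at this
      linarith
    have h2 := ((hg.hasDerivAt_log_heat_time ht (∑ i, L i (x i))).sub
      (HasDerivAt.fun_sum (u := Finset.univ) fun i _ =>
        ((hf i).hasDerivAt_log_heat_time ht (x i)).const_mul (c i))).add
        ((hasDerivAt_id t).const_mul (ε * K))
    have h3 := (hasDerivAt_iff_tendsto_slope.1 h2).mono_left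
      (nhdsWithin_mono t (fun s (hs : s ∈ Set.Iio t) => ne_of_lt hs))
    have h4 := le_of_tendsto h3 (b := 0) (by
      filter_upwards [Ioo_mem_nhdsLT h] with s hs
      have := hmin' (s, x) ⟨⟨hs.1.le, hs.2.le.trans htx.1.2⟩, trivial⟩
      simp only [hv, heatGap] at this
      rw [slope_def_field]
      refine div_nonpos_of_nonneg_of_nonpos ?_ (by linarith [hs.2])
      simp only [Pi.add_apply, Pi.sub_apply, id_eq]
      linarith)
    rw [hK] at h4
    linarith

/-- The heat flow proof of the reverse Brascamp-Lieb inequality, in a form where the resolution of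
the identity need not be exact. -/
theorem heatGap_ge_of_coisometry (hc : ∀ i, 0 < c i) (hg : LogLip ℓ g)
    (hf : ∀ i, LogLip ℓ (f i))
    (hB : ∀ i y, ‖(B i).adjoint y‖ = ‖y‖) (hL : ∀ z, ∑ i, L i (B i z) = z)
    (hLc : ∀ z, ∑ i, (c i)⁻¹ * ‖(L i).adjoint z‖ ^ 2 ≤ ‖z‖ ^ 2)
    (hfg : ∀ x : ∀ i, H i, ∏ i, f i (x i) ^ c i ≤ g (∑ i, L i (x i)))
    {T : ℝ} (hT : 0 < T) :
    heatGapBound H E c ℓ 0 ≤ heatGap L c f g T 0 := by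
  have h1 : ∀ t₀, 0 < t₀ → t₀ ≤ T → heatGapBound H E c ℓ t₀ ≤ heatGap L c f g T 0 := by
    intro t₀ ht₀ htT
    set K := ∑ i, ((Module.finrank ℝ (H i) : ℝ) + 2 * ℓ) + 1 with hK
    have hcont : Tendsto (fun ε : ℝ => heatGap L c f g T 0 + ε * Fintype.card ι + ε * K * T)
        (𝓝[>] 0) (𝓝 (heatGap L c f g T 0 + 0 * Fintype.card ι + 0 * K * T)) :=
      Tendsto.mono_left (Continuous.tendsto (by fun_prop) 0) nhdsWithin_le_nhds
    simp only [zero_mul, add_zero] at hcont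
    refine ge_of_tendsto hcont ?_
    filter_upwards [self_mem_nhdsWithin] with ε hε
    exact heatGapBound_le_heatGap_add hc hg hf hB hL hLc hfg ht₀ htT hε
  have h2 : Tendsto (heatGapBound H E c ℓ) (𝓝[>] 0) (𝓝 (heatGapBound H E c ℓ 0)) :=
    ((continuous_heatGapBound c ℓ).tendsto 0).mono_left nhdsWithin_le_nhds
  refine le_of_tendsto h2 ?_
  filter_upwards [Ioo_mem_nhdsGT hT] with t₀ ht₀
  exact h1 t₀ ht₀.1 ht₀.2.le

end HeatGap

section ChangeOfVariables

variable {V : Type*} [NormedAddCommGroup V] [InnerProductSpace ℝ V]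
  [FiniteDimensional ℝ V] [MeasurableSpace V] [BorelSpace V]

lemma integral_comp_clm (P : V →L[ℝ] V) (hP : P.det ≠ 0) (φ : V → ℝ) :
    ∫ y, φ (P y) = |P.det|⁻¹ * ∫ x, φ x := by
  have h := Measure.map_linearMap_addHaar_eq_smul_addHaar (volume : Measure V)
    (f := (P : V →ₗ[ℝ] V)) hP
  have he : MeasurableEmbedding P :=
    (P.toContinuousLinearEquivOfDetNeZero hP).toHomeomorph.measurableEmbedding
  have h2 := he.integral_map (μ := volume) φ
  rw [← h2]
  have h3 : Measure.map P volume = ENNReal.ofReal |(P.det)⁻¹| • (volume : Measure V) := h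
  rw [h3, integral_smul_measure, ENNReal.toReal_ofReal (abs_nonneg _), abs_inv, smul_eq_mul]

lemma lintegral_comp_clm (P : V →L[ℝ] V) (hP : P.det ≠ 0) (φ : V → ℝ≥0∞) :
    ∫⁻ y, φ (P y) = ENNReal.ofReal |P.det|⁻¹ * ∫⁻ x, φ x := by
  have h := Measure.map_linearMap_addHaar_eq_smul_addHaar (volume : Measure V)
    (f := (P : V →ₗ[ℝ] V)) hP
  have he : MeasurableEmbedding P :=
    (P.toContinuousLinearEquivOfDetNeZero hP).toHomeomorph.measurableEmbedding
  rw [← he.lintegral_map]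
  have h3 : Measure.map P volume = ENNReal.ofReal |(P.det)⁻¹| • (volume : Measure V) := h
  rw [h3, lintegral_smul_measure, abs_inv, smul_eq_mul]

/-- A linear map expanding distances at most by `a` has determinant at most `a ^ dim`. -/
lemma abs_det_le_pow (P : V →L[ℝ] V) {a : ℝ} (ha : 0 ≤ a) (h : ∀ x, ‖P x‖ ≤ a * ‖x‖) :
    |P.det| ≤ a ^ Module.finrank ℝ V := by
  have h1 : P '' Metric.closedBall 0 1 ⊆ Metric.closedBall 0 a := by
    rintro _ ⟨x, hx, rfl⟩
    rw [mem_closedBall_zero_iff] at hx ⊢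
    exact (h x).trans (mul_le_of_le_one_right ha hx)
  have h2 := measure_mono (μ := volume) h1
  rw [Measure.addHaar_image_continuousLinearMap, Measure.addHaar_closedBall volume _ ha,
    Measure.addHaar_closedBall volume _ zero_le_one, one_pow, ENNReal.ofReal_one, one_mul] at h2
  have h3 : volume (Metric.ball (0 : V) 1) ≠ 0 := (Metric.measure_ball_pos _ _ one_pos).ne'
  have h4 := (ENNReal.mul_le_mul_iff_left h3 measure_ball_lt_top.ne).1 h2
  exact (ENNReal.ofReal_le_ofReal_iff (by positivity)).1 h4

end ChangeOfVariables

section GaussianForm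

variable {V : Type*} [NormedAddCommGroup V] [InnerProductSpace ℝ V]
  [FiniteDimensional ℝ V] [MeasurableSpace V] [BorelSpace V]

lemma gaussNormMgf_zero : gaussNormMgf V 0 = (4 * Real.pi) ^ ((Module.finrank ℝ V : ℝ) / 2) := by
  have h := GaussianFourier.integral_rexp_neg_mul_sq_norm (V := V) (b := 1 / 4) (by norm_num)
  rw [gaussNormMgf]
  have h2 : Real.pi / (1 / 4) = 4 * Real.pi := by ring
  rw [h2] at h
  rw [← h]
  congr 1
  ext w
  rw [zero_mul, Real.exp_zero, mul_one]
  ring_nf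

lemma heat_zero_eq (f : V → ℝ) {T : ℝ} (hT : 0 < T) :
    heat f T 0 = T ^ (-((Module.finrank ℝ V : ℝ) / 2)) *
      ∫ y, Real.exp (-‖y‖ ^ 2 / (4 * T)) * f y := by
  have hs : 0 < √T := Real.sqrt_pos.2 hT
  have h := Measure.integral_comp_smul_of_nonneg (volume : Measure V)
    (fun y => Real.exp (-‖y‖ ^ 2 / (4 * T)) * f y) (√T) (hR := hs.le)
  have h2 : (√T ^ Module.finrank ℝ V)⁻¹ = T ^ (-((Module.finrank ℝ V : ℝ) / 2)) := by
    rw [Real.rpow_neg hT.le, Real.sqrt_eq_rpow, ← Real.rpow_natCast, ← Real.rpow_mul hT.le]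
    congr 2
    ring
  rw [← h2, ← smul_eq_mul, ← h, heat]
  congr 1
  ext w
  rw [norm_smul, mul_pow, Real.norm_of_nonneg hs.le, Real.sq_sqrt hT.le, zero_add]
  congr 2
  field_simp

/-- The average of `f` against the heat kernel. -/
noncomputable def gaussAvg (f : V → ℝ) (T : ℝ) : ℝ :=
  (4 * Real.pi * T) ^ (-((Module.finrank ℝ V : ℝ) / 2)) *
    ∫ y, Real.exp (-‖y‖ ^ 2 / (4 * T)) * f y

lemma heat_eq_gaussAvg (f : V → ℝ) {T : ℝ} (hT : 0 < T) :
    heat f T 0 = gaussNormMgf V 0 * gaussAvg f T := by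
  rw [heat_zero_eq f hT, gaussAvg, gaussNormMgf_zero, Real.mul_rpow (by positivity) hT.le,
    Real.rpow_neg (by positivity : 0 ≤ 4 * Real.pi)]
  have : 0 < (4 * Real.pi) ^ ((Module.finrank ℝ V : ℝ) / 2) := by positivity
  field_simp

lemma LogLip.gaussAvg_pos {ℓ : ℝ} {f : V → ℝ} (hf : LogLip ℓ f) {T : ℝ} (hT : 0 < T) :
    0 < gaussAvg f T := by
  have h := hf.heat_pos T 0
  rw [heat_eq_gaussAvg f hT] at h
  exact pos_of_mul_pos_right h (gaussNormMgf_pos 0).le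

variable {ι : Type*} [Fintype ι] {H : ι → Type*} {E : Type*}
  [NormedAddCommGroup E] [InnerProductSpace ℝ E] [FiniteDimensional ℝ E]
  [MeasurableSpace E] [BorelSpace E]
  [∀ i, NormedAddCommGroup (H i)] [∀ i, InnerProductSpace ℝ (H i)]
  [∀ i, FiniteDimensional ℝ (H i)] [∀ i, MeasurableSpace (H i)] [∀ i, BorelSpace (H i)]
  {L : ∀ i, H i →L[ℝ] E} {B : ∀ i, E →L[ℝ] H i} {c : ι → ℝ} {ℓ : ℝ} {f : ∀ i, H i → ℝ}
  {g : E → ℝ}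

theorem prod_gaussAvg_le (hc : ∀ i, 0 < c i) (hg : LogLip ℓ g)
    (hf : ∀ i, LogLip ℓ (f i))
    (hB : ∀ i y, ‖(B i).adjoint y‖ = ‖y‖) (hL : ∀ z, ∑ i, L i (B i z) = z)
    (hLc : ∀ z, ∑ i, (c i)⁻¹ * ‖(L i).adjoint z‖ ^ 2 ≤ ‖z‖ ^ 2)
    (hfg : ∀ x : ∀ i, H i, ∏ i, f i (x i) ^ c i ≤ g (∑ i, L i (x i)))
    {T : ℝ} (hT : 0 < T) :
    ∏ i, gaussAvg (f i) T ^ c i ≤ gaussAvg g T := by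
  have h := heatGap_ge_of_coisometry hc hg hf hB hL hLc hfg hT
  rw [heatGap, heatGapBound] at h
  simp only [Real.sqrt_zero, mul_zero, neg_zero, Pi.zero_apply, map_zero, Finset.sum_const_zero,
    heat_eq_gaussAvg _ hT] at h
  have h1 : ∀ i, c i * Real.log (gaussNormMgf (H i) 0 * gaussAvg (f i) T) =
      c i * Real.log (gaussNormMgf (H i) 0) + c i * Real.log (gaussAvg (f i) T) := fun i => by
    rw [Real.log_mul (gaussNormMgf_pos 0).ne' ((hf i).gaussAvg_pos hT).ne', mul_add]
  rw [Real.log_mul (gaussNormMgf_pos 0).ne' (hg.gaussAvg_pos hT).ne',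
    Finset.sum_congr rfl fun i _ => h1 i, Finset.sum_add_distrib] at h
  have h2 : Real.log (∏ i, gaussAvg (f i) T ^ c i) = ∑ i, c i * Real.log (gaussAvg (f i) T) := by
    rw [Real.log_prod fun i _ => (Real.rpow_pos_of_pos ((hf i).gaussAvg_pos hT) _).ne']
    exact Finset.sum_congr rfl fun i _ => Real.log_rpow ((hf i).gaussAvg_pos hT) _
  have h3 : 0 < ∏ i, gaussAvg (f i) T ^ c i :=
    Finset.prod_pos fun i _ => Real.rpow_pos_of_pos ((hf i).gaussAvg_pos hT) _
  rw [← Real.log_le_log_iff h3 (hg.gaussAvg_pos hT), h2]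
  linarith

end GaussianForm

section NearNormal

variable {ι : Type*} [Fintype ι] {H : ι → Type*} {E : Type*}
  [NormedAddCommGroup E] [InnerProductSpace ℝ E] [FiniteDimensional ℝ E]
  [MeasurableSpace E] [BorelSpace E]
  [∀ i, NormedAddCommGroup (H i)] [∀ i, InnerProductSpace ℝ (H i)]
  [∀ i, FiniteDimensional ℝ (H i)] [∀ i, MeasurableSpace (H i)] [∀ i, BorelSpace (H i)]

/-- Up to linear changes of variables of controlled size and up to a relative error `η`, the datum
`(B, c)` is geometric with reverse Brascamp-Lieb constant at least `d`. -/
def NearGeometric (B : ∀ i, E →L[ℝ] H i) (c : ι → ℝ) (d η S : ℝ) : Prop :=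
  ∃ (R : E →L[ℝ] E) (P : ∀ i, H i →L[ℝ] H i) (B' : ∀ i, E →L[ℝ] H i) (L : ∀ i, H i →L[ℝ] E),
    R.det ≠ 0 ∧ (∀ i, (P i).det ≠ 0) ∧ (∀ i y, ‖(B' i).adjoint y‖ = ‖y‖) ∧
    (∀ z, ∑ i, L i (B' i z) = z) ∧
    (∀ z, ∑ i, (c i)⁻¹ * ‖(L i).adjoint z‖ ^ 2 ≤ (1 + η) * ‖z‖ ^ 2) ∧
    (∀ i y, R (L i y) = c i • (B i).adjoint (P i y)) ∧
    (∀ i y, ‖y‖ ^ 2 ≤ 2 * Real.exp S * ‖P i y‖ ^ 2) ∧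
    (∀ i, |(P i).det| ≤ Real.exp S) ∧
    d * ∏ i, |(P i).det| ^ c i ≤ |R.det| * (1 + η) ^ ((Module.finrank ℝ E : ℝ) / 2)

variable {B : ∀ i, E →L[ℝ] H i} {c : ι → ℝ} {ℓ : ℝ} {f : ∀ i, H i → ℝ} {g : E → ℝ}

lemma LogLip.integrable_exp_mul {ℓ : ℝ} {f : E → ℝ} (hf : LogLip ℓ f) {a : ℝ} (ha : 0 < a) :
    Integrable fun y => Real.exp (-(a * ‖y‖ ^ 2)) * f y := by
  have hc := hf.continuous
  refine ((integrable_exp_quadratic_norm (V := E) ha ℓ).mul_const (f 0)).mono' (by fun_prop)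
    (ae_of_all _ fun w => ?_)
  have h1 := hf.le w 0
  rw [sub_zero] at h1
  rw [Real.norm_of_nonneg (mul_nonneg (Real.exp_pos _).le (hf.pos _).le), Real.exp_add, mul_assoc,
    mul_comm _ (f 0), neg_mul]
  gcongr

lemma LogLip.integral_exp_mul_pos {ℓ : ℝ} {f : E → ℝ} (hf : LogLip ℓ f) {a : ℝ} (ha : 0 < a) :
    0 < ∫ y, Real.exp (-(a * ‖y‖ ^ 2)) * f y := by
  refine (integral_pos_iff_support_of_nonneg (fun w => ?_) (hf.integrable_exp_mul ha)).2 ?_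
  · exact mul_nonneg (Real.exp_pos _).le (hf.pos _).le
  · have : Function.support (fun y => Real.exp (-(a * ‖y‖ ^ 2)) * f y) = Set.univ := by
      ext w; simp [(hf.pos _).ne']
    rw [this]
    exact isOpen_univ.measure_pos _ Set.univ_nonempty

lemma NearGeometric.prod_integral_le {d η S C : ℝ} (h : NearGeometric B c d η S)
    (hη : 0 < η) (hc : ∀ i, 0 < c i)
    (hsum : ∑ i, c i * (Module.finrank ℝ (H i) : ℝ) = Module.finrank ℝ E)
    (hf : ∀ i, LogLip ℓ (f i)) (hg : LogLip ℓ g) (hgi : Integrable g) (hgC : ∀ x, g x ≤ C)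
    (hfg : ∀ x : ∀ i, H i, ∏ i, f i (x i) ^ c i ≤ g (∑ i, c i • (B i).adjoint (x i))) :
    d * ((1 + η) ^ (-((Module.finrank ℝ E : ℝ) / 2)) *
      (4 * Real.pi * (Real.exp S / η)) ^ (-(η * ((Module.finrank ℝ E : ℝ) / 2))) *
      Real.exp (-(η * S * ∑ i, c i))) *
      ∏ i, (∫ x, Real.exp (-(η / 2 * ‖x‖ ^ 2)) * f i x) ^ ((1 + η) * c i)
      ≤ C ^ η * ∫ x, g x := by
  obtain ⟨R, P, B', L, hR, hP, hB', hL, hLc, hRL, hPn, hPd, hdet⟩ := h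
  set T := Real.exp S / η with hT
  have hT0 : 0 < T := by positivity
  have h1η : 0 < 1 + η := by linarith
  have hℓ := hg.nonneg
  set ℓ' := (1 + η) * (ℓ * ‖R‖) + ∑ i, ℓ * ‖P i‖ with hℓ'
  have hG : LogLip ℓ' (fun x => g (R x) ^ (1 + η)) :=
    ((hg.comp_clm R).rpow h1η.le).mono (le_add_of_nonneg_right (by positivity))
  have hF : ∀ i, LogLip ℓ' (fun x => f i (P i x)) := fun i =>
    ((hf i).comp_clm (P i)).mono ((Finset.single_le_sum (f := fun i => ℓ * ‖P i‖)
      (fun j _ => by positivity) (Finset.mem_univ i)).trans (le_add_of_nonneg_left (by positivity)))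
  have key := prod_gaussAvg_le (c := fun i => (1 + η) * c i) (fun i => mul_pos h1η (hc i)) hG hF
    hB' hL (fun z => by
      have h2 : ∀ i, ((1 + η) * c i)⁻¹ * ‖(L i).adjoint z‖ ^ 2
          = (1 + η)⁻¹ * ((c i)⁻¹ * ‖(L i).adjoint z‖ ^ 2) := fun i => by
        rw [mul_inv, mul_assoc]
      rw [Finset.sum_congr rfl fun i _ => h2 i, ← Finset.mul_sum, inv_mul_le_iff₀ h1η]
      exact hLc z) (fun x => by
      have h2 : R (∑ i, L i (x i)) = ∑ i, c i • (B i).adjoint (P i (x i)) := by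
        rw [map_sum]
        exact Finset.sum_congr rfl fun i _ => hRL i (x i)
      have h3 := hfg fun i => P i (x i)
      simp only [h2]
      refine le_trans (le_of_eq ?_) (Real.rpow_le_rpow (Finset.prod_nonneg fun i _ =>
        Real.rpow_nonneg ((hf i).pos _).le _) h3 h1η.le)
      rw [← Real.finsetProd_rpow _ _ fun i _ => Real.rpow_nonneg ((hf i).pos _).le _]
      refine Finset.prod_congr rfl fun i _ => ?_
      rw [← Real.rpow_mul ((hf i).pos _).le, mul_comm]) hT0
  -- bound the right-hand side
  have hgiC : Integrable fun x => g x ^ (1 + η) := by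
    refine (hgi.const_mul (C ^ η)).mono' ((hg.rpow h1η.le).continuous.aestronglyMeasurable)
      (ae_of_all _ fun x => ?_)
    rw [Real.norm_of_nonneg (Real.rpow_nonneg (hg.pos x).le _), Real.rpow_add (hg.pos x),
      Real.rpow_one, mul_comm]
    have := (hg.pos x).le
    gcongr
    exact hgC x
  have hgint : ∫ x, g x ^ (1 + η) ≤ C ^ η * ∫ x, g x := by
    rw [← integral_const_mul]
    refine integral_mono hgiC (hgi.const_mul _) fun x => ?_
    simp only
    rw [Real.rpow_add (hg.pos x), Real.rpow_one, mul_comm]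
    have := (hg.pos x).le
    gcongr
    exact hgC x
  have hdiv : ∀ r : ℝ, -r ^ 2 / (4 * T) = -(1 / (4 * T) * r ^ 2) := fun r => by ring
  have hright : gaussAvg (fun x => g (R x) ^ (1 + η)) T ≤
      (4 * Real.pi * T) ^ (-((Module.finrank ℝ E : ℝ) / 2)) *
        (|R.det|⁻¹ * (C ^ η * ∫ x, g x)) := by
    rw [gaussAvg]
    gcongr
    have hcomp := integral_comp_clm R hR fun x => g x ^ (1 + η)
    have hfint : Integrable fun x => g (R x) ^ (1 + η) := by
      by_contra hni
      rw [integral_undef hni] at hcomp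
      have h5 : 0 < ∫ x, g x ^ (1 + η) := by
        refine (integral_pos_iff_support_of_nonneg (fun w => ?_) hgiC).2 ?_
        · exact Real.rpow_nonneg (hg.pos _).le _
        · have : Function.support (fun x => g x ^ (1 + η)) = Set.univ := by
            ext w; simp [(Real.rpow_pos_of_pos (hg.pos w) (1 + η)).ne']
          rw [this]
          exact isOpen_univ.measure_pos _ Set.univ_nonempty
      have h6 := abs_pos.2 hR
      have h7 : 0 < |R.det|⁻¹ * ∫ x, g x ^ (1 + η) := by positivity
      exact h7.ne hcomp
    calc ∫ y, Real.exp (-‖y‖ ^ 2 / (4 * T)) * g (R y) ^ (1 + η)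
        ≤ ∫ y, g (R y) ^ (1 + η) := by
          refine integral_mono ?_ hfint fun y => ?_
          · simp only [hdiv]
            exact hG.integrable_exp_mul (by positivity)
          · refine mul_le_of_le_one_left (Real.rpow_nonneg (hg.pos _).le _) ?_
            rw [Real.exp_le_one_iff, hdiv, neg_nonpos]
            positivity
      _ = |R.det|⁻¹ * ∫ x, g x ^ (1 + η) := hcomp
      _ ≤ _ := by gcongr
  set J : ι → ℝ := fun i => ∫ x, Real.exp (-(η / 2 * ‖x‖ ^ 2)) * f i x with hJ
  have hJ0 : ∀ i, 0 < J i := fun i => (hf i).integral_exp_mul_pos (by positivity)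
  have hdp : ∀ i, 0 < |(P i).det| := fun i => abs_pos.2 (hP i)
  have hleft : ∀ i, (4 * Real.pi * T) ^ (-((Module.finrank ℝ (H i) : ℝ) / 2)) *
      (|(P i).det|⁻¹ * J i) ≤ gaussAvg (fun x => f i (P i x)) T := by
    intro i
    rw [gaussAvg]
    gcongr
    rw [hJ, ← integral_comp_clm (P i) (hP i) fun x => Real.exp (-(η / 2 * ‖x‖ ^ 2)) * f i x]
    have hineq : ∀ y : H i, Real.exp (-(η / 2 * ‖P i y‖ ^ 2)) * f i (P i y) ≤
        Real.exp (-‖y‖ ^ 2 / (4 * T)) * f i (P i y) := fun y => by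
      have h4 := ((hf i).pos (P i y)).le
      gcongr
      rw [hdiv, neg_le_neg_iff, hT]
      have h5 := mul_le_mul_of_nonneg_left (hPn i y)
        (show 0 ≤ 1 / (4 * (Real.exp S / η)) by positivity)
      refine h5.trans_eq ?_
      field_simp
      norm_num
    have hfint : Integrable fun y => Real.exp (-‖y‖ ^ 2 / (4 * T)) * f i (P i y) := by
      simp only [hdiv]
      exact (hF i).integrable_exp_mul (by positivity)
    refine integral_mono (hfint.mono' ?_ (ae_of_all _ fun y => ?_)) hfint hineq
    · have := (hf i).continuous
      exact Continuous.aestronglyMeasurable (by fun_prop)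
    · rw [Real.norm_of_nonneg (mul_nonneg (Real.exp_pos _).le ((hf i).pos _).le)]
      exact hineq y
  have hmain := (Finset.prod_le_prod (fun i _ => by
      have := hJ0 i; have := hdp i; positivity) fun i (_ : i ∈ Finset.univ) =>
      Real.rpow_le_rpow (by have := hJ0 i; have := hdp i; positivity) (hleft i)
        (mul_pos h1η (hc i)).le).trans (key.trans hright)
  set A := 4 * Real.pi * T with hA
  have hA0 : 0 < A := by positivity
  set N := (Module.finrank ℝ E : ℝ) with hN
  have hprod : ∏ i, (A ^ (-((Module.finrank ℝ (H i) : ℝ) / 2)) * (|(P i).det|⁻¹ * J i)) ^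
      ((1 + η) * c i) = A ^ (-(N / 2)) * A ^ (-(η * (N / 2))) *
      ((∏ i, |(P i).det| ^ c i)⁻¹ * (∏ i, |(P i).det| ^ (η * c i))⁻¹ *
        ∏ i, J i ^ ((1 + η) * c i)) := by
    rw [← Real.rpow_add hA0, ← Finset.prod_inv_distrib, ← Finset.prod_inv_distrib,
      ← Finset.prod_mul_distrib, ← Finset.prod_mul_distrib]
    have h5 : A ^ (-(N / 2) + -(η * (N / 2))) =
        ∏ i, A ^ (-((Module.finrank ℝ (H i) : ℝ) / 2) * ((1 + η) * c i)) := by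
      rw [← Real.rpow_sum_of_pos hA0, ← hsum]
      congr 1
      rw [Finset.sum_div, ← Finset.sum_neg_distrib, Finset.mul_sum, ← Finset.sum_neg_distrib,
        ← Finset.sum_add_distrib]
      refine Finset.sum_congr rfl fun i _ => ?_
      ring
    rw [h5, ← Finset.prod_mul_distrib]
    refine Finset.prod_congr rfl fun i _ => ?_
    have h6 := hJ0 i
    have h7 := hdp i
    rw [Real.mul_rpow (by positivity) (by positivity), Real.mul_rpow (by positivity) h6.le,
      ← Real.rpow_mul hA0.le, Real.inv_rpow h7.le, add_mul 1 η, one_mul, Real.rpow_add h7, mul_inv]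
  rw [hprod, mul_assoc] at hmain
  have hmain2 := le_of_mul_le_mul_left hmain (Real.rpow_pos_of_pos hA0 (-(N / 2)))
  have hR0 := abs_pos.2 hR
  rw [le_inv_mul_iff₀ hR0] at hmain2
  have hD0 : 0 < ∏ i, |(P i).det| ^ c i := Finset.prod_pos fun i _ => Real.rpow_pos_of_pos (hdp i) _
  have hJp : 0 < ∏ i, J i ^ ((1 + η) * c i) :=
    Finset.prod_pos fun i _ => Real.rpow_pos_of_pos (hJ0 i) _
  have hexp : Real.exp (-(η * S * ∑ i, c i)) ≤ (∏ i, |(P i).det| ^ (η * c i))⁻¹ := by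
    rw [Real.exp_neg]
    refine inv_anti₀ (Finset.prod_pos fun i _ => Real.rpow_pos_of_pos (hdp i) _) ?_
    rw [Finset.mul_sum, Real.exp_sum]
    refine Finset.prod_le_prod (fun i _ => Real.rpow_nonneg (abs_nonneg _) _) fun i _ => ?_
    refine (Real.rpow_le_rpow (abs_nonneg _) (hPd i) (mul_pos hη (hc i)).le).trans_eq ?_
    rw [← Real.exp_mul]
    ring_nf
  have hdet' : d * (1 + η) ^ (-(N / 2)) ≤ |R.det| * (∏ i, |(P i).det| ^ c i)⁻¹ := by
    rw [Real.rpow_neg h1η.le, ← div_eq_mul_inv, ← div_eq_mul_inv,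
      div_le_div_iff₀ (Real.rpow_pos_of_pos h1η _) hD0]
    exact hdet
  have hAe := Real.rpow_pos_of_pos hA0 (-(η * (N / 2)))
  calc _ = (d * (1 + η) ^ (-(N / 2))) * Real.exp (-(η * S * ∑ i, c i)) *
        (A ^ (-(η * (N / 2))) * ∏ i, J i ^ ((1 + η) * c i)) := by ring
    _ ≤ (|R.det| * (∏ i, |(P i).det| ^ c i)⁻¹) * (∏ i, |(P i).det| ^ (η * c i))⁻¹ *
        (A ^ (-(η * (N / 2))) * ∏ i, J i ^ ((1 + η) * c i)) := by
        gcongr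
    _ = _ := by ring
    _ ≤ _ := hmain2

end NearNormal

section NearNormalLimit

variable {ι : Type*} [Fintype ι] {H : ι → Type*} {E : Type*}
  [NormedAddCommGroup E] [InnerProductSpace ℝ E] [FiniteDimensional ℝ E]
  [MeasurableSpace E] [BorelSpace E]
  [∀ i, NormedAddCommGroup (H i)] [∀ i, InnerProductSpace ℝ (H i)]
  [∀ i, FiniteDimensional ℝ (H i)] [∀ i, MeasurableSpace (H i)] [∀ i, BorelSpace (H i)]

variable {B : ∀ i, E →L[ℝ] H i} {c : ι → ℝ} {ℓ : ℝ} {f : ∀ i, H i → ℝ} {g : E → ℝ}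

theorem prod_integral_le_of_nearGeometric {d C : ℝ}
    (hNG : ∀ δ > 0, ∃ η S, 0 < η ∧ η < δ ∧ 0 ≤ S ∧ η * S ≤ δ ∧ NearGeometric B c d η S)
    (hc : ∀ i, 0 < c i)
    (hsum : ∑ i, c i * (Module.finrank ℝ (H i) : ℝ) = Module.finrank ℝ E)
    (hf : ∀ i, LogLip ℓ (f i)) (hg : LogLip ℓ g) (hgi : Integrable g) (hgC : ∀ x, g x ≤ C)
    (hfi : ∀ i, Integrable (f i))
    (hfg : ∀ x : ∀ i, H i, ∏ i, f i (x i) ^ c i ≤ g (∑ i, c i • (B i).adjoint (x i))) :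
    d * ∏ i, (∫ x, f i x) ^ c i ≤ ∫ x, g x := by
  have hδ : ∀ m : ℕ, (0 : ℝ) < 1 / ((m : ℝ) + 1) := fun m => by positivity
  choose η S hη hηδ hS hηS hN using fun m : ℕ => hNG _ (hδ m)
  have hC : 0 < C := (hg.pos 0).trans_le (hgC 0)
  have hδ0 : Tendsto (fun m : ℕ => 1 / ((m : ℝ) + 1)) atTop (𝓝 0) :=
    tendsto_one_div_add_atTop_nhds_zero_nat
  have hη0 : Tendsto η atTop (𝓝 0) :=
    squeeze_zero (fun m => (hη m).le) (fun m => (hηδ m).le) hδ0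
  have hηS0 : Tendsto (fun m => η m * S m) atTop (𝓝 0) :=
    squeeze_zero (fun m => mul_nonneg (hη m).le (hS m)) hηS hδ0
  have hlog : Tendsto (fun m => η m * Real.log (η m)) atTop (𝓝 0) := by
    have := (Real.continuous_mul_log.tendsto 0).comp hη0
    simpa [Function.comp_def] using this
  set N := (Module.finrank ℝ E : ℝ)
  have h1 : Tendsto (fun m => (1 + η m) ^ (-(N / 2))) atTop (𝓝 1) := by
    have : Tendsto (fun m => 1 + η m) atTop (𝓝 1) := by simpa using hη0.const_add 1
    simpa using this.rpow_const (p := -(N / 2)) (Or.inl one_ne_zero)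
  have h2 : Tendsto (fun m => (4 * Real.pi * (Real.exp (S m) / η m)) ^ (-(η m * (N / 2)))) atTop
      (𝓝 1) := by
    have h3 : ∀ m, (4 * Real.pi * (Real.exp (S m) / η m)) ^ (-(η m * (N / 2))) =
        Real.exp (-((N / 2) * (η m * Real.log (4 * Real.pi) + η m * S m -
          η m * Real.log (η m)))) := fun m => by
      have := hη m
      rw [Real.rpow_def_of_pos (by positivity), Real.log_mul (by positivity) (by positivity),
        Real.log_div (Real.exp_pos _).ne' this.ne', Real.log_exp]
      congr 1
      ring
    simp only [h3]
    have h4 : Tendsto (fun m => -((N / 2) * (η m * Real.log (4 * Real.pi) + η m * S m -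
          η m * Real.log (η m)))) atTop (𝓝 0) := by
      simpa using ((((hη0.mul_const (Real.log (4 * Real.pi))).add hηS0).sub hlog).const_mul
        (N / 2)).neg
    simpa [Function.comp_def] using (Real.continuous_exp.tendsto 0).comp h4
  have h3 : Tendsto (fun m => Real.exp (-(η m * S m * ∑ i, c i))) atTop (𝓝 1) := by
    have h4 : Tendsto (fun m => -(η m * S m * ∑ i, c i)) atTop (𝓝 0) := by
      simpa using (hηS0.mul_const (∑ i, c i)).neg
    simpa [Function.comp_def] using (Real.continuous_exp.tendsto 0).comp h4
  have h4 : ∀ i, Tendsto (fun m => ∫ x, Real.exp (-(η m / 2 * ‖x‖ ^ 2)) * f i x) atTop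
      (𝓝 (∫ x, f i x)) := fun i => by
    have hci := (hf i).continuous
    refine tendsto_integral_of_dominated_convergence (f i)
      (fun m => Continuous.aestronglyMeasurable (by fun_prop)) (hfi i)
      (fun m => ae_of_all _ fun x => ?_) (ae_of_all _ fun x => ?_)
    · rw [Real.norm_of_nonneg (mul_nonneg (Real.exp_pos _).le ((hf i).pos _).le)]
      refine mul_le_of_le_one_left ((hf i).pos _).le ?_
      rw [Real.exp_le_one_iff, neg_nonpos]
      have := hη m
      positivity
    · have h5 : Tendsto (fun m => -(η m / 2 * ‖x‖ ^ 2)) atTop (𝓝 0) := by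
        simpa using ((hη0.div_const 2).mul_const (‖x‖ ^ 2)).neg
      simpa using ((Real.continuous_exp.tendsto 0).comp h5).mul_const (f i x)
  have hpos : ∀ i, 0 < ∫ x, f i x := fun i => by
    refine (integral_pos_iff_support_of_nonneg (fun w => ((hf i).pos w).le) (hfi i)).2 ?_
    have : Function.support (f i) = Set.univ := by
      ext w; simp [((hf i).pos w).ne']
    rw [this]
    exact isOpen_univ.measure_pos _ Set.univ_nonempty
  have h5 : Tendsto (fun m => ∏ i, (∫ x, Real.exp (-(η m / 2 * ‖x‖ ^ 2)) * f i x) ^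
      ((1 + η m) * c i)) atTop (𝓝 (∏ i, (∫ x, f i x) ^ c i)) := by
    refine tendsto_finsetProd _ fun i _ => (h4 i).rpow ?_ (Or.inl (hpos i).ne')
    simpa using (hη0.const_add 1).mul_const (c i)
  have h6 : Tendsto (fun m => C ^ η m * ∫ x, g x) atTop (𝓝 (∫ x, g x)) := by
    simpa using (tendsto_const_nhds.rpow hη0 (Or.inl hC.ne')).mul_const (∫ x, g x)
  have h7 := (((h1.mul h2).mul h3).const_mul d).mul h5
  simp only [mul_one] at h7
  exact le_of_tendsto_of_tendsto' h7 h6 fun m =>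
    (hN m).prod_integral_le (hη m) hc hsum hf hg hgi hgC hfg

end NearNormalLimit

section OperatorPenalty

variable {V : Type*} [NormedAddCommGroup V] [InnerProductSpace ℝ V] [FiniteDimensional ℝ V]
  [MeasurableSpace V] [BorelSpace V]

/-- The squared Hilbert-Schmidt norm. -/
noncomputable def hsNormSq (X : V →L[ℝ] V) : ℝ := ∑ j, ‖X (stdOrthonormalBasis ℝ V j)‖ ^ 2

/-- The map `v ↦ v + s ⟪q, v⟫ q`. -/
noncomputable def rankOneAdd (s : ℝ) (q : V) : V →L[ℝ] V :=
  ContinuousLinearMap.id ℝ V + s • (innerSL ℝ q).smulRight q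

lemma rankOneAdd_apply (s : ℝ) (q v : V) : rankOneAdd s q v = v + (s * ⟪q, v⟫) • q := by
  simp [rankOneAdd, mul_smul]

lemma det_rankOneAdd (s : ℝ) (q : V) : (rankOneAdd s q).det = 1 + s * ‖q‖ ^ 2 := by
  have h : ((rankOneAdd s q : V →L[ℝ] V) : V →ₗ[ℝ] V) =
      LinearMap.transvection (s • (innerSL ℝ q : V →ₗ[ℝ] ℝ)) q := by
    ext v
    simp [rankOneAdd_apply, LinearMap.transvection.apply]
  rw [ContinuousLinearMap.det, h, LinearMap.transvection.det]
  simp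

lemma adjoint_rankOneAdd (s : ℝ) (q : V) : (rankOneAdd s q).adjoint = rankOneAdd s q := by
  refine ((ContinuousLinearMap.eq_adjoint_iff _ _).2 fun x y => ?_).symm
  rw [rankOneAdd_apply, rankOneAdd_apply, inner_add_left, inner_add_right,
    real_inner_smul_left, real_inner_smul_right, real_inner_comm x q]
  ring

lemma det_comp (X Y : V →L[ℝ] V) : (X.comp Y).det = X.det * Y.det :=
  LinearMap.det_comp (X : V →ₗ[ℝ] V) (Y : V →ₗ[ℝ] V)

lemma hsNormSq_nonneg (X : V →L[ℝ] V) : 0 ≤ hsNormSq X :=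
  Finset.sum_nonneg fun _ _ => by positivity

lemma continuous_hsNormSq : Continuous (hsNormSq : (V →L[ℝ] V) → ℝ) := by
  unfold hsNormSq
  fun_prop

lemma norm_adjoint_sq_eq_sum (X : V →L[ℝ] V) (q : V) :
    ‖X.adjoint q‖ ^ 2 = ∑ j, ⟪q, X (stdOrthonormalBasis ℝ V j)⟫ ^ 2 := by
  rw [← (stdOrthonormalBasis ℝ V).sum_sq_norm_inner_left (X.adjoint q)]
  refine Finset.sum_congr rfl fun j _ => ?_
  rw [ContinuousLinearMap.adjoint_inner_left, Real.norm_eq_abs, sq_abs]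

lemma norm_adjoint_sq_le_hsNormSq (X : V →L[ℝ] V) (q : V) :
    ‖X.adjoint q‖ ^ 2 ≤ hsNormSq X * ‖q‖ ^ 2 := by
  rw [norm_adjoint_sq_eq_sum, hsNormSq, Finset.sum_mul]
  refine Finset.sum_le_sum fun j _ => ?_
  rw [← sq_abs, mul_comm, ← mul_pow]
  gcongr
  exact abs_real_inner_le_norm _ _

lemma norm_le_sqrt_hsNormSq (X : V →L[ℝ] V) : ‖X‖ ≤ √(hsNormSq X) := by
  rw [← ContinuousLinearMap.adjoint.norm_map X]
  refine ContinuousLinearMap.opNorm_le_bound _ (Real.sqrt_nonneg _) fun q => ?_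
  refine abs_le_of_sq_le_sq' ?_ (by positivity) |>.2
  rw [mul_pow, Real.sq_sqrt (hsNormSq_nonneg X)]
  exact norm_adjoint_sq_le_hsNormSq X q

lemma det_sq_le_hsNormSq_pow (X : V →L[ℝ] V) :
    X.det ^ 2 ≤ hsNormSq X ^ Module.finrank ℝ V := by
  have h := abs_det_le_pow X (Real.sqrt_nonneg _) fun x =>
    (X.le_opNorm x).trans (mul_le_mul_of_nonneg_right (norm_le_sqrt_hsNormSq X) (norm_nonneg x))
  calc X.det ^ 2 = |X.det| ^ 2 := (sq_abs _).symm
    _ ≤ (√(hsNormSq X) ^ Module.finrank ℝ V) ^ 2 := by gcongr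
    _ = _ := by rw [← pow_mul, mul_comm, pow_mul, Real.sq_sqrt (hsNormSq_nonneg X)]

lemma hsNormSq_rankOneAdd_comp (s : ℝ) (q : V) (X : V →L[ℝ] V) :
    hsNormSq ((rankOneAdd s q).comp X) =
      hsNormSq X + (2 * s + s ^ 2 * ‖q‖ ^ 2) * ‖X.adjoint q‖ ^ 2 := by
  rw [norm_adjoint_sq_eq_sum, hsNormSq, hsNormSq, Finset.mul_sum, ← Finset.sum_add_distrib]
  refine Finset.sum_congr rfl fun j _ => ?_
  rw [ContinuousLinearMap.comp_apply, rankOneAdd_apply, norm_add_sq_real, norm_smul,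
    real_inner_smul_right, mul_pow, Real.norm_eq_abs, sq_abs, real_inner_comm q]
  ring

/-- A coercive penalty on invertible operators. -/
noncomputable def opPenalty (X : V →L[ℝ] V) : ℝ :=
  ((Module.finrank ℝ V : ℝ) + 1) * Real.log (1 + hsNormSq X) - 2 * Real.log |X.det|

lemma log_le_opPenalty {X : V →L[ℝ] V} (hX : X.det ≠ 0) :
    Real.log (1 + hsNormSq X) ≤ opPenalty X := by
  have h := det_sq_le_hsNormSq_pow X
  have h0 := hsNormSq_nonneg X
  have h1 : 0 < X.det ^ 2 := by positivity
  have h2 : 2 * Real.log |X.det| ≤ Module.finrank ℝ V * Real.log (1 + hsNormSq X) := by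
    have h3 : 2 * Real.log |X.det| = Real.log (X.det ^ 2) := by
      rw [Real.log_pow, Real.log_abs]; norm_num
    rw [h3, ← Real.log_pow]
    refine Real.log_le_log h1 (h.trans ?_)
    gcongr
    linarith
  rw [opPenalty]
  linarith

lemma opPenalty_nonneg {X : V →L[ℝ] V} (hX : X.det ≠ 0) : 0 ≤ opPenalty X :=
  (Real.log_nonneg (by linarith [hsNormSq_nonneg X])).trans (log_le_opPenalty hX)

lemma neg_two_mul_log_abs_det_le_opPenalty (X : V →L[ℝ] V) :
    -(2 * Real.log |X.det|) ≤ opPenalty X := by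
  have h : 0 ≤ Real.log (1 + hsNormSq X) := Real.log_nonneg (by linarith [hsNormSq_nonneg X])
  rw [opPenalty]
  have : 0 ≤ ((Module.finrank ℝ V : ℝ) + 1) * Real.log (1 + hsNormSq X) := by positivity
  linarith

lemma hsNormSq_le_exp_opPenalty {X : V →L[ℝ] V} (hX : X.det ≠ 0) :
    1 + hsNormSq X ≤ Real.exp (opPenalty X) :=
  (Real.log_le_iff_le_exp (by linarith [hsNormSq_nonneg X])).1 (log_le_opPenalty hX)

lemma det_sq_le_exp_opPenalty {X : V →L[ℝ] V} (hX : X.det ≠ 0) :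
    X.det ^ 2 ≤ Real.exp (Module.finrank ℝ V * opPenalty X) := by
  rw [Real.exp_nat_mul]
  refine (det_sq_le_hsNormSq_pow X).trans ?_
  have := hsNormSq_nonneg X
  gcongr
  linarith [hsNormSq_le_exp_opPenalty hX]

lemma pow_le_exp_opPenalty_mul {X : V →L[ℝ] V} (hX : X.det ≠ 0) :
    (1 + hsNormSq X) ^ Module.finrank ℝ V ≤ Real.exp (opPenalty X) * X.det ^ 2 := by
  have h0 := hsNormSq_nonneg X
  have h1 : 0 < 1 + hsNormSq X := by linarith
  have h2 : Real.exp (opPenalty X) * X.det ^ 2 = (1 + hsNormSq X) ^ (Module.finrank ℝ V + 1) := by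
    have h3 : opPenalty X = ((Module.finrank ℝ V + 1 : ℕ) : ℝ) * Real.log (1 + hsNormSq X) -
        Real.log (X.det ^ 2) := by
      rw [opPenalty, Real.log_pow, Real.log_abs]; push_cast; ring
    rw [h3, Real.exp_sub, Real.exp_nat_mul, Real.exp_log h1, Real.exp_log (by positivity)]
    field_simp
  rw [h2]
  exact pow_le_pow_right₀ (by linarith) (Nat.le_succ _)

lemma det_adjoint (X : V →L[ℝ] V) : X.adjoint.det = X.det := by
  have h := congrArg Matrix.det (LinearMap.toMatrix_adjoint (stdOrthonormalBasis ℝ V)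
    (stdOrthonormalBasis ℝ V) (X : V →ₗ[ℝ] V))
  rw [Matrix.det_conjTranspose, LinearMap.det_toMatrix, LinearMap.det_toMatrix] at h
  exact h

lemma exists_inverse {X : V →L[ℝ] V} (hX : X.det ≠ 0) :
    ∃ Y : V →L[ℝ] V, (∀ v, X (Y v) = v) ∧ ∀ v, Y (X v) = v := by
  refine ⟨(ContinuousLinearMap.toContinuousLinearEquivOfDetNeZero X hX).symm, fun v => ?_,
    fun v => ?_⟩
  · exact (ContinuousLinearMap.toContinuousLinearEquivOfDetNeZero X hX).apply_symm_apply v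
  · exact (ContinuousLinearMap.toContinuousLinearEquivOfDetNeZero X hX).symm_apply_apply v

lemma norm_sq_le_exp_opPenalty_mul {X : V →L[ℝ] V} (hX : X.det ≠ 0) (v : V) :
    ‖v‖ ^ 2 ≤ 2 ^ Module.finrank ℝ V * Real.exp (opPenalty X) * ‖X.adjoint v‖ ^ 2 := by
  rcases eq_or_ne v 0 with rfl | hv
  · simp
  have hv0 : 0 < ‖v‖ := norm_pos_iff.2 hv
  obtain ⟨Y, hY, -⟩ := exists_inverse (X := X.adjoint.adjoint) (by simpa using hX)
  have hw : 0 < ‖X.adjoint v‖ := by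
    refine norm_pos_iff.2 fun h => hv ?_
    have h1 : ⟪X.adjoint v, Y v⟫ = ‖v‖ ^ 2 := by
      rw [← ContinuousLinearMap.adjoint_inner_right, hY, real_inner_self_eq_norm_sq]
    rw [h, inner_zero_left] at h1
    simpa using h1.symm
  set w := ‖X.adjoint v‖ with hwdef
  -- a rank one perturbation of size `‖v‖ / w` in the direction `v / ‖v‖`
  set s := (‖v‖ * w)⁻¹ with hs
  have hs0 : 0 < s := by positivity
  have h1 := det_sq_le_hsNormSq_pow ((rankOneAdd s v).comp X)
  have hdet : ((rankOneAdd s v).comp X).det = (1 + s * ‖v‖ ^ 2) * X.det := by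
    rw [← det_rankOneAdd, det_comp]
  have hwN : w ^ 2 ≤ hsNormSq X * ‖v‖ ^ 2 := norm_adjoint_sq_le_hsNormSq X v
  have hN0 := hsNormSq_nonneg X
  have h2 : hsNormSq ((rankOneAdd s v).comp X) ≤ 2 * (1 + hsNormSq X) := by
    rw [hsNormSq_rankOneAdd_comp, ← hwdef]
    have h3 : (2 * s + s ^ 2 * ‖v‖ ^ 2) * w ^ 2 = 2 * (w / ‖v‖) + 1 := by
      rw [hs]; field_simp
    have h4 : (w / ‖v‖) ^ 2 ≤ hsNormSq X := by
      rw [div_pow, div_le_iff₀ (by positivity)]; exact hwN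
    rw [h3]
    nlinarith [sq_nonneg (w / ‖v‖ - 1)]
  rw [hdet] at h1
  have h5 := hsNormSq_nonneg ((rankOneAdd s v).comp X)
  have h6 : (s * ‖v‖ ^ 2) ^ 2 * X.det ^ 2 ≤
      2 ^ Module.finrank ℝ V * Real.exp (opPenalty X) * X.det ^ 2 := by
    calc (s * ‖v‖ ^ 2) ^ 2 * X.det ^ 2 ≤ (1 + s * ‖v‖ ^ 2) ^ 2 * X.det ^ 2 := by
          gcongr; linarith
      _ = ((1 + s * ‖v‖ ^ 2) * X.det) ^ 2 := by ring
      _ ≤ _ := h1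
      _ ≤ (2 * (1 + hsNormSq X)) ^ Module.finrank ℝ V := by gcongr
      _ = 2 ^ Module.finrank ℝ V * (1 + hsNormSq X) ^ Module.finrank ℝ V := mul_pow _ _ _
      _ ≤ 2 ^ Module.finrank ℝ V * (Real.exp (opPenalty X) * X.det ^ 2) := by
          gcongr; exact pow_le_exp_opPenalty_mul hX
      _ = _ := by ring
  have h7 := le_of_mul_le_mul_right h6 (by positivity)
  have h8 : (s * ‖v‖ ^ 2) ^ 2 * w ^ 2 = ‖v‖ ^ 2 := by rw [hs]; field_simp
  rw [← h8]
  gcongr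

/-- A positive operator has a self-adjoint square root. -/
lemma exists_selfAdjoint_sqrt {T : V →L[ℝ] V} (hT : T.adjoint = T) (hT0 : ∀ v, 0 ≤ ⟪v, T v⟫) :
    ∃ Y : V →L[ℝ] V, Y.adjoint = Y ∧ Y.comp Y = T := by
  have hs : (T : V →ₗ[ℝ] V).IsSymmetric := fun x y => by
    have := ContinuousLinearMap.adjoint_inner_left T y x
    rw [hT] at this
    exact this
  set b := hs.eigenvectorBasis rfl
  set e := hs.eigenvalues rfl
  have hb : ∀ j, T (b j) = e j • b j := fun j => hs.apply_eigenvectorBasis rfl j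
  have he : ∀ j, 0 ≤ e j := fun j => by
    have := hT0 (b j)
    rw [hb, real_inner_smul_right, real_inner_self_eq_norm_sq, b.norm_eq_one] at this
    simpa using this
  set Y : V →L[ℝ] V := ∑ j, √(e j) • (innerSL ℝ (b j)).smulRight (b j) with hY
  have hYb : ∀ j, Y (b j) = √(e j) • b j := fun j => by
    simp [hY, orthonormal_iff_ite.1 b.orthonormal]
  refine ⟨Y, ?_, ?_⟩
  · refine (ContinuousLinearMap.eq_adjoint_iff _ _).2 (fun x y => ?_) |>.symm
    simp only [hY, sum_apply, smul_apply,
      ContinuousLinearMap.smulRight_apply, innerSL_apply_apply, sum_inner, inner_sum,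
      real_inner_smul_left, real_inner_smul_right]
    refine Finset.sum_congr rfl fun j _ => ?_
    rw [real_inner_comm x (b j)]
    ring
  · refine ContinuousLinearMap.coe_injective (b.toBasis.ext fun j => ?_)
    change Y (Y (b.toBasis j)) = T (b.toBasis j)
    simp only [OrthonormalBasis.coe_toBasis, hYb, map_smul, hb, smul_smul,
      Real.mul_self_sqrt (he j)]

end OperatorPenalty

section GaussianFunctional

variable {ι : Type*} [Fintype ι] {H : ι → Type*} {E : Type*}
  [NormedAddCommGroup E] [InnerProductSpace ℝ E] [FiniteDimensional ℝ E]
  [MeasurableSpace E] [BorelSpace E]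
  [∀ i, NormedAddCommGroup (H i)] [∀ i, InnerProductSpace ℝ (H i)]
  [∀ i, FiniteDimensional ℝ (H i)] [∀ i, MeasurableSpace (H i)] [∀ i, BorelSpace (H i)]

/-- The operator `∑ cᵢ Bᵢ† Xᵢ† Xᵢ Bᵢ`. -/
noncomputable def blOp (B : ∀ i, E →L[ℝ] H i) (c : ι → ℝ) (X : ∀ i, H i →L[ℝ] H i) : E →L[ℝ] E :=
  ∑ i, c i • ((B i).adjoint.comp ((X i).adjoint.comp ((X i).comp (B i))))

/-- The constant `d` is admissible for centred Gaussian inputs. -/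
def GaussianBound (B : ∀ i, E →L[ℝ] H i) (c : ι → ℝ) (d : ℝ) : Prop :=
  ∀ X : ∀ i, H i →L[ℝ] H i, (∀ i, (X i).det ≠ 0) →
    d ^ 2 * ∏ i, (|(X i).det| ^ c i) ^ 2 ≤ (blOp B c X).det

/-- The logarithm of the Gaussian Brascamp-Lieb ratio. -/
noncomputable def blLogRatio (B : ∀ i, E →L[ℝ] H i) (c : ι → ℝ) (X : ∀ i, H i →L[ℝ] H i) : ℝ :=
  Real.log (blOp B c X).det - ∑ i, c i * (2 * Real.log |(X i).det|)

/-- The total penalty. -/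
noncomputable def blPenalty (c : ι → ℝ) (X : ∀ i, H i →L[ℝ] H i) : ℝ :=
  ∑ i, c i * opPenalty (X i)

variable {B : ∀ i, E →L[ℝ] H i} {c : ι → ℝ} {d η : ℝ}

lemma blOp_apply (X : ∀ i, H i →L[ℝ] H i) (z : E) :
    blOp B c X z = ∑ i, c i • (B i).adjoint ((X i).adjoint (X i (B i z))) := by
  simp [blOp]

lemma adjoint_blOp (X : ∀ i, H i →L[ℝ] H i) : (blOp B c X).adjoint = blOp B c X := by
  simp [blOp, ContinuousLinearMap.adjoint_comp, ContinuousLinearMap.comp_assoc]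

lemma inner_blOp (X : ∀ i, H i →L[ℝ] H i) (z : E) :
    ⟪z, blOp B c X z⟫ = ∑ i, c i * ‖X i (B i z)‖ ^ 2 := by
  rw [blOp_apply, inner_sum]
  refine Finset.sum_congr rfl fun i _ => ?_
  rw [real_inner_smul_right, ContinuousLinearMap.adjoint_inner_right,
    ContinuousLinearMap.adjoint_inner_right, real_inner_self_eq_norm_sq]

lemma continuous_blOp : Continuous (blOp B c) := by
  unfold blOp
  refine continuous_finsetSum _ fun i _ => ?_
  have h1 : Continuous fun X : ∀ i, H i →L[ℝ] H i => X i := continuous_apply i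
  have h2 : Continuous fun X : ∀ i, H i →L[ℝ] H i => (X i).adjoint :=
    ContinuousLinearMap.adjoint.continuous.comp h1
  exact (continuous_const.clm_comp (h2.clm_comp (h1.clm_comp continuous_const))).const_smul (c i)

lemma GaussianBound.det_pos (h : GaussianBound B c d) (hd : 0 < d) {X : ∀ i, H i →L[ℝ] H i}
    (hX : ∀ i, (X i).det ≠ 0) : 0 < (blOp B c X).det := by
  refine lt_of_lt_of_le ?_ (h X hX)
  have : 0 < ∏ i, (|(X i).det| ^ c i) ^ 2 := Finset.prod_pos fun i _ =>
    pow_pos (Real.rpow_pos_of_pos (abs_pos.2 (hX i)) _) 2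
  positivity

lemma GaussianBound.le_blLogRatio (h : GaussianBound B c d) (hd : 0 < d)
    {X : ∀ i, H i →L[ℝ] H i} (hX : ∀ i, (X i).det ≠ 0) : 2 * Real.log d ≤ blLogRatio B c X := by
  have hp : ∀ i, 0 < (|(X i).det| ^ c i) ^ 2 := fun i =>
    pow_pos (Real.rpow_pos_of_pos (abs_pos.2 (hX i)) _) 2
  have h0 : 0 < ∏ i, (|(X i).det| ^ c i) ^ 2 := Finset.prod_pos fun i _ => hp i
  have h1 := Real.log_le_log (by positivity) (h X hX)
  rw [Real.log_mul (by positivity) h0.ne', Real.log_pow, Real.log_prod fun i _ => (hp i).ne'] at h1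
  have h2 : ∀ i, Real.log ((|(X i).det| ^ c i) ^ 2) = c i * (2 * Real.log |(X i).det|) := fun i => by
    rw [Real.log_pow, Real.log_rpow (abs_pos.2 (hX i))]; push_cast; ring
  simp only [h2] at h1
  push_cast at h1
  rw [blLogRatio]
  linarith

lemma blPenalty_nonneg (hc : ∀ i, 0 < c i) {X : ∀ i, H i →L[ℝ] H i} (hX : ∀ i, (X i).det ≠ 0) :
    0 ≤ blPenalty c X :=
  Finset.sum_nonneg fun i _ => mul_nonneg (hc i).le (opPenalty_nonneg (hX i))

/-- The penalised functional attains its minimum. -/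
lemma GaussianBound.exists_min (h : GaussianBound B c d) (hd : 0 < d) (hc : ∀ i, 0 < c i)
    (hη : 0 < η) :
    ∃ X : ∀ i, H i →L[ℝ] H i, (∀ i, (X i).det ≠ 0) ∧ ∀ X' : ∀ i, H i →L[ℝ] H i,
      (∀ i, (X' i).det ≠ 0) →
        blLogRatio B c X + η * blPenalty c X ≤ blLogRatio B c X' + η * blPenalty c X' := by
  set X₁ : ∀ i, H i →L[ℝ] H i := fun i => ContinuousLinearMap.id ℝ (H i)
  have hX₁ : ∀ i, (X₁ i).det ≠ 0 := fun i => by simp [X₁, ContinuousLinearMap.det]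
  set F : (∀ i, H i →L[ℝ] H i) → ℝ := fun X => blLogRatio B c X + η * blPenalty c X with hF
  set κ := F X₁ - 2 * Real.log d with hκ
  set K : Set (∀ i, H i →L[ℝ] H i) := {X | ∀ i, hsNormSq (X i) ≤ Real.exp (κ / (η * c i)) ∧
    Real.exp (-(κ / (η * c i)) / 2) ≤ |(X i).det|} with hK
  have hKdet : ∀ X ∈ K, ∀ i, (X i).det ≠ 0 := fun X hX i =>
    abs_pos.1 ((Real.exp_pos _).trans_le (hX i).2)
  have hsub : ∀ X : ∀ i, H i →L[ℝ] H i, (∀ i, (X i).det ≠ 0) → F X ≤ F X₁ → X ∈ K := by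
    intro X hX hFX i
    have h1 := h.le_blLogRatio hd hX
    have h2 : c i * opPenalty (X i) ≤ blPenalty c X :=
      Finset.single_le_sum (f := fun i => c i * opPenalty (X i))
        (fun j _ => mul_nonneg (hc j).le (opPenalty_nonneg (hX j))) (Finset.mem_univ i)
    have h3 : opPenalty (X i) ≤ κ / (η * c i) := by
      rw [le_div_iff₀ (mul_pos hη (hc i))]
      have h4 := mul_le_mul_of_nonneg_left h2 hη.le
      have h5 : blLogRatio B c X + η * blPenalty c X ≤ F X₁ := hFX
      rw [hκ]
      linarith
    constructor
    · linarith [hsNormSq_le_exp_opPenalty (hX i), Real.exp_le_exp.2 h3]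
    · rw [← Real.le_log_iff_exp_le (abs_pos.2 (hX i))]
      linarith [neg_two_mul_log_abs_det_le_opPenalty (X i)]
  have hdetc : ∀ i, Continuous fun X : ∀ i, H i →L[ℝ] H i => (X i).det := fun i =>
    ContinuousLinearMap.continuous_det.comp (continuous_apply i)
  have hclosed : IsClosed K := by
    have : K = ⋂ i, {X | hsNormSq (X i) ≤ Real.exp (κ / (η * c i))} ∩
        {X | Real.exp (-(κ / (η * c i)) / 2) ≤ |(X i).det|} := by
      ext X; simp [hK]
    rw [this]
    refine isClosed_iInter fun i => IsClosed.inter ?_ ?_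
    · exact isClosed_le (continuous_hsNormSq.comp (continuous_apply i)) continuous_const
    · exact isClosed_le continuous_const (hdetc i).abs
  have hbdd : Bornology.IsBounded K := by
    refine Bornology.IsBounded.subset (Metric.isBounded_closedBall (x := 0)
      (r := ∑ i, √(Real.exp (κ / (η * c i))))) fun X hX => ?_
    rw [mem_closedBall_zero_iff]
    refine (pi_norm_le_iff_of_nonneg (by positivity)).2 fun i => ?_
    refine ((norm_le_sqrt_hsNormSq (X i)).trans (Real.sqrt_le_sqrt (hX i).1)).trans ?_
    exact Finset.single_le_sum (f := fun i => √(Real.exp (κ / (η * c i))))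
      (fun j _ => by positivity) (Finset.mem_univ i)
  have : ProperSpace (∀ i, H i →L[ℝ] H i) := FiniteDimensional.proper ℝ _
  have hcomp : IsCompact K := Metric.isCompact_of_isClosed_isBounded hclosed hbdd
  have hcont : ContinuousOn F K := by
    have hlogd : ∀ i, ContinuousOn (fun X : ∀ i, H i →L[ℝ] H i => Real.log |(X i).det|) K :=
      fun i => ContinuousOn.log (hdetc i).abs.continuousOn
        fun X hX => abs_ne_zero.2 (hKdet X hX i)
    refine ContinuousOn.add (ContinuousOn.sub ?_ ?_) (continuousOn_const.mul ?_)
    · exact ContinuousOn.log (ContinuousLinearMap.continuous_det.comp continuous_blOp).continuousOn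
        fun X hX => (h.det_pos hd (hKdet X hX)).ne'
    · exact continuousOn_finsetSum _ fun i _ => continuousOn_const.mul
        (continuousOn_const.mul (hlogd i))
    · refine continuousOn_finsetSum _ fun i _ => continuousOn_const.mul ?_
      refine ContinuousOn.sub (continuousOn_const.mul (ContinuousOn.log ?_ fun X _ => ?_))
        (continuousOn_const.mul (hlogd i))
      · exact (continuous_const.add (continuous_hsNormSq.comp (continuous_apply i))).continuousOn
      · have := hsNormSq_nonneg (X i)
        positivity
  have hmem : X₁ ∈ K := hsub X₁ hX₁ le_rfl
  obtain ⟨X, hXK, hXmin⟩ := hcomp.exists_isMinOn ⟨X₁, hmem⟩ hcont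
  refine ⟨X, hKdet X hXK, fun X' hX' => ?_⟩
  by_cases hle : F X' ≤ F X₁
  · exact hXmin (hsub X' hX' hle)
  · exact (hXmin hmem).trans (not_le.1 hle).le

lemma sum_update_eq {A : Type*} [AddCommGroup A] {W : ι → Type*} [DecidableEq ι]
    (G : ∀ j, W j → A) (X : ∀ j, W j) (i : ι) (Y : W i) :
    ∑ j, G j (Function.update X i Y j) = ∑ j, G j (X j) + (G i Y - G i (X i)) := by
  rw [← sub_eq_iff_eq_add', ← Finset.sum_sub_distrib, Finset.sum_eq_single i]
  · simp
  · intro j _ hj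
    simp [Function.update_of_ne hj]
  · simp

lemma blOp_update_rankOneAdd [DecidableEq ι] {X : ∀ i, H i →L[ℝ] H i}
    {R R' : E →L[ℝ] E} (hR : R.adjoint = R) (hRR : R.comp R = blOp B c X)
    (hR' : ∀ z, R (R' z) = z) (i : ι) (q : H i) (s : ℝ) :
    blOp B c (Function.update X i ((rankOneAdd s q).comp (X i))) =
      R.comp ((rankOneAdd (c i * (2 * s + s ^ 2 * ‖q‖ ^ 2))
        (R' ((B i).adjoint ((X i).adjoint q)))).comp R) := by
  have h1 : ∀ z, blOp B c (Function.update X i ((rankOneAdd s q).comp (X i))) z =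
      blOp B c X z + (c i • (B i).adjoint
        (((rankOneAdd s q).comp (X i)).adjoint (((rankOneAdd s q).comp (X i)) (B i z))) -
        c i • (B i).adjoint ((X i).adjoint (X i (B i z)))) := by
    intro z
    rw [blOp_apply, blOp_apply]
    exact sum_update_eq (fun j (Y : H j →L[ℝ] H j) => c j • (B j).adjoint (Y.adjoint (Y (B j z)))) X i _
  have h2 : ∀ z, ⟪R' ((B i).adjoint ((X i).adjoint q)), R z⟫ = ⟪q, X i (B i z)⟫ := by
    intro z
    rw [← ContinuousLinearMap.adjoint_inner_left, hR, hR',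
      ContinuousLinearMap.adjoint_inner_left, ContinuousLinearMap.adjoint_inner_left]
  refine ContinuousLinearMap.ext fun z => ?_
  rw [h1, ContinuousLinearMap.adjoint_comp, adjoint_rankOneAdd]
  simp only [ContinuousLinearMap.comp_apply, rankOneAdd_apply, map_add, map_smul, h2, hR',
    real_inner_self_eq_norm_sq]
  rw [← hRR, ContinuousLinearMap.comp_apply]
  generalize ⟪q, X i (B i z)⟫ = t
  module

/-- The Euler-Lagrange equation for the penalised functional. -/
lemma norm_sq_eq_of_isMin [DecidableEq ι] (hc : ∀ i, 0 < c i) {X : ∀ i, H i →L[ℝ] H i}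
    (hX : ∀ i, (X i).det ≠ 0)
    (hmin : ∀ X' : ∀ i, H i →L[ℝ] H i, (∀ i, (X' i).det ≠ 0) →
        blLogRatio B c X + η * blPenalty c X ≤ blLogRatio B c X' + η * blPenalty c X')
    {R R' : E →L[ℝ] E} (hR : R.adjoint = R) (hRR : R.comp R = blOp B c X) (hRd : R.det ≠ 0)
    (hR' : ∀ z, R (R' z) = z) (i : ι) (q : H i) :
    ‖R' ((B i).adjoint ((X i).adjoint q))‖ ^ 2 = (1 + η) * ‖q‖ ^ 2 -
      η * ((Module.finrank ℝ (H i) + 1) * ‖(X i).adjoint q‖ ^ 2 / (1 + hsNormSq (X i))) := by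
  set Q := ‖q‖ ^ 2 with hQ
  set w := ‖(X i).adjoint q‖ ^ 2 with hw
  set N := hsNormSq (X i) with hN
  have hN0 : 0 ≤ N := hsNormSq_nonneg _
  set p := R' ((B i).adjoint ((X i).adjoint q)) with hp
  set a : ℝ → ℝ := fun s => c i * (2 * s + s ^ 2 * Q) with ha
  set ψ : ℝ → ℝ := fun s => Real.log (1 + a s * ‖p‖ ^ 2) - c i * (2 * Real.log (1 + s * Q)) +
    η * (c i * ((Module.finrank ℝ (H i) + 1) *
      (Real.log (1 + N + (2 * s + s ^ 2 * Q) * w) - Real.log (1 + N)) -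
        2 * Real.log (1 + s * Q))) with hψ
  set X' : ℝ → ∀ j, H j →L[ℝ] H j := fun s =>
    Function.update X i ((rankOneAdd s q).comp (X i)) with hX'
  have hdetc : ∀ s, ((rankOneAdd s q).comp (X i)).det = (1 + s * Q) * (X i).det := fun s => by
    rw [hQ, ← det_rankOneAdd, det_comp]
  have hop : ∀ s, blOp B c (X' s) = R.comp ((rankOneAdd (a s) p).comp R) := fun s =>
    blOp_update_rankOneAdd hR hRR hR' i q s
  have hdetop : ∀ s, (blOp B c (X' s)).det = R.det * R.det * (1 + a s * ‖p‖ ^ 2) := fun s => by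
    rw [hop, det_comp, det_comp, det_rankOneAdd]
    ring
  have hdetop0 : (blOp B c X).det = R.det * R.det := by rw [← hRR, det_comp]
  have hψ0 : ψ 0 = 0 := by simp [hψ, ha]
  have hev : ∀ᶠ s in 𝓝 (0 : ℝ), 0 ≤ ψ s := by
    have e1 : ∀ᶠ s in 𝓝 (0 : ℝ), 0 < 1 + s * Q := by
      have : Continuous fun s : ℝ => 1 + s * Q := by fun_prop
      exact this.continuousAt.eventually (lt_mem_nhds (by simp))
    have e2 : ∀ᶠ s in 𝓝 (0 : ℝ), 0 < 1 + a s * ‖p‖ ^ 2 := by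
      have : Continuous fun s : ℝ => 1 + a s * ‖p‖ ^ 2 := by fun_prop
      exact this.continuousAt.eventually (lt_mem_nhds (by simp [ha]))
    filter_upwards [e1, e2] with s h1 h2
    have hX's : ∀ j, (X' s j).det ≠ 0 := by
      intro j
      rcases eq_or_ne j i with rfl | hj
      · rw [hX']; simp only [Function.update_self]
        rw [hdetc]
        exact mul_ne_zero h1.ne' (hX _)
      · rw [hX']; simp only [Function.update_of_ne hj]
        exact hX j
    have h3 := hmin (X' s) hX's
    have h4 : blLogRatio B c (X' s) = blLogRatio B c X + (Real.log (1 + a s * ‖p‖ ^ 2) -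
        c i * (2 * Real.log (1 + s * Q))) := by
      rw [blLogRatio, blLogRatio, hdetop, hdetop0, Real.log_mul (mul_ne_zero hRd hRd) h2.ne',
        sum_update_eq (fun j (Y : H j →L[ℝ] H j) => c j * (2 * Real.log |Y.det|)), hdetc, abs_mul,
        Real.log_mul (abs_ne_zero.2 h1.ne') (abs_ne_zero.2 (hX i)), abs_of_pos h1]
      ring
    have h5 : blPenalty c (X' s) = blPenalty c X + c i * ((Module.finrank ℝ (H i) + 1) *
      (Real.log (1 + N + (2 * s + s ^ 2 * Q) * w) - Real.log (1 + N)) -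
        2 * Real.log (1 + s * Q)) := by
      rw [blPenalty, blPenalty, sum_update_eq (fun j (Y : H j →L[ℝ] H j) => c j * opPenalty Y), opPenalty,
        opPenalty, hdetc, abs_mul,
        Real.log_mul (abs_ne_zero.2 h1.ne') (abs_ne_zero.2 (hX i)), abs_of_pos h1,
        hsNormSq_rankOneAdd_comp, ← hN, ← hw, ← hQ, add_assoc 1 N]
      ring
    rw [h4, h5] at h3
    rw [hψ]
    simp only
    linarith
  have hlm : IsLocalMin ψ 0 := by
    filter_upwards [hev] with s hs
    rw [hψ0]; exact hs
  have hder : HasDerivAt ψ (c i * 2 * ‖p‖ ^ 2 - c i * (2 * Q) + η * (c i *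
      ((Module.finrank ℝ (H i) + 1) * (2 * w / (1 + N)) - 2 * Q))) 0 := by
    have d1 : HasDerivAt (fun s : ℝ => 2 * s + s ^ 2 * Q) 2 0 :=
      (((hasDerivAt_id (0 : ℝ)).const_mul 2).add
        (((hasDerivAt_id (0 : ℝ)).pow 2).mul_const Q)).congr_deriv (by simp)
    have d2 : HasDerivAt (fun s : ℝ => Real.log (1 + s * Q)) Q 0 :=
      ((((hasDerivAt_id (0 : ℝ)).mul_const Q).const_add 1).log (by simp)).congr_deriv (by simp)
    have d3 : HasDerivAt (fun s : ℝ => Real.log (1 + a s * ‖p‖ ^ 2)) (c i * 2 * ‖p‖ ^ 2) 0 :=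
      ((((d1.const_mul (c i)).mul_const (‖p‖ ^ 2)).const_add 1).log (by simp)).congr_deriv
        (by simp)
    have d4 : HasDerivAt (fun s : ℝ => Real.log (1 + N + (2 * s + s ^ 2 * Q) * w))
        (2 * w / (1 + N)) 0 :=
      (((d1.mul_const w).const_add (1 + N)).log (by simp; positivity)).congr_deriv (by simp)
    exact (d3.sub ((d2.const_mul 2).const_mul (c i))).add
      (((((d4.sub_const _).const_mul _).sub (d2.const_mul 2)).const_mul (c i)).const_mul η)
  have h0 := hlm.hasDerivAt_eq_zero hder
  have hci := hc i
  have h1N : (0 : ℝ) < 1 + N := by positivity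
  have h6 : 2 * c i * (‖p‖ ^ 2 - ((1 + η) * Q -
      η * ((Module.finrank ℝ (H i) + 1) * w / (1 + N)))) = 0 := by
    rw [← h0]; ring
  have h7 := (mul_eq_zero.1 h6).resolve_left (by positivity)
  linarith

end GaussianFunctional

section NearGeometricExistence

variable {ι : Type*} [Fintype ι] {H : ι → Type*} {E : Type*}
  [NormedAddCommGroup E] [InnerProductSpace ℝ E] [FiniteDimensional ℝ E]
  [MeasurableSpace E] [BorelSpace E]
  [∀ i, NormedAddCommGroup (H i)] [∀ i, InnerProductSpace ℝ (H i)]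
  [∀ i, FiniteDimensional ℝ (H i)] [∀ i, MeasurableSpace (H i)] [∀ i, BorelSpace (H i)]
  {V : Type*} [NormedAddCommGroup V] [InnerProductSpace ℝ V] [FiniteDimensional ℝ V]
  [MeasurableSpace V] [BorelSpace V]

variable {B : ∀ i, E →L[ℝ] H i} {c : ι → ℝ} {d η : ℝ}

lemma det_ne_zero_of_norm_sq_le {Y : V →L[ℝ] V} {a : ℝ} (h : ∀ q, ‖q‖ ^ 2 ≤ a * ‖Y q‖ ^ 2) :
    Y.det ≠ 0 := by
  intro h0
  obtain ⟨q, hq, hq0⟩ := Submodule.exists_mem_ne_zero_of_ne_bot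
    (LinearMap.bot_lt_ker_of_det_eq_zero (f := (Y : V →ₗ[ℝ] V)) h0).ne'
  have h1 : Y q = 0 := hq
  have h2 := h q
  rw [h1, norm_zero] at h2
  have h3 := norm_pos_iff.2 hq0
  nlinarith

lemma adjoint_inverse {R R' : V →L[ℝ] V} (hR : R.adjoint = R) (h1 : ∀ z, R (R' z) = z) :
    R'.adjoint = R' := by
  refine ((ContinuousLinearMap.eq_adjoint_iff _ _).2 fun x y => ?_).symm
  conv_lhs => rw [← h1 y]
  conv_rhs => rw [← h1 x]
  rw [← ContinuousLinearMap.adjoint_inner_left, hR]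

lemma GaussianBound.nearGeometric_of_isMin (h : GaussianBound B c d) (hd : 0 < d)
    (hc : ∀ i, 0 < c i)
    (hsum : ∑ i, c i * (Module.finrank ℝ (H i) : ℝ) = Module.finrank ℝ E) (hη : 0 < η) (hη1 : η ≤ 1)
    (hηn : ∀ i, η * Module.finrank ℝ (H i) ≤ 1 / 2) {X : ∀ i, H i →L[ℝ] H i}
    (hX : ∀ i, (X i).det ≠ 0)
    (hmin : ∀ X' : ∀ i, H i →L[ℝ] H i, (∀ i, (X' i).det ≠ 0) →
        blLogRatio B c X + η * blPenalty c X ≤ blLogRatio B c X' + η * blPenalty c X')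
    {S : ℝ} (hS : ∀ i, (Module.finrank ℝ (H i) + 1) * (opPenalty (X i) + 1) ≤ S) :
    NearGeometric B c d η S := by
  classical
  obtain ⟨R, hR, hRR⟩ := exists_selfAdjoint_sqrt (adjoint_blOp (B := B) (c := c) X) fun v => by
    rw [inner_blOp]
    exact Finset.sum_nonneg fun i _ => mul_nonneg (hc i).le (by positivity)
  have hdetRR : (blOp B c X).det = R.det * R.det := by rw [← hRR, det_comp]
  have hRd : R.det ≠ 0 := fun h0 => (h.det_pos hd hX).ne' (by rw [hdetRR, h0, mul_zero])
  obtain ⟨R', hR1, hR2⟩ := exists_inverse hRd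
  have hR' : R'.adjoint = R' := adjoint_inverse hR hR1
  set C : ∀ i, E →L[ℝ] H i := fun i => (X i).comp ((B i).comp R') with hC
  have hCadj : ∀ i q, (C i).adjoint q = R' ((B i).adjoint ((X i).adjoint q)) := fun i q => by
    simp [hC, ContinuousLinearMap.adjoint_comp, hR']
  have hcrit := norm_sq_eq_of_isMin hc hX hmin hR hRR hRd hR1
  have hfrac : ∀ i q, 0 ≤ ‖(X i).adjoint q‖ ^ 2 / (1 + hsNormSq (X i)) ∧
      ‖(X i).adjoint q‖ ^ 2 / (1 + hsNormSq (X i)) ≤ ‖q‖ ^ 2 := fun i q => by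
    have h1 := hsNormSq_nonneg (X i)
    refine ⟨by positivity, ?_⟩
    rw [div_le_iff₀ (by positivity)]
    nlinarith [norm_adjoint_sq_le_hsNormSq (X i) q, sq_nonneg ‖q‖]
  have hup : ∀ i q, ‖(C i).adjoint q‖ ^ 2 ≤ (1 + η) * ‖q‖ ^ 2 := fun i q => by
    rw [hCadj, hcrit, mul_div_assoc]
    have := (hfrac i q).1
    have : 0 ≤ η * ((Module.finrank ℝ (H i) + 1) *
      (‖(X i).adjoint q‖ ^ 2 / (1 + hsNormSq (X i)))) := by positivity
    linarith
  have hlow : ∀ i q, ‖q‖ ^ 2 ≤ 2 * ‖(C i).adjoint q‖ ^ 2 := fun i q => by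
    rw [hCadj, hcrit, mul_div_assoc]
    have h1 : η * ((Module.finrank ℝ (H i) + 1) *
      (‖(X i).adjoint q‖ ^ 2 / (1 + hsNormSq (X i)))) ≤
        η * ((Module.finrank ℝ (H i) + 1) * ‖q‖ ^ 2) := by
      gcongr
      exact (hfrac i q).2
    have h2 := mul_le_mul_of_nonneg_right (hηn i) (sq_nonneg ‖q‖)
    linarith
  have hY : ∀ i, ∃ Y : H i →L[ℝ] H i, Y.adjoint = Y ∧ Y.comp Y = (C i).comp (C i).adjoint :=
    fun i => exists_selfAdjoint_sqrt (by
      rw [ContinuousLinearMap.adjoint_comp, ContinuousLinearMap.adjoint_adjoint]) fun v => by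
      rw [ContinuousLinearMap.comp_apply, ← ContinuousLinearMap.adjoint_inner_left]
      exact real_inner_self_nonneg
  choose Y hYa hYY using hY
  have hYn : ∀ i q, ‖Y i q‖ ^ 2 = ‖(C i).adjoint q‖ ^ 2 := fun i q => by
    rw [← real_inner_self_eq_norm_sq, ← real_inner_self_eq_norm_sq,
      ← ContinuousLinearMap.adjoint_inner_right, hYa, ← ContinuousLinearMap.comp_apply, hYY,
      ContinuousLinearMap.comp_apply, ContinuousLinearMap.adjoint_inner_left]
  have hYd : ∀ i, (Y i).det ≠ 0 := fun i =>
    det_ne_zero_of_norm_sq_le (a := 2) fun q => by rw [hYn]; exact hlow i q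
  choose Y' hY1 hY2 using fun i => exists_inverse (hYd i)
  have hY'a : ∀ i, (Y' i).adjoint = Y' i := fun i => adjoint_inverse (hYa i) (hY1 i)
  have hCC : ∀ z, ∑ i, c i * ‖C i z‖ ^ 2 = ‖z‖ ^ 2 := fun z => by
    have h1 := inner_blOp (B := B) (c := c) X (R' z)
    rw [← hRR, ContinuousLinearMap.comp_apply, ← ContinuousLinearMap.adjoint_inner_left, hR,
      hR1, real_inner_self_eq_norm_sq] at h1
    exact h1.symm
  have hYdet : ∀ i, |(Y i).det| ≤ (1 + η) ^ ((Module.finrank ℝ (H i) : ℝ) / 2) := fun i => by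
    have h1 := abs_det_le_pow (Y i) (Real.sqrt_nonneg (1 + η)) fun q => by
      refine abs_le_of_sq_le_sq' ?_ (by positivity) |>.2
      rw [mul_pow, Real.sq_sqrt (by positivity), hYn]
      exact hup i q
    refine h1.trans_eq ?_
    rw [Real.sqrt_eq_rpow, ← Real.rpow_natCast, ← Real.rpow_mul (by positivity)]
    congr 1
    ring
  have hp0 : ∀ i, 0 ≤ opPenalty (X i) := fun i => opPenalty_nonneg (hX i)
  have h2e : (2 : ℝ) ≤ Real.exp 1 := by linarith [Real.add_one_le_exp (1 : ℝ)]
  refine ⟨R, fun i => (X i).adjoint.comp (Y i), fun i => (Y' i).comp (C i),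
    fun i => c i • (C i).adjoint.comp (Y i), hRd, fun i => ?_, fun i y => ?_, fun z => ?_,
    fun z => ?_, fun i y => ?_, fun i y => ?_, fun i => ?_, ?_⟩
  · rw [det_comp, det_adjoint]
    exact mul_ne_zero (hX i) (hYd i)
  · rw [ContinuousLinearMap.adjoint_comp, ContinuousLinearMap.comp_apply, hY'a]
    refine (sq_eq_sq₀ (norm_nonneg _) (norm_nonneg _)).1 ?_
    rw [← hYn, hY1]
  · have h1 : ∀ i, (c i • (C i).adjoint.comp (Y i)) ((Y' i).comp (C i) z) =
        R' (c i • (B i).adjoint ((X i).adjoint (X i (B i (R' z))))) := fun i => by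
      simp [hY1, hC, hR']
    rw [Finset.sum_congr rfl fun i _ => h1 i, ← map_sum, ← blOp_apply, ← hRR,
      ContinuousLinearMap.comp_apply, hR2, hR1]
  · rw [← hCC z, Finset.mul_sum]
    refine Finset.sum_le_sum fun i _ => ?_
    have h1 : (c i • (C i).adjoint.comp (Y i)).adjoint z = c i • Y i (C i z) := by
      simp [ContinuousLinearMap.adjoint_comp, hYa]
    rw [h1, norm_smul, mul_pow, hYn, Real.norm_of_nonneg (hc i).le]
    have h2 := mul_le_mul_of_nonneg_left (hup i (C i z)) (hc i).le
    have h3 := (hc i).ne'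
    calc (c i)⁻¹ * (c i ^ 2 * ‖(C i).adjoint (C i z)‖ ^ 2)
        = c i * ‖(C i).adjoint (C i z)‖ ^ 2 := by field_simp
      _ ≤ _ := h2
      _ = _ := by ring
  · simp [hCadj, hR1]
  · have h1 := hlow i y
    rw [← hYn] at h1
    have h2 := norm_sq_le_exp_opPenalty_mul (hX i) (Y i y)
    have h3 : 2 ^ Module.finrank ℝ (H i) * Real.exp (opPenalty (X i)) ≤ Real.exp S := by
      calc 2 ^ Module.finrank ℝ (H i) * Real.exp (opPenalty (X i))
          ≤ Real.exp 1 ^ Module.finrank ℝ (H i) * Real.exp (opPenalty (X i)) := by gcongr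
        _ = Real.exp (Module.finrank ℝ (H i) * 1 + opPenalty (X i)) := by
            rw [← Real.exp_nat_mul, Real.exp_add]
        _ ≤ _ := by
            refine Real.exp_le_exp.2 (le_trans ?_ (hS i))
            have := hp0 i
            nlinarith [(Nat.cast_nonneg (Module.finrank ℝ (H i)) : (0 : ℝ) ≤ _)]
    calc ‖y‖ ^ 2 ≤ 2 * ‖Y i y‖ ^ 2 := h1
      _ ≤ 2 * (2 ^ Module.finrank ℝ (H i) * Real.exp (opPenalty (X i)) *
          ‖(X i).adjoint (Y i y)‖ ^ 2) := by gcongr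
      _ ≤ 2 * (Real.exp S * ‖(X i).adjoint (Y i y)‖ ^ 2) := by gcongr
      _ = _ := by rw [ContinuousLinearMap.comp_apply]; ring
  · rw [det_comp, det_adjoint, abs_mul]
    have h1 : |(X i).det| ≤ Real.exp (Module.finrank ℝ (H i) * opPenalty (X i)) := by
      refine abs_le_of_sq_le_sq ?_ (Real.exp_pos _).le
      refine (det_sq_le_exp_opPenalty (hX i)).trans ?_
      rw [← Real.exp_nat_mul]
      refine Real.exp_le_exp.2 ?_
      have : 0 ≤ Module.finrank ℝ (H i) * opPenalty (X i) := mul_nonneg (by positivity) (hp0 i)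
      push_cast
      linarith
    have h2 : |(Y i).det| ≤ Real.exp (Module.finrank ℝ (H i)) := by
      refine (hYdet i).trans ?_
      calc (1 + η) ^ ((Module.finrank ℝ (H i) : ℝ) / 2)
          ≤ Real.exp 1 ^ ((Module.finrank ℝ (H i) : ℝ) / 2) := by gcongr; linarith
        _ = Real.exp ((Module.finrank ℝ (H i) : ℝ) / 2) := by rw [← Real.exp_mul, one_mul]
        _ ≤ _ := Real.exp_le_exp.2 (half_le_self (by positivity))
    calc |(X i).det| * |(Y i).det|
        ≤ Real.exp (Module.finrank ℝ (H i) * opPenalty (X i)) *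
          Real.exp (Module.finrank ℝ (H i)) := by gcongr
      _ = Real.exp (Module.finrank ℝ (H i) * opPenalty (X i) + Module.finrank ℝ (H i)) :=
          (Real.exp_add _ _).symm
      _ ≤ _ := Real.exp_le_exp.2 (by have := hp0 i; linarith [hS i])
  · have h1 : d * ∏ i, |(X i).det| ^ c i ≤ |R.det| := by
      have h2 := h X hX
      rw [hdetRR, Finset.prod_pow, ← mul_pow] at h2
      refine (le_abs_self _).trans (sq_le_sq.1 ?_)
      rw [sq R.det]; exact h2
    have h3 : ∏ i, ((1 + η) ^ ((Module.finrank ℝ (H i) : ℝ) / 2)) ^ c i =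
        (1 + η) ^ ((Module.finrank ℝ E : ℝ) / 2) := by
      rw [← hsum, Finset.sum_div, Real.rpow_sum_of_pos (by positivity)]
      refine Finset.prod_congr rfl fun i _ => ?_
      rw [← Real.rpow_mul (by positivity)]
      congr 1
      ring
    have h4 : ∏ i, |((X i).adjoint.comp (Y i)).det| ^ c i ≤ (∏ i, |(X i).det| ^ c i) *
        (1 + η) ^ ((Module.finrank ℝ E : ℝ) / 2) := by
      rw [← h3, ← Finset.prod_mul_distrib]
      refine Finset.prod_le_prod (fun i _ => by positivity) fun i _ => ?_
      rw [det_comp, det_adjoint, abs_mul, Real.mul_rpow (abs_nonneg _) (abs_nonneg _)]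
      have := (hc i).le
      gcongr
      exact hYdet i
    calc _ ≤ d * ((∏ i, |(X i).det| ^ c i) * (1 + η) ^ ((Module.finrank ℝ E : ℝ) / 2)) := by
          gcongr
      _ = (d * ∏ i, |(X i).det| ^ c i) * (1 + η) ^ ((Module.finrank ℝ E : ℝ) / 2) := by ring
      _ ≤ _ := by gcongr

theorem GaussianBound.exists_nearGeometric (h : GaussianBound B c d) (hd : 0 < d)
    (hc : ∀ i, 0 < c i)
    (hsum : ∑ i, c i * (Module.finrank ℝ (H i) : ℝ) = Module.finrank ℝ E) :
    ∀ δ > 0, ∃ η S, 0 < η ∧ η < δ ∧ 0 ≤ S ∧ η * S ≤ δ ∧ NearGeometric B c d η S := by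
  intro δ hδ
  set nn : ℝ := ∑ i, (Module.finrank ℝ (H i) : ℝ) with hnn
  set κ : ℝ := ∑ i, (c i)⁻¹ with hκ
  have hnn0 : 0 ≤ nn := by positivity
  have hκ0 : 0 ≤ κ := Finset.sum_nonneg fun i _ => (inv_pos.2 (hc i)).le
  set δ' := δ / (4 * (nn + 1) * (κ + 1)) with hδ'
  have hδ'0 : 0 < δ' := by positivity
  -- a near-minimiser of the unpenalised functional
  set Z : Set ℝ := {r | ∃ X : ∀ i, H i →L[ℝ] H i, (∀ i, (X i).det ≠ 0) ∧ blLogRatio B c X = r}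
    with hZ
  have hZne : Z.Nonempty := ⟨_, fun i => ContinuousLinearMap.id ℝ (H i),
    fun i => by simp [ContinuousLinearMap.det], rfl⟩
  have hZb : BddBelow Z := ⟨2 * Real.log d, by
    rintro _ ⟨X, hX, rfl⟩
    exact h.le_blLogRatio hd hX⟩
  obtain ⟨_, ⟨X₀, hX₀, rfl⟩, hX₀lt⟩ := exists_lt_of_csInf_lt hZne (lt_add_of_pos_right (sInf Z) hδ'0)
  have hP₀ := blPenalty_nonneg hc hX₀
  set η := min (min (δ / 2) (1 / (2 * (nn + 1)))) (min (δ' / (1 + blPenalty c X₀))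
    (δ / (2 * (nn + 1)))) with hηdef
  have hη : 0 < η := by positivity
  have hη1 : η ≤ δ / 2 := (min_le_left _ _).trans (min_le_left _ _)
  have hη2 : η ≤ 1 / (2 * (nn + 1)) := (min_le_left _ _).trans (min_le_right _ _)
  have hη3 : η ≤ δ' / (1 + blPenalty c X₀) := (min_le_right _ _).trans (min_le_left _ _)
  have hη4 : η ≤ δ / (2 * (nn + 1)) := (min_le_right _ _).trans (min_le_right _ _)
  rw [le_div_iff₀ (by positivity)] at hη2 hη3 hη4
  obtain ⟨X, hX, hmin⟩ := h.exists_min hd hc hη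
  have hp0 : ∀ i, 0 ≤ opPenalty (X i) := fun i => opPenalty_nonneg (hX i)
  have hpen : η * blPenalty c X ≤ 2 * δ' := by
    have h1 := hmin X₀ hX₀
    have h2 : sInf Z ≤ blLogRatio B c X := csInf_le hZb ⟨X, hX, rfl⟩
    nlinarith
  have hpi : ∀ i, opPenalty (X i) ≤ κ * blPenalty c X := fun i => by
    have h1 : c i * opPenalty (X i) ≤ blPenalty c X :=
      Finset.single_le_sum (f := fun i => c i * opPenalty (X i))
        (fun j _ => mul_nonneg (hc j).le (hp0 j)) (Finset.mem_univ i)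
    have h2 : (c i)⁻¹ ≤ κ := Finset.single_le_sum (f := fun i => (c i)⁻¹)
        (fun j _ => (inv_pos.2 (hc j)).le) (Finset.mem_univ i)
    calc opPenalty (X i) = (c i)⁻¹ * (c i * opPenalty (X i)) := by
          rw [inv_mul_cancel_left₀ (hc i).ne']
      _ ≤ κ * blPenalty c X := mul_le_mul h2 h1 (mul_nonneg (hc i).le (hp0 i)) hκ0
  have hni : ∀ i, (Module.finrank ℝ (H i) : ℝ) ≤ nn := fun i =>
    Finset.single_le_sum (f := fun i => (Module.finrank ℝ (H i) : ℝ))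
      (fun j _ => by positivity) (Finset.mem_univ i)
  have hPX := blPenalty_nonneg hc hX
  refine ⟨η, (nn + 1) * (κ * blPenalty c X + 1), hη, by linarith, by positivity, ?_,
    h.nearGeometric_of_isMin hd hc hsum hη (by nlinarith) (fun i => ?_) hX hmin fun i => ?_⟩
  · have h1 : (nn + 1) * (κ * (2 * δ')) ≤ δ / 2 := by
      have : (nn + 1) * ((κ + 1) * (2 * δ')) = δ / 2 := by rw [hδ']; field_simp; norm_num
      rw [← this]
      gcongr
      linarith
    have h2 : (nn + 1) * (κ * (η * blPenalty c X)) ≤ (nn + 1) * (κ * (2 * δ')) := by gcongr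
    nlinarith
  · have := hni i
    nlinarith
  · have := hni i
    have := hpi i
    have := hp0 i
    gcongr

end NearGeometricExistence

section GaussianInputs

lemma outerLintegral_le {α : Type*} [MeasurableSpace α] {μ : Measure α} {f g : α → ℝ≥0∞}
    (hg : Measurable g) (hfg : ∀ x, f x ≤ g x) : outerLintegral μ f ≤ ∫⁻ x, g x ∂μ :=
  iInf₂_le_of_le g hg (iInf_le _ hfg)

variable {V : Type*} [NormedAddCommGroup V] [InnerProductSpace ℝ V] [FiniteDimensional ℝ V]
  [MeasurableSpace V] [BorelSpace V]

lemma lintegral_exp_neg_norm_sq :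
    ∫⁻ x : V, ENNReal.ofReal (Real.exp (-‖x‖ ^ 2)) =
      ENNReal.ofReal (Real.pi ^ ((Module.finrank ℝ V : ℝ) / 2)) := by
  have h1 := GaussianFourier.integral_rexp_neg_mul_sq_norm (V := V) one_pos
  have h2 := integrable_exp_neg_mul_sq_norm (V := V) one_pos
  simp only [neg_mul, one_mul, div_one] at h1 h2
  rw [← ofReal_integral_eq_lintegral_ofReal h2 (ae_of_all _ fun x => (Real.exp_pos _).le), h1]

lemma lintegral_exp_neg_norm_sq_comp {P : V →L[ℝ] V} (hP : P.det ≠ 0) :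
    ∫⁻ x : V, ENNReal.ofReal (Real.exp (-‖P x‖ ^ 2)) =
      ENNReal.ofReal (|P.det|⁻¹ * Real.pi ^ ((Module.finrank ℝ V : ℝ) / 2)) := by
  rw [lintegral_comp_clm P hP fun x => ENNReal.ofReal (Real.exp (-‖x‖ ^ 2)),
    lintegral_exp_neg_norm_sq, ← ENNReal.ofReal_mul (by positivity)]

variable {ι : Type*} [Fintype ι] {H : ι → Type*} {E : Type*}
  [NormedAddCommGroup E] [InnerProductSpace ℝ E] [FiniteDimensional ℝ E]
  [MeasurableSpace E] [BorelSpace E]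
  [∀ i, NormedAddCommGroup (H i)] [∀ i, InnerProductSpace ℝ (H i)]
  [∀ i, FiniteDimensional ℝ (H i)] [∀ i, MeasurableSpace (H i)] [∀ i, BorelSpace (H i)]

variable {B : ∀ i, E →L[ℝ] H i} {c : ι → ℝ}

lemma prod_ofReal_rpow {a c : ι → ℝ} (ha : ∀ i, 0 ≤ a i) (hc : ∀ i, 0 < c i) :
    ∏ i, ENNReal.ofReal (a i) ^ c i = ENNReal.ofReal (∏ i, a i ^ c i) := by
  rw [ENNReal.ofReal_prod_of_nonneg fun i _ => Real.rpow_nonneg (ha i) _]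
  exact Finset.prod_congr rfl fun i _ => ENNReal.ofReal_rpow_of_nonneg (ha i) (hc i).le

lemma norm_sq_le_of_eq_sum_adjoint (hc : ∀ i, 0 < c i) {X : ∀ i, H i →L[ℝ] H i} {R R' : E →L[ℝ] E}
    (hR : R.adjoint = R) (hRR : R.comp R = blOp B c X) (hR1 : ∀ z, R (R' z) = z)
    (w : ∀ i, H i) :
    ‖R' (∑ i, c i • (B i).adjoint ((X i).adjoint (w i)))‖ ^ 2 ≤ ∑ i, c i * ‖w i‖ ^ 2 := by
  set x := ∑ i, c i • (B i).adjoint ((X i).adjoint (w i)) with hx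
  have hR' := adjoint_inverse hR hR1
  have h1 : ∑ i, c i * ‖X i (B i (R' (R' x)))‖ ^ 2 = ‖R' x‖ ^ 2 := by
    rw [← inner_blOp, ← hRR, ContinuousLinearMap.comp_apply,
      ← ContinuousLinearMap.adjoint_inner_left, hR, hR1, real_inner_self_eq_norm_sq]
  have h2 : ‖R' x‖ ^ 2 = ∑ i, c i * ⟪w i, X i (B i (R' (R' x)))⟫ := by
    rw [← real_inner_self_eq_norm_sq]
    conv_lhs => rw [← ContinuousLinearMap.adjoint_inner_right, hR']
    conv_lhs => arg 2; rw [hx]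
    rw [sum_inner]
    refine Finset.sum_congr rfl fun i _ => ?_
    rw [real_inner_smul_left, ContinuousLinearMap.adjoint_inner_left,
      ContinuousLinearMap.adjoint_inner_left]
  have h3 : 2 * ∑ i, c i * ⟪w i, X i (B i (R' (R' x)))⟫ ≤
      ∑ i, c i * ‖w i‖ ^ 2 + ∑ i, c i * ‖X i (B i (R' (R' x)))‖ ^ 2 := by
    rw [Finset.mul_sum, ← Finset.sum_add_distrib]
    refine Finset.sum_le_sum fun i _ => ?_
    rw [← mul_add, mul_left_comm]
    have := (hc i).le
    gcongr
    nlinarith [real_inner_le_norm (w i) (X i (B i (R' (R' x)))),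
      sq_nonneg (‖w i‖ - ‖X i (B i (R' (R' x)))‖)]
  linarith

lemma isPosDefMap_comp_adjoint {Z : V →L[ℝ] V} (hZ : Z.det ≠ 0) :
    IsPosDefMap ((Z.comp Z.adjoint : V →L[ℝ] V) : V →ₗ[ℝ] V) := by
  obtain ⟨W, hW1, hW2⟩ := exists_inverse (X := Z.adjoint) (by rwa [det_adjoint])
  have h1 : ∀ x y : V, ⟪x, Z (Z.adjoint y)⟫ = ⟪Z.adjoint x, Z.adjoint y⟫ := fun x y =>
    (ContinuousLinearMap.adjoint_inner_left _ _ _).symm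
  refine ⟨fun x y => ?_, fun x hx => ?_⟩
  · simp only [ContinuousLinearMap.coe_coe, ContinuousLinearMap.comp_apply]
    rw [h1, ← ContinuousLinearMap.adjoint_inner_right]
  · simp only [ContinuousLinearMap.coe_coe, ContinuousLinearMap.comp_apply]
    rw [h1, real_inner_self_eq_norm_sq]
    have : Z.adjoint x ≠ 0 := fun h0 => hx (by rw [← hW2 x, h0, map_zero])
    positivity

/-- The Gaussian ratio in the reverse Brascamp-Lieb inequality. -/
noncomputable def gaussianRatio (B : ∀ i, E →L[ℝ] H i) (c : ι → ℝ) (A : ∀ i, H i →ₗ[ℝ] H i) :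
    ℝ≥0∞ :=
  (outerLintegral volume fun x : E =>
    ⨆ (y : ∀ i, H i) (_ : x = ∑ i, c i • (B i).adjoint (y i)),
      ∏ i, ENNReal.ofReal (Real.exp (-⟪A i (y i), y i⟫)) ^ c i) /
    ∏ i, (∫⁻ z, ENNReal.ofReal (Real.exp (-⟪A i z, z⟫))) ^ c i

/-- If the datum has a common kernel, the Gaussian ratios vanish. -/
lemma gaussianRatio_eq_zero {v : E} (hv : v ≠ 0) (hBv : ∀ i, B i v = 0)
    (A : ∀ i, H i →ₗ[ℝ] H i) :
    gaussianRatio B c A = 0 := by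
  rw [gaussianRatio, ENNReal.div_eq_zero_iff]
  refine Or.inl (le_antisymm ?_ bot_le)
  set K : Submodule ℝ E := (ℝ ∙ v)ᗮ with hK
  have hKm : MeasurableSet (K : Set E) := K.closed_of_finiteDimensional.measurableSet
  refine (outerLintegral_le (g := (K : Set E).indicator fun _ => ⊤)
    (measurable_const.indicator hKm) fun x => ?_).trans ?_
  · refine iSup₂_le fun y hy => ?_
    have hx : x ∈ (K : Set E) := by
      rw [SetLike.mem_coe, hK, Submodule.mem_orthogonal_singleton_iff_inner_right, hy, inner_sum]
      refine Finset.sum_eq_zero fun i _ => ?_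
      rw [real_inner_smul_right, ContinuousLinearMap.adjoint_inner_right, hBv, inner_zero_left,
        mul_zero]
    rw [Set.indicator_of_mem hx]
    exact le_top
  · rw [lintegral_indicator hKm, setLIntegral_const, Measure.addHaar_submodule, mul_zero]
    intro h
    have : v ∈ K := by rw [h]; trivial
    rw [hK, Submodule.mem_orthogonal_singleton_iff_inner_right, real_inner_self_eq_norm_sq] at this
    exact hv (norm_eq_zero.1 (pow_eq_zero_iff two_ne_zero |>.1 this))

lemma det_eq_inv_of_inverse {P Q : V →L[ℝ] V} (h : ∀ v, P (Q v) = v) : Q.det⁻¹ = P.det := by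
  have h1 : P.comp Q = ContinuousLinearMap.id ℝ V := ContinuousLinearMap.ext h
  have h2 : P.det * Q.det = 1 := by
    rw [← det_comp, h1]
    simp [ContinuousLinearMap.det]
  exact (eq_inv_of_mul_eq_one_left h2).symm

lemma gaussianRatio_le (hc : ∀ i, 0 < c i)
    (hsum : ∑ i, c i * (Module.finrank ℝ (H i) : ℝ) = Module.finrank ℝ E)
    {X Z : ∀ i, H i →L[ℝ] H i} (hX : ∀ i, (X i).det ≠ 0) (hXZ : ∀ i v, X i (Z i v) = v)
    (hZX : ∀ i v, Z i (X i v) = v)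
    {R R' : E →L[ℝ] E} (hR : R.adjoint = R) (hRR : R.comp R = blOp B c X)
    (hR1 : ∀ z, R (R' z) = z) (hRd : R.det ≠ 0) :
    gaussianRatio B c (fun i => ((Z i).comp (Z i).adjoint : H i →L[ℝ] H i)) ≤
      ENNReal.ofReal (|R.det| / ∏ i, |(X i).det| ^ c i) := by
  have hdetR := det_eq_inv_of_inverse hR1
  have hdetX : ∀ i, (Z i).det⁻¹ = (X i).det := fun i => det_eq_inv_of_inverse (hXZ i)
  have hq : ∀ i (z : H i), ⟪((Z i).comp (Z i).adjoint : H i →L[ℝ] H i) z, z⟫ =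
      ‖(Z i).adjoint z‖ ^ 2 := fun i z => by
    rw [ContinuousLinearMap.comp_apply, ← ContinuousLinearMap.adjoint_inner_right,
      real_inner_self_eq_norm_sq]
  have hadj : ∀ i (y : H i), (X i).adjoint ((Z i).adjoint y) = y := fun i y => by
    have h1 : (Z i).comp (X i) = ContinuousLinearMap.id ℝ (H i) := ContinuousLinearMap.ext (hZX i)
    have h2 := congrArg ContinuousLinearMap.adjoint h1
    rw [ContinuousLinearMap.adjoint_comp, ContinuousLinearMap.adjoint_id] at h2
    exact DFunLike.congr_fun h2 y
  have hden : ∏ i, (∫⁻ z, ENNReal.ofReal (Real.exp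
      (-⟪((Z i).comp (Z i).adjoint : H i →L[ℝ] H i) z, z⟫))) ^ c i =
      ENNReal.ofReal ((∏ i, |(X i).det| ^ c i) * Real.pi ^ ((Module.finrank ℝ E : ℝ) / 2)) := by
    have h1 : ∀ i, ∫⁻ z, ENNReal.ofReal (Real.exp
        (-⟪((Z i).comp (Z i).adjoint : H i →L[ℝ] H i) z, z⟫)) =
        ENNReal.ofReal (|(X i).det| * Real.pi ^ ((Module.finrank ℝ (H i) : ℝ) / 2)) := fun i => by
      simp only [hq]
      rw [lintegral_exp_neg_norm_sq_comp, det_adjoint, ← abs_inv, hdetX]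
      rw [det_adjoint]
      intro h0
      have := hdetX i
      rw [h0, inv_zero] at this
      exact hX i this.symm
    simp only [h1]
    rw [prod_ofReal_rpow (fun i => by positivity) hc]
    congr 1
    rw [← hsum, Finset.sum_div, Real.rpow_sum_of_pos Real.pi_pos, ← Finset.prod_mul_distrib]
    refine Finset.prod_congr rfl fun i _ => ?_
    rw [Real.mul_rpow (abs_nonneg _) (by positivity), ← Real.rpow_mul Real.pi_pos.le]
    congr 2
    ring
  have hnum : (outerLintegral volume fun x : E =>
      ⨆ (y : ∀ i, H i) (_ : x = ∑ i, c i • (B i).adjoint (y i)),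
        ∏ i, ENNReal.ofReal (Real.exp
          (-⟪((Z i).comp (Z i).adjoint : H i →L[ℝ] H i) (y i), y i⟫)) ^ c i) ≤
      ENNReal.ofReal (|R.det| * Real.pi ^ ((Module.finrank ℝ E : ℝ) / 2)) := by
    have hR'd : R'.det ≠ 0 := fun h0 => hRd (by rw [← hdetR, h0, inv_zero])
    rw [← hdetR, abs_inv, ← lintegral_exp_neg_norm_sq_comp hR'd]
    refine outerLintegral_le (by fun_prop) fun x => iSup₂_le fun y hy => ?_
    rw [prod_ofReal_rpow (fun i => (Real.exp_pos _).le) hc]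
    refine ENNReal.ofReal_le_ofReal ?_
    simp only [hq]
    have h1 := norm_sq_le_of_eq_sum_adjoint hc hR hRR hR1 fun i => (Z i).adjoint (y i)
    simp only [hadj] at h1
    rw [← hy] at h1
    calc ∏ i, Real.exp (-‖(Z i).adjoint (y i)‖ ^ 2) ^ c i
        = Real.exp (-∑ i, c i * ‖(Z i).adjoint (y i)‖ ^ 2) := by
          rw [← Finset.sum_neg_distrib, Real.exp_sum]
          refine Finset.prod_congr rfl fun i _ => ?_
          rw [← Real.exp_mul]
          congr 1
          ring
      _ ≤ _ := Real.exp_le_exp.2 (neg_le_neg h1)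
  have hP : 0 < ∏ i, |(X i).det| ^ c i :=
    Finset.prod_pos fun i _ => Real.rpow_pos_of_pos (abs_pos.2 (hX i)) _
  have hpi := Real.rpow_pos_of_pos Real.pi_pos ((Module.finrank ℝ E : ℝ) / 2)
  rw [gaussianRatio]
  refine (ENNReal.div_le_div hnum hden.ge).trans_eq ?_
  rw [← ENNReal.ofReal_div_of_pos (mul_pos hP hpi)]
  congr 1
  field_simp

/-- A nonzero lower bound for all Gaussian ratios is finite and admissible. -/
theorem gaussianBound_of_le_gaussianRatio (hc : ∀ i, 0 < c i)
    (hsum : ∑ i, c i * (Module.finrank ℝ (H i) : ℝ) = Module.finrank ℝ E) {D : ℝ≥0∞}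
    (hD : ∀ A : ∀ i, H i →ₗ[ℝ] H i, (∀ i, IsPosDefMap (A i)) → D ≤ gaussianRatio B c A)
    (hD0 : D ≠ 0) : D ≠ ⊤ ∧ GaussianBound B c D.toReal := by
  have key : ∀ X : ∀ i, H i →L[ℝ] H i, (∀ i, (X i).det ≠ 0) →
      ∃ r : ℝ, r ^ 2 = (blOp B c X).det ∧ 0 ≤ r ∧
        D ≤ ENNReal.ofReal (r / ∏ i, |(X i).det| ^ c i) := by
    intro X hX
    obtain ⟨R, hR, hRR⟩ := exists_selfAdjoint_sqrt (adjoint_blOp (B := B) (c := c) X) fun v => by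
      rw [inner_blOp]
      exact Finset.sum_nonneg fun i _ => mul_nonneg (hc i).le (by positivity)
    have hdet : |R.det| ^ 2 = (blOp B c X).det := by rw [sq_abs, ← hRR, det_comp, sq]
    choose Z hXZ hZX using fun i => exists_inverse (hX i)
    have hZd : ∀ i, (Z i).det ≠ 0 := fun i h0 => hX i (by
      rw [← det_eq_inv_of_inverse (hXZ i), h0, inv_zero])
    have hpd : ∀ i, IsPosDefMap (((Z i).comp (Z i).adjoint : H i →L[ℝ] H i) : H i →ₗ[ℝ] H i) :=
      fun i => isPosDefMap_comp_adjoint (hZd i)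
    rcases eq_or_ne R.det 0 with h0 | hRd
    · exfalso
      obtain ⟨v, hv, hv0⟩ := Submodule.exists_mem_ne_zero_of_ne_bot
        (LinearMap.bot_lt_ker_of_det_eq_zero (f := (R : E →ₗ[ℝ] E)) h0).ne'
      have hRv : R v = 0 := hv
      have h1 := inner_blOp (B := B) (c := c) X v
      rw [← hRR, ContinuousLinearMap.comp_apply, hRv, map_zero, inner_zero_right] at h1
      have h2 := (Finset.sum_eq_zero_iff_of_nonneg fun i _ =>
        mul_nonneg (hc i).le (sq_nonneg ‖X i (B i v)‖)).1 h1.symm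
      have h3 : ∀ i, B i v = 0 := fun i => by
        have h4 := (mul_eq_zero.1 (h2 i (Finset.mem_univ i))).resolve_left (hc i).ne'
        have h5 : X i (B i v) = 0 := by simpa using h4
        rw [← hZX i (B i v), h5, map_zero]
      have h6 := hD _ hpd
      rw [gaussianRatio_eq_zero hv0 h3] at h6
      exact hD0 (le_antisymm h6 bot_le)
    · obtain ⟨R', hR1, -⟩ := exists_inverse hRd
      exact ⟨|R.det|, hdet, abs_nonneg _,
        (hD _ hpd).trans (gaussianRatio_le hc hsum hX hXZ hZX hR hRR hR1 hRd)⟩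
  refine ⟨?_, fun X hX => ?_⟩
  · obtain ⟨r, -, -, hr⟩ := key (fun i => ContinuousLinearMap.id ℝ (H i))
      fun i => by simp [ContinuousLinearMap.det]
    exact (hr.trans_lt ENNReal.ofReal_lt_top).ne
  · obtain ⟨r, hr2, hr0, hr⟩ := key X hX
    have hP : 0 < ∏ i, |(X i).det| ^ c i :=
      Finset.prod_pos fun i _ => Real.rpow_pos_of_pos (abs_pos.2 (hX i)) _
    have h1 : D.toReal ≤ r / ∏ i, |(X i).det| ^ c i :=
      ENNReal.toReal_le_of_le_ofReal (by positivity) hr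
    rw [le_div_iff₀ hP] at h1
    rw [Finset.prod_pow, ← mul_pow, ← hr2]
    have := ENNReal.toReal_nonneg (a := D)
    gcongr

end GaussianInputs

section SupConvolution

variable {V : Type*} [NormedAddCommGroup V] [InnerProductSpace ℝ V] [FiniteDimensional ℝ V]
  [MeasurableSpace V] [BorelSpace V]

lemma integrable_exp_neg_mul_norm {ℓ : ℝ} (hℓ : 0 < ℓ) :
    Integrable fun x : V => Real.exp (-(ℓ * ‖x‖)) := by
  set N := Module.finrank ℝ V + 1 with hN
  have h1 : Integrable fun x : V => (1 + ‖x‖) ^ (-(N : ℝ)) :=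
    integrable_one_add_norm (by rw [hN]; push_cast; linarith)
  refine (h1.const_mul (N.factorial * Real.exp ℓ / ℓ ^ N)).mono'
    (by fun_prop) (ae_of_all _ fun x => ?_)
  have hx : 0 < 1 + ‖x‖ := by positivity
  have h2 := Real.pow_div_factorial_le_exp (ℓ * (1 + ‖x‖)) (by positivity) N
  rw [Real.norm_of_nonneg (Real.exp_pos _).le, Real.rpow_neg hx.le, Real.rpow_natCast,
    Real.exp_neg, ← one_div, ← div_eq_mul_inv, div_div, div_le_div_iff₀ (by positivity)
      (by positivity), one_mul]
  rw [mul_pow, mul_add, mul_one, Real.exp_add, div_le_iff₀ (by positivity)] at h2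
  linarith

/-- The sup-convolution of the push-forward of `F` under `T` with `exp (-ℓ‖·‖)`. -/
noncomputable def supConv {X : Type*} (F : X → ℝ) (T : X → V) (ℓ : ℝ) (z : V) : ℝ :=
  ⨆ x, F x * Real.exp (-(ℓ * ‖z - T x‖))

variable {X : Type*} {F : X → ℝ} {T : X → V} {M ℓ : ℝ}

lemma supConv_term_le (hF : ∀ x, 0 ≤ F x) (hM : ∀ x, F x ≤ M) (hℓ : 0 ≤ ℓ) (z : V) (x : X) :
    F x * Real.exp (-(ℓ * ‖z - T x‖)) ≤ M := by
  refine (mul_le_of_le_one_right (hF x) ?_).trans (hM x)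
  rw [Real.exp_le_one_iff, neg_nonpos]
  positivity

lemma bddAbove_supConv (hF : ∀ x, 0 ≤ F x) (hM : ∀ x, F x ≤ M) (hℓ : 0 ≤ ℓ) (z : V) :
    BddAbove (Set.range fun x => F x * Real.exp (-(ℓ * ‖z - T x‖))) :=
  ⟨M, Set.forall_mem_range.2 fun x => supConv_term_le hF hM hℓ z x⟩

lemma le_supConv (hF : ∀ x, 0 ≤ F x) (hM : ∀ x, F x ≤ M) (hℓ : 0 ≤ ℓ) (z : V) (x : X) :
    F x * Real.exp (-(ℓ * ‖z - T x‖)) ≤ supConv F T ℓ z :=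
  le_ciSup (bddAbove_supConv hF hM hℓ z) x

lemma supConv_le [Nonempty X] (hF : ∀ x, 0 ≤ F x) (hM : ∀ x, F x ≤ M) (hℓ : 0 ≤ ℓ) (z : V) :
    supConv F T ℓ z ≤ M :=
  ciSup_le fun x => supConv_term_le hF hM hℓ z x

lemma supConv_anti [Nonempty X] (hF : ∀ x, 0 ≤ F x) (hM : ∀ x, F x ≤ M) (hℓ : 0 ≤ ℓ) {ℓ' : ℝ}
    (h : ℓ ≤ ℓ') (z : V) : supConv F T ℓ' z ≤ supConv F T ℓ z := by
  refine ciSup_le fun x => le_trans ?_ (le_supConv hF hM hℓ z x)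
  have := hF x
  gcongr

lemma logLip_supConv (hF : ∀ x, 0 ≤ F x) (hM : ∀ x, F x ≤ M) (hF0 : ∃ x, 0 < F x) (hℓ : 0 ≤ ℓ) :
    LogLip ℓ (supConv F T ℓ) where
  nonneg := hℓ
  pos z := by
    obtain ⟨x, hx⟩ := hF0
    exact (mul_pos hx (Real.exp_pos _)).trans_le (le_supConv hF hM hℓ z x)
  le z w := by
    obtain ⟨x₀, -⟩ := hF0
    have : Nonempty X := ⟨x₀⟩
    refine ciSup_le fun x => ?_
    calc F x * Real.exp (-(ℓ * ‖z - T x‖))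
        ≤ F x * (Real.exp (-(ℓ * ‖w - T x‖)) * Real.exp (ℓ * ‖z - w‖)) := by
          rw [← Real.exp_add]
          refine mul_le_mul_of_nonneg_left (Real.exp_le_exp.2 ?_) (hF x)
          have h : ‖w - T x‖ ≤ ‖z - w‖ + ‖z - T x‖ := by
            rw [norm_sub_rev z w]
            exact norm_sub_le_norm_sub_add_norm_sub w z (T x)
          nlinarith
      _ ≤ supConv F T ℓ w * Real.exp (ℓ * ‖z - w‖) := by
          rw [← mul_assoc]
          exact mul_le_mul_of_nonneg_right (le_supConv hF hM hℓ w x) (Real.exp_pos _).le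

lemma integrable_supConv (hF : ∀ x, 0 ≤ F x) (hM : ∀ x, F x ≤ M) (hF0 : ∃ x, 0 < F x)
    (hℓ : 0 < ℓ) {R : ℝ} (hR : ∀ x, F x ≠ 0 → ‖T x‖ ≤ R) : Integrable (supConv F T ℓ) := by
  have hL := logLip_supConv (T := T) hF hM hF0 hℓ.le
  obtain ⟨x₀, hx₀⟩ := hF0
  have : Nonempty X := ⟨x₀⟩
  have hM0 : 0 ≤ M := (hF x₀).trans (hM x₀)
  refine ((integrable_exp_neg_mul_norm (V := V) hℓ).const_mul (M * Real.exp (ℓ * R))).mono'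
    hL.continuous.aestronglyMeasurable (ae_of_all _ fun z => ?_)
  rw [Real.norm_of_nonneg (hL.pos z).le]
  refine ciSup_le fun x => ?_
  by_cases hx : F x = 0
  · rw [hx, zero_mul]; positivity
  rw [mul_assoc, ← Real.exp_add]
  refine mul_le_mul (hM x) (Real.exp_le_exp.2 ?_) (Real.exp_pos _).le hM0
  have h := norm_sub_norm_le z (T x)
  have h2 := hR x hx
  nlinarith

/-- The sup-convolutions of an upper semicontinuous function decrease to its push-forward. -/
lemma eventually_supConv_le [TopologicalSpace X] [Nonempty X] (hF : ∀ x, 0 ≤ F x)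
    (hM : ∀ x, F x ≤ M) {K : Set X} (hK : IsCompact K) (hFK : ∀ x, x ∉ K → F x = 0)
    (hFs : UpperSemicontinuous F) (hT : Continuous T) {z : V} {s : ℝ} (hs : 0 < s)
    (hz : ∀ x, T x = z → F x < s) : ∀ᶠ ℓ in atTop, supConv F T ℓ z ≤ s := by
  have hK' : IsCompact (T '' (K ∩ F ⁻¹' Set.Ici s)) :=
    ((hFs.upperSemicontinuousOn K).isCompact_inter_preimage_Ici hK s).image hT
  have hzK : z ∈ (T '' (K ∩ F ⁻¹' Set.Ici s))ᶜ := by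
    rintro ⟨x, ⟨-, hx⟩, hxz⟩
    exact (hz x hxz).not_ge hx
  obtain ⟨δ, hδ, hball⟩ := Metric.isOpen_iff.1 hK'.isClosed.isOpen_compl z hzK
  have hlim : Tendsto (fun ℓ : ℝ => M * Real.exp (-(ℓ * δ))) atTop (𝓝 (M * 0)) :=
    (Real.tendsto_exp_neg_atTop_nhds_zero.comp (tendsto_id.atTop_mul_const hδ)).const_mul M
  rw [mul_zero] at hlim
  filter_upwards [hlim.eventually_le_const hs, eventually_ge_atTop 0] with ℓ h1 h2
  refine ciSup_le fun x => ?_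
  by_cases hx : F x < s
  · refine (mul_le_of_le_one_right (hF x) ?_).trans hx.le
    rw [Real.exp_le_one_iff, neg_nonpos]
    positivity
  · refine le_trans (mul_le_mul (hM x) (Real.exp_le_exp.2 (neg_le_neg ?_)) (Real.exp_pos _).le
      ((hF x).trans (hM x))) h1
    have hxK : x ∈ K := by
      by_contra h
      exact hx (by rwa [hFK x h])
    refine mul_le_mul_of_nonneg_left ?_ h2
    by_contra hlt
    refine hball (a := T x) ?_ ⟨x, ⟨hxK, not_lt.1 hx⟩, rfl⟩
    rw [Metric.mem_ball, dist_comm, dist_eq_norm]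
    exact not_le.1 hlt

end SupConvolution

section Regularization

variable {V : Type*} [NormedAddCommGroup V] [InnerProductSpace ℝ V] [FiniteDimensional ℝ V]
  [MeasurableSpace V] [BorelSpace V]

lemma UpperSemicontinuous.indicator_of_isClosed {X : Type*} [TopologicalSpace X] {g : X → ℝ}
    (hg : UpperSemicontinuous g) (hg0 : ∀ x, 0 ≤ g x) {K : Set X} (hK : IsClosed K) :
    UpperSemicontinuous (K.indicator g) := by
  intro x y hy
  by_cases hx : x ∈ K
  · rw [Set.indicator_of_mem hx] at hy
    filter_upwards [hg x y hy] with x' hx'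
    exact (Set.indicator_le_self' (fun a _ => hg0 a) x').trans_lt hx'
  · rw [Set.indicator_of_notMem hx] at hy
    filter_upwards [hK.isOpen_compl.mem_nhds hx] with x' hx'
    rwa [Set.indicator_of_notMem hx']

/-- Approximation from below by bounded upper semicontinuous functions of bounded support. -/
lemma exists_upperSemicontinuous_lt_integral {f : V → ℝ} (hf0 : ∀ x, 0 ≤ f x) (hf : Integrable f)
    {t : ℝ} (ht : t < ∫ x, f x) :
    ∃ (h : V → ℝ) (M : ℝ), UpperSemicontinuous h ∧ (∀ x, 0 ≤ h x) ∧ (∀ x, h x ≤ f x) ∧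
      (∀ x, h x ≤ M) ∧ (∀ x, x ∉ Metric.closedBall 0 M → h x = 0) ∧ Integrable h ∧
      t < ∫ x, h x := by
  obtain ⟨g, hgf, hg, hgi, hgt⟩ := exists_upperSemicontinuous_le_integral_le
    (μ := (volume : Measure V)) (fun x => (f x).toNNReal)
    (by simpa only [Real.coe_toNNReal _ (hf0 _)] using hf) (half_pos (sub_pos.2 ht))
  simp only [Real.coe_toNNReal _ (hf0 _)] at hgt
  have hg' : UpperSemicontinuous fun x => (g x : ℝ) :=
    NNReal.continuous_coe.comp_upperSemicontinuous hg fun a b h => NNReal.coe_le_coe.2 h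
  have hlim : Tendsto (fun n : ℕ => ∫ x, (Metric.closedBall (0 : V) n).indicator
      (fun x => (g x : ℝ)) x) atTop (𝓝 (∫ x, (g x : ℝ))) := by
    refine tendsto_integral_of_dominated_convergence (fun x => (g x : ℝ))
      (fun n => (hgi.indicator Metric.isClosed_closedBall.measurableSet).aestronglyMeasurable)
      hgi (fun n => ae_of_all _ fun x => ?_) (ae_of_all _ fun x => ?_)
    · rw [Real.norm_of_nonneg (Set.indicator_nonneg (fun _ _ => NNReal.coe_nonneg _) _)]
      exact Set.indicator_le_self' (fun _ _ => NNReal.coe_nonneg _) x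
    · refine tendsto_const_nhds.congr' ?_
      obtain ⟨N, hN⟩ := exists_nat_ge ‖x‖
      filter_upwards [eventually_ge_atTop N] with n hn
      rw [Set.indicator_of_mem]
      rw [mem_closedBall_zero_iff]
      exact hN.trans (by exact_mod_cast hn)
  obtain ⟨n, hn⟩ := (hlim.eventually_const_lt (show t < _ by linarith)).exists
  obtain ⟨C, hC⟩ := (hg'.upperSemicontinuousOn (Metric.closedBall 0 n)).bddAbove_of_isCompact
    (isCompact_closedBall (0 : V) n)
  refine ⟨_, max C n, hg'.indicator_of_isClosed (fun _ => NNReal.coe_nonneg _)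
    Metric.isClosed_closedBall, Set.indicator_nonneg (fun _ _ => NNReal.coe_nonneg _),
    fun x => ?_, fun x => ?_, fun x hx => ?_,
    hgi.indicator Metric.isClosed_closedBall.measurableSet, hn⟩
  · refine (Set.indicator_le_self' (fun _ _ => NNReal.coe_nonneg _) x).trans ?_
    have := NNReal.coe_le_coe.2 (hgf x)
    rwa [Real.coe_toNNReal _ (hf0 x)] at this
  · by_cases hx : x ∈ Metric.closedBall (0 : V) n
    · rw [Set.indicator_of_mem hx]
      exact (hC ⟨x, hx, rfl⟩).trans (le_max_left _ _)
    · rw [Set.indicator_of_notMem hx]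
      exact n.cast_nonneg.trans (le_max_right C _)
  · exact Set.indicator_of_notMem (fun h => hx (Metric.closedBall_subset_closedBall
      (le_max_right _ _) h)) _

end Regularization

section GeneralInputs

variable {ι : Type*} [Fintype ι] {H : ι → Type*} {E : Type*}
  [NormedAddCommGroup E] [InnerProductSpace ℝ E] [FiniteDimensional ℝ E]
  [MeasurableSpace E] [BorelSpace E]
  [∀ i, NormedAddCommGroup (H i)] [∀ i, InnerProductSpace ℝ (H i)]
  [∀ i, FiniteDimensional ℝ (H i)] [∀ i, MeasurableSpace (H i)] [∀ i, BorelSpace (H i)]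

variable {B : ∀ i, E →L[ℝ] H i} {c : ι → ℝ} {ℓ : ℝ} {h : ∀ i, H i → ℝ} {M : ι → ℝ}

lemma upperSemicontinuous_prod_rpow (hc : ∀ i, 0 < c i) (hh0 : ∀ i x, 0 ≤ h i x)
    (hh : ∀ i, UpperSemicontinuous (h i)) :
    UpperSemicontinuous fun x : ∀ i, H i => ∏ i, h i (x i) ^ c i := by
  intro x y hy
  have hcont : Continuous fun ε : ℝ => ∏ i, (h i (x i) + ε) ^ c i :=
    continuous_finsetProd _ fun i _ => (Real.continuous_rpow_const (hc i).le).comp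
      (continuous_const.add continuous_id)
  have h1 : ∀ᶠ ε in 𝓝[>] (0 : ℝ), ∏ i, (h i (x i) + ε) ^ c i < y := by
    refine nhdsWithin_le_nhds (hcont.continuousAt.eventually_lt_const ?_)
    simpa using hy
  obtain ⟨ε, hε, hε0⟩ := (h1.and self_mem_nhdsWithin).exists
  have h2 : ∀ᶠ x' in 𝓝 x, ∀ i, h i (x' i) < h i (x i) + ε :=
    eventually_all.2 fun i => (continuous_apply i).continuousAt.eventually
      (hh i (x i) _ (lt_add_of_pos_right _ hε0))
  filter_upwards [h2] with x' hx'
  refine lt_of_le_of_lt (Finset.prod_le_prod (fun i _ => Real.rpow_nonneg (hh0 i _) _)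
    fun i _ => ?_) hε
  exact Real.rpow_le_rpow (hh0 i _) (hx' i).le (hc i).le

lemma norm_sum_smul_adjoint_le (hc : ∀ i, 0 < c i) (x : ∀ i, H i) :
    ‖∑ i, c i • (B i).adjoint (x i)‖ ≤ (1 + ∑ i, ‖B i‖) * ∑ i, c i * ‖x i‖ := by
  rw [Finset.mul_sum]
  refine norm_sum_le_of_le _ fun i _ => ?_
  rw [norm_smul, Real.norm_of_nonneg (hc i).le, mul_left_comm]
  refine mul_le_mul_of_nonneg_left (((B i).adjoint.le_opNorm _).trans ?_) (hc i).le
  refine mul_le_mul_of_nonneg_right ?_ (norm_nonneg _)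
  rw [LinearIsometryEquiv.norm_map]
  have := Finset.single_le_sum (f := fun i => ‖B i‖) (fun j _ => norm_nonneg _)
    (Finset.mem_univ i)
  linarith

lemma prod_supConv_rpow_le (hc : ∀ i, 0 < c i) (hh0 : ∀ i x, 0 ≤ h i x)
    (hM : ∀ i x, h i x ≤ M i) (hpos : ∀ i, ∃ x, 0 < h i x) (hℓ : 0 ≤ ℓ) (x : ∀ i, H i) :
    ∏ i, supConv (h i) id ((1 + ∑ j, ‖B j‖) * ℓ) (x i) ^ c i ≤
      supConv (fun y : ∀ i, H i => ∏ i, h i (y i) ^ c i)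
        (fun y => ∑ i, c i • (B i).adjoint (y i)) ℓ (∑ i, c i • (B i).adjoint (x i)) := by
  set L := 1 + ∑ j, ‖B j‖ with hL
  have hL0 : 0 ≤ L := by positivity
  have hlog : ∀ i, LogLip (L * ℓ) (supConv (h i) id (L * ℓ)) := fun i =>
    logLip_supConv (hh0 i) (hM i) (hpos i) (by positivity)
  have hF0 : ∀ y : ∀ i, H i, 0 ≤ ∏ i, h i (y i) ^ c i := fun y =>
    Finset.prod_nonneg fun i _ => Real.rpow_nonneg (hh0 i _) _
  have hFM : ∀ y : ∀ i, H i, ∏ i, h i (y i) ^ c i ≤ ∏ i, M i ^ c i := fun y =>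
    Finset.prod_le_prod (fun i _ => Real.rpow_nonneg (hh0 i _) _) fun i _ =>
      Real.rpow_le_rpow (hh0 i _) (hM i _) (hc i).le
  have key : ∀ ε ∈ Set.Ioo (0 : ℝ) 1,
      ∏ i, (ε * supConv (h i) id (L * ℓ) (x i)) ^ c i ≤
      supConv (fun y : ∀ i, H i => ∏ i, h i (y i) ^ c i)
        (fun y => ∑ i, c i • (B i).adjoint (y i)) ℓ (∑ i, c i • (B i).adjoint (x i)) := by
    rintro ε ⟨hε0, hε1⟩
    have h1 : ∀ i, ∃ a, ε * supConv (h i) id (L * ℓ) (x i) <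
        h i a * Real.exp (-(L * ℓ * ‖x i - a‖)) := fun i =>
      exists_lt_of_lt_ciSup (mul_lt_of_lt_one_left ((hlog i).pos _) hε1)
    choose a ha using h1
    calc ∏ i, (ε * supConv (h i) id (L * ℓ) (x i)) ^ c i
        ≤ ∏ i, (h i (a i) * Real.exp (-(L * ℓ * ‖x i - a i‖))) ^ c i :=
          Finset.prod_le_prod (fun i _ => Real.rpow_nonneg
            (mul_pos hε0 ((hlog i).pos _)).le _) fun i _ =>
            Real.rpow_le_rpow (mul_pos hε0 ((hlog i).pos _)).le (ha i).le (hc i).le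
      _ = (∏ i, h i (a i) ^ c i) * Real.exp (-(ℓ * (L * ∑ i, c i * ‖x i - a i‖))) := by
          rw [Finset.mul_sum, Finset.mul_sum, ← Finset.sum_neg_distrib, Real.exp_sum,
            ← Finset.prod_mul_distrib]
          refine Finset.prod_congr rfl fun i _ => ?_
          rw [Real.mul_rpow (hh0 i _) (Real.exp_pos _).le, ← Real.exp_mul]
          ring_nf
      _ ≤ (∏ i, h i (a i) ^ c i) * Real.exp (-(ℓ * ‖∑ i, c i • (B i).adjoint (x i) -
            ∑ i, c i • (B i).adjoint (a i)‖)) := by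
          refine mul_le_mul_of_nonneg_left (Real.exp_le_exp.2 (neg_le_neg
            (mul_le_mul_of_nonneg_left ?_ hℓ))) (hF0 a)
          have h2 := norm_sum_smul_adjoint_le (B := B) hc fun i => x i - a i
          simpa only [map_sub, smul_sub, Finset.sum_sub_distrib] using h2
      _ ≤ _ := le_supConv (T := fun y : ∀ i, H i => ∑ i, c i • (B i).adjoint (y i))
          hF0 hFM hℓ _ a
  have hcont : Continuous fun ε : ℝ => ∏ i, (ε * supConv (h i) id (L * ℓ) (x i)) ^ c i :=
    continuous_finsetProd _ fun i _ => (Real.continuous_rpow_const (hc i).le).comp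
      (continuous_id.mul continuous_const)
  have hlim := (hcont.tendsto 1).mono_left (nhdsWithin_le_nhds (s := Set.Iio 1))
  simp only [one_mul] at hlim
  exact le_of_tendsto hlim (mem_of_superset (Ioo_mem_nhdsLT one_pos) key)

variable {d : ℝ}

lemma prod_integral_le_lintegral_of_upperSemicontinuous
    (hNG : ∀ δ > 0, ∃ η S, 0 < η ∧ η < δ ∧ 0 ≤ S ∧ η * S ≤ δ ∧ NearGeometric B c d η S)
    (hc : ∀ i, 0 < c i)
    (hsum : ∑ i, c i * (Module.finrank ℝ (H i) : ℝ) = Module.finrank ℝ E) (hd : 0 ≤ d)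
    (hh : ∀ i, UpperSemicontinuous (h i)) (hh0 : ∀ i x, 0 ≤ h i x) (hM : ∀ i x, h i x ≤ M i)
    (hsupp : ∀ i x, x ∉ Metric.closedBall 0 (M i) → h i x = 0) (hhi : ∀ i, Integrable (h i))
    (hpos : ∀ i, 0 < ∫ x, h i x) {ψ : E → ℝ≥0∞}
    (hψ : ∀ x : ∀ i, H i, ENNReal.ofReal (∏ i, h i (x i) ^ c i) ≤
      ψ (∑ i, c i • (B i).adjoint (x i))) :
    ENNReal.ofReal (d * ∏ i, (∫ x, h i x) ^ c i) ≤ ∫⁻ z, ψ z := by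
  have hpos' : ∀ i, ∃ x, 0 < h i x := fun i => by
    by_contra! hcon
    have : h i = 0 := funext fun x => le_antisymm (hcon x) (hh0 i x)
    have h2 := hpos i
    simp [this] at h2
  set F : (∀ i, H i) → ℝ := fun y => ∏ i, h i (y i) ^ c i with hF
  set T : (∀ i, H i) → E := fun y => ∑ i, c i • (B i).adjoint (y i) with hT
  have hTc : Continuous T := by fun_prop
  have hF0 : ∀ y, 0 ≤ F y := fun y =>
    Finset.prod_nonneg fun i _ => Real.rpow_nonneg (hh0 i _) _
  have hFM : ∀ y, F y ≤ ∏ i, M i ^ c i := fun y =>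
    Finset.prod_le_prod (fun i _ => Real.rpow_nonneg (hh0 i _) _) fun i _ =>
      Real.rpow_le_rpow (hh0 i _) (hM i _) (hc i).le
  have hFpos : ∃ y, 0 < F y := by
    choose a ha using hpos'
    exact ⟨a, Finset.prod_pos fun i _ => Real.rpow_pos_of_pos (ha i) _⟩
  have hK : IsCompact (Set.univ.pi fun i => Metric.closedBall (0 : H i) (M i)) :=
    isCompact_univ_pi fun i => isCompact_closedBall _ _
  have hFK : ∀ y, y ∉ (Set.univ.pi fun i => Metric.closedBall (0 : H i) (M i)) → F y = 0 := by
    intro y hy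
    simp only [Set.mem_univ_pi, not_forall] at hy
    obtain ⟨i, hi⟩ := hy
    refine Finset.prod_eq_zero (Finset.mem_univ i) ?_
    rw [hsupp i _ hi, Real.zero_rpow (hc i).ne']
  obtain ⟨R, hR⟩ := (hK.image hTc).isBounded.exists_norm_le
  have hFR : ∀ y, F y ≠ 0 → ‖T y‖ ≤ R := fun y hy =>
    hR _ ⟨y, by_contra fun hyK => hy (hFK y hyK), rfl⟩
  set L := 1 + ∑ j, ‖B j‖ with hL
  have hL1 : 1 ≤ L := by
    have := Finset.sum_nonneg fun (j : ι) (_ : j ∈ Finset.univ) => norm_nonneg (B j)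
    linarith
  have hL0 : 0 < L := one_pos.trans_le hL1
  have hreal : ∀ ℓ : ℝ, 0 < ℓ → d * ∏ i, (∫ x, h i x) ^ c i ≤ ∫ z, supConv F T ℓ z := by
    intro ℓ hℓ
    have hLℓ : 0 < L * ℓ := mul_pos hL0 hℓ
    have hfi : ∀ i, Integrable (supConv (h i) id (L * ℓ)) := fun i =>
      integrable_supConv (R := M i) (hh0 i) (hM i) (hpos' i) hLℓ fun x hx => by
        rw [id, ← mem_closedBall_zero_iff]
        exact by_contra fun hxM => hx (hsupp i x hxM)
    refine le_trans (mul_le_mul_of_nonneg_left (Finset.prod_le_prod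
      (fun i _ => Real.rpow_nonneg (hpos i).le _) fun i _ =>
        Real.rpow_le_rpow (hpos i).le (integral_mono (hhi i) (hfi i) fun x => ?_) (hc i).le) hd)
      (prod_integral_le_of_nearGeometric (ℓ := L * ℓ) hNG hc hsum
        (fun i => logLip_supConv (hh0 i) (hM i) (hpos' i) hLℓ.le)
        ((logLip_supConv hF0 hFM hFpos hℓ.le).mono (le_mul_of_one_le_left hℓ.le hL1))
        (integrable_supConv hF0 hFM hFpos hℓ hFR) (fun z => supConv_le hF0 hFM hℓ.le z) hfi
        fun x => prod_supConv_rpow_le hc hh0 hM hpos' hℓ.le x)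
    have := le_supConv (T := id) (hh0 i) (hM i) hLℓ.le x x
    simpa using this
  set g : ℕ → E → ℝ≥0∞ := fun m z => ENNReal.ofReal (supConv F T (m + 1) z) with hg
  have hgL : ∀ m : ℕ, LogLip (m + 1 : ℝ) (supConv F T (m + 1)) := fun m =>
    logLip_supConv hF0 hFM hFpos (by positivity)
  have hgint : ∀ m, ∫⁻ z, g m z = ENNReal.ofReal (∫ z, supConv F T (m + 1) z) := fun m =>
    (ofReal_integral_eq_lintegral_ofReal
      (integrable_supConv hF0 hFM hFpos (by positivity) hFR)
      (ae_of_all _ fun z => ((hgL m).pos z).le)).symm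
  have hanti : Antitone g := fun m m' hm z =>
    ENNReal.ofReal_le_ofReal (supConv_anti hF0 hFM (by positivity)
      (by have : (m : ℝ) ≤ m' := by exact_mod_cast hm
          linarith) z)
  have hlim : ∫⁻ z, ⨅ m, g m z = ⨅ m, ∫⁻ z, g m z :=
    lintegral_iInf (fun m => (hgL m).continuous.measurable.ennreal_ofReal) hanti
      (by rw [hgint]; exact ENNReal.ofReal_ne_top)
  calc ENNReal.ofReal (d * ∏ i, (∫ x, h i x) ^ c i) ≤ ⨅ m, ∫⁻ z, g m z :=
        le_iInf fun m => by
          rw [hgint]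
          exact ENNReal.ofReal_le_ofReal (hreal _ (by positivity))
    _ = ∫⁻ z, ⨅ m, g m z := hlim.symm
    _ ≤ ∫⁻ z, ψ z := lintegral_mono fun z => ?_
  refine le_of_forall_gt fun s hs => ?_
  obtain ⟨r, hr0, hr1⟩ := ENNReal.lt_iff_exists_nnreal_btwn.1 hs
  have hr : (0 : ℝ) < r := by
    rw [NNReal.coe_pos, ← ENNReal.coe_pos]
    exact bot_le.trans_lt hr0
  have hev := eventually_supConv_le hF0 hFM hK hFK (upperSemicontinuous_prod_rpow hc hh0 hh) hTc
    (z := z) hr fun y hy => by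
      have h1 := (hψ y).trans_lt (show ψ (T y) < r by rwa [hy])
      rwa [← ENNReal.ofReal_coe_nnreal, ENNReal.ofReal_lt_ofReal_iff hr] at h1
  have hnat : Tendsto (fun m : ℕ => (m : ℝ) + 1) atTop atTop :=
    tendsto_atTop_add_const_right _ _ tendsto_natCast_atTop_atTop
  obtain ⟨m, hm⟩ := (hnat.eventually hev).exists
  refine (iInf_le _ m).trans_lt (lt_of_le_of_lt ?_ hr1)
  rw [← ENNReal.ofReal_coe_nnreal]
  exact ENNReal.ofReal_le_ofReal hm

/-- The reverse Brascamp-Lieb inequality with a constant admissible for Gaussian inputs. -/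
theorem GaussianBound.prod_integral_le_lintegral (hB : GaussianBound B c d) (hd : 0 < d)
    (hc : ∀ i, 0 < c i)
    (hsum : ∑ i, c i * (Module.finrank ℝ (H i) : ℝ) = Module.finrank ℝ E)
    {f : ∀ i, H i → ℝ} (hf0 : ∀ i x, 0 ≤ f i x) (hf : ∀ i, Integrable (f i)) {ψ : E → ℝ≥0∞}
    (hψ : ∀ x : ∀ i, H i, ENNReal.ofReal (∏ i, f i (x i) ^ c i) ≤
      ψ (∑ i, c i • (B i).adjoint (x i))) :
    ENNReal.ofReal (d * ∏ i, (∫ x, f i x) ^ c i) ≤ ∫⁻ z, ψ z := by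
  have hfint : ∀ i, 0 ≤ ∫ x, f i x := fun i => integral_nonneg (hf0 i)
  by_cases hz : ∃ i, ∫ x, f i x = 0
  · obtain ⟨i, hi⟩ := hz
    rw [Finset.prod_eq_zero (Finset.mem_univ i) (by rw [hi, Real.zero_rpow (hc i).ne'])]
    simp
  push Not at hz
  have hpos : ∀ i, 0 < ∫ x, f i x := fun i => (hfint i).lt_of_ne' (hz i)
  have key : ∀ θ ∈ Set.Ioo (0 : ℝ) 1,
      ENNReal.ofReal (d * ∏ i, (θ * ∫ x, f i x) ^ c i) ≤ ∫⁻ z, ψ z := by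
    rintro θ ⟨hθ0, hθ1⟩
    choose h M hh hh0 hhf hM hsupp hhi hlt using fun i =>
      exists_upperSemicontinuous_lt_integral (hf0 i) (hf i)
        (mul_lt_of_lt_one_left (hpos i) hθ1)
    have hθ : ∀ i, 0 ≤ θ * ∫ x, f i x := fun i => mul_nonneg hθ0.le (hfint i)
    refine le_trans (ENNReal.ofReal_le_ofReal ?_)
      (prod_integral_le_lintegral_of_upperSemicontinuous (hB.exists_nearGeometric hd hc hsum)
        hc hsum hd.le hh hh0 hM hsupp hhi (fun i => (hθ i).trans_lt (hlt i))
        fun x => le_trans (ENNReal.ofReal_le_ofReal ?_) (hψ x))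
    · exact mul_le_mul_of_nonneg_left (Finset.prod_le_prod (fun i _ => Real.rpow_nonneg (hθ i) _)
        fun i _ => Real.rpow_le_rpow (hθ i) (hlt i).le (hc i).le) hd.le
    · exact Finset.prod_le_prod (fun i _ => Real.rpow_nonneg (hh0 i _) _)
        fun i _ => Real.rpow_le_rpow (hh0 i _) (hhf i _) (hc i).le
  have hcont : Continuous fun θ : ℝ => ENNReal.ofReal (d * ∏ i, (θ * ∫ x, f i x) ^ c i) :=
    ENNReal.continuous_ofReal.comp (continuous_const.mul (continuous_finsetProd _ fun i _ =>
      (Real.continuous_rpow_const (hc i).le).comp (continuous_id.mul continuous_const)))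
  have hlim := (hcont.tendsto 1).mono_left (nhdsWithin_le_nhds (s := Set.Iio 1))
  simp only [one_mul] at hlim
  exact le_of_tendsto hlim (mem_of_superset (Ioo_mem_nhdsLT one_pos) key)

/-- The reverse Brascamp-Lieb inequality with a constant below all Gaussian ratios. -/
theorem mul_prod_lintegral_le_outerLintegral (hc : ∀ i, 0 < c i)
    (hsum : ∑ i, c i * (Module.finrank ℝ (H i) : ℝ) = Module.finrank ℝ E) {D : ℝ≥0∞}
    (hD : ∀ A : ∀ i, H i →ₗ[ℝ] H i, (∀ i, IsPosDefMap (A i)) → D ≤ gaussianRatio B c A)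
    {f : ∀ i, H i → ℝ} (hf0 : ∀ i x, 0 ≤ f i x) (hf : ∀ i, Integrable (f i)) :
    D * ∏ i, (∫⁻ z, ENNReal.ofReal (f i z)) ^ c i ≤ outerLintegral volume fun x : E =>
      ⨆ (y : ∀ i, H i) (_ : x = ∑ i, c i • (B i).adjoint (y i)),
        ∏ i, ENNReal.ofReal (f i (y i)) ^ c i := by
  rcases eq_or_ne D 0 with rfl | hD0
  · simp
  obtain ⟨hDtop, hB⟩ := gaussianBound_of_le_gaussianRatio hc hsum hD hD0
  have hfint : ∀ i, ∫⁻ z, ENNReal.ofReal (f i z) = ENNReal.ofReal (∫ z, f i z) := fun i =>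
    (ofReal_integral_eq_lintegral_ofReal (hf i) (ae_of_all _ (hf0 i))).symm
  simp only [hfint]
  rw [prod_ofReal_rpow (fun i => integral_nonneg (hf0 i)) hc, ← ENNReal.ofReal_toReal hDtop,
    ← ENNReal.ofReal_mul ENNReal.toReal_nonneg]
  refine le_iInf fun ψ => le_iInf fun _ => le_iInf fun hψ => ?_
  refine hB.prod_integral_le_lintegral (ENNReal.toReal_pos hD0 hDtop) hc hsum hf0 hf fun x => ?_
  rw [← prod_ofReal_rpow (fun i => hf0 i _) hc]
  refine le_trans ?_ (hψ _)
  exact le_iSup_of_le x (le_iSup_of_le rfl le_rfl)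

end GeneralInputs

end ReverseBrascampLieb

/-- Barthe's general Reverse Brascamp--Lieb inequality: for a Brascamp--Lieb datum given
by surjective linear maps `Bᵢ : ℝⁿ → Hᵢ` onto `nᵢ`-dimensional Euclidean spaces and
`cᵢ > 0` with `∑ᵢ cᵢnᵢ = n`, and for non-negative `fᵢ ∈ L¹(Hᵢ)`,
`∫*_{ℝⁿ} sup{∏ᵢ fᵢ(xᵢ)^{cᵢ} : x = ∑ᵢ cᵢ Bᵢ^* xᵢ, xᵢ ∈ Hᵢ} dx ≥ D ∏ᵢ (∫_{Hᵢ} fᵢ)^{cᵢ}`,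
where `D` is the infimum of the corresponding ratios over all centered Gaussian inputs
`fᵢ(x) = e^{-⟪Aᵢx, x⟫}` with `Aᵢ` positive definite. -/
theorem general_reverse_brascamp_lieb
    {n k : ℕ} (H : Fin k → Type*)
    [∀ i, NormedAddCommGroup (H i)] [∀ i, InnerProductSpace ℝ (H i)]
    [∀ i, FiniteDimensional ℝ (H i)] [∀ i, MeasurableSpace (H i)] [∀ i, BorelSpace (H i)]
    (hH : ∀ i, 1 ≤ Module.finrank ℝ (H i))
    (B : ∀ i, EuclideanSpace ℝ (Fin n) →ₗ[ℝ] H i)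
    (hB : ∀ i, Function.Surjective (B i))
    (c : Fin k → ℝ) (hc : ∀ i, 0 < c i)
    (hsum : ∑ i, c i * (Module.finrank ℝ (H i) : ℝ) = (n : ℝ))
    (f : ∀ i, H i → ℝ) (hf0 : ∀ i x, 0 ≤ f i x) (hf : ∀ i, Integrable (f i)) :
    (⨅ (A : ∀ i, H i →ₗ[ℝ] H i) (_ : ∀ i, IsPosDefMap (A i)),
      (outerLintegral volume fun x =>
        ⨆ (y : ∀ i, H i)
          (_ : x = ∑ i, c i • (LinearMap.adjoint (B i)) (y i)),
          ∏ i, ENNReal.ofReal (Real.exp (-⟪A i (y i), y i⟫)) ^ (c i)) /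
        ∏ i, (∫⁻ z, ENNReal.ofReal (Real.exp (-⟪A i z, z⟫))) ^ (c i)) *
      ∏ i, (∫⁻ z, ENNReal.ofReal (f i z)) ^ (c i) ≤
    outerLintegral volume fun x =>
      ⨆ (y : ∀ i, H i) (_ : x = ∑ i, c i • (LinearMap.adjoint (B i)) (y i)),
        ∏ i, ENNReal.ofReal (f i (y i)) ^ (c i) := by
  have hadj : ∀ (i : Fin k) (y : H i),
      (LinearMap.toContinuousLinearMap (B i)).adjoint y = LinearMap.adjoint (B i) y :=
    fun _ _ => rfl
  have h := mul_prod_lintegral_le_outerLintegral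
    (B := fun i => LinearMap.toContinuousLinearMap (B i)) hc
    (hsum.trans (by rw [finrank_euclideanSpace_fin]))
    (D := ⨅ (A : ∀ i, H i →ₗ[ℝ] H i) (_ : ∀ i, IsPosDefMap (A i)),
      gaussianRatio (fun i => LinearMap.toContinuousLinearMap (B i)) c A)
    (fun A hA => iInf₂_le A hA) hf0 hf
  simpa only [gaussianRatio, hadj] using h
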